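/- arXiv:1710.05485 — 5 statements merged into one kernel-verified Lean document; each statement's English description precedes it below -/
import Mathlib

section
/- Let a, b, d be positive real constants and let c satisfy 0 ≤ c < 2√(abd). Then the boundary value problem dχ''(s) - cχ'(s) + aχ(s)(b - χ(s)) = 0 for s ∈ (0,∞), χ(0) = 0, has a unique bounded positive solution χ (i.e. χ is twice continuously differentiable on [0,∞), satisfies the equation on (0,∞), χ(0) = 0, χ(s) > 0 for s > 0, and χ is bounded). Moreover this χ is strictly increasing on [0,∞), χ(s) → b as s → ∞, and there exists a constant b_χ > 0 such that (b - χ(s))·e^{-λs} → b_χ as s → ∞, where λ = (c - √(c² + 4abd))/(2d). -/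
open Real Filter Set

/-- `χ` is a bounded positive solution of the Fisher-KPP problem
`d χ'' - c χ' + a χ (b - χ) = 0` on `(0,∞)`, `χ(0) = 0`. -/
structure IsKPPSolution (a b c d : ℝ) (χ : ℝ → ℝ) : Prop where
  smooth : ContDiffOn ℝ 2 χ (Set.Ici 0)
  init : χ 0 = 0
  ode : ∀ s > (0:ℝ), d * deriv (deriv χ) s - c * deriv χ s + a * χ s * (b - χ s) = 0
  pos : ∀ s > (0:ℝ), 0 < χ s
  bounded : ∃ M : ℝ, ∀ s ≥ (0:ℝ), |χ s| ≤ M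


open scoped NNReal BoundedContinuousFunction

theorem kpp_integral_bound {E : Type*} [NormedAddCommGroup E] [NormedSpace ℝ E]
    (f : ℝ → E) (C L s : ℝ) (hC : 0 ≤ C) (hL : 0 < L) (hs : 0 ≤ s)
    (hb : ∀ t, 0 ≤ t → ‖f t‖ ≤ C * Real.exp (L * t)) :
    ‖∫ t in (0:ℝ)..s, f t‖ ≤ C * Real.exp (L * s) / L := by
  have hd : ∀ t : ℝ, HasDerivAt (fun t => C * Real.exp (L * t) / L) (C * Real.exp (L * t)) t := by
    intro t
    have h1 : HasDerivAt (fun t : ℝ => L * t) L t := by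
      simpa using (hasDerivAt_id t).const_mul L
    have h2 := ((h1.exp).const_mul C).div_const L
    refine h2.congr_deriv ?_
    field_simp
  have hint : ∫ t in (0:ℝ)..s, C * Real.exp (L * t)
      = C * Real.exp (L * s) / L - C * Real.exp (L * 0) / L := by
    apply intervalIntegral.integral_eq_sub_of_hasDerivAt (fun t _ => hd t)
    apply Continuous.intervalIntegrable
    fun_prop
  have h3 : ‖∫ t in (0:ℝ)..s, f t‖ ≤ ∫ t in (0:ℝ)..s, C * Real.exp (L * t) := by
    apply intervalIntegral.norm_integral_le_of_norm_le hs
    · filter_upwards with t ht using hb t ht.1.le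
    · apply Continuous.intervalIntegrable
      fun_prop
  rw [hint] at h3
  have : 0 ≤ C * Real.exp (L * 0) / L := by positivity
  linarith

theorem kpp_global_ode {E : Type*} [NormedAddCommGroup E] [NormedSpace ℝ E] [CompleteSpace E]
    (X : E → E) (K : ℝ≥0) (hK : 0 < K) (hX : LipschitzWith K X) (h0 : X 0 = 0) (x0 : E) :
    ∃ γ : ℝ → E, γ 0 = x0 ∧ ∀ s, 0 ≤ s → HasDerivAt γ (X (γ s)) s := by
  have hKr : (0:ℝ) < K := by exact_mod_cast hK
  set L : ℝ := 2 * K with hLdef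
  have hL : 0 < L := by positivity
  have hXb : ∀ y, ‖X y‖ ≤ K * ‖y‖ := by
    intro y
    have := hX.dist_le_mul y 0
    simpa [h0, dist_eq_norm] using this
  have hXc : Continuous X := hX.continuous
  let G : (ℝ →ᵇ E) → ℝ → E := fun U t => X (Real.exp (L * t) • U t)
  have hGc : ∀ U, Continuous (G U) := by
    intro U
    have := U.continuous
    show Continuous (fun t => X (Real.exp (L * t) • U t))
    fun_prop
  let Γ : (ℝ →ᵇ E) → ℝ → E := fun U s => x0 + ∫ t in (0:ℝ)..s, G U t
  have hΓd : ∀ U s, HasDerivAt (Γ U) (G U s) s := by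
    intro U s
    exact ((hGc U).integral_hasStrictDerivAt 0 s).hasDerivAt.const_add x0
  have hΓc : ∀ U, Continuous (Γ U) := fun U =>
    continuous_iff_continuousAt.2 fun s => (hΓd U s).continuousAt
  have hexp1 : ∀ s : ℝ, 0 ≤ s → Real.exp (-(L * s)) ≤ 1 := by
    intro s hs
    apply Real.exp_le_one_iff.2
    have := mul_nonneg hL.le hs
    linarith
  let F : (ℝ →ᵇ E) → (ℝ →ᵇ E) := fun U =>
    BoundedContinuousFunction.ofNormedAddCommGroup
      (fun s => Real.exp (-(L * max s 0)) • Γ U (max s 0))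
      (by have := hΓc U; fun_prop) (‖x0‖ + K * ‖U‖ / L) (by
        intro s
        have hs : 0 ≤ max s 0 := le_max_right _ _
        generalize max s 0 = r at hs
        rw [norm_smul, Real.norm_eq_abs, abs_of_pos (Real.exp_pos _)]
        have h1 : ‖∫ t in (0:ℝ)..r, G U t‖ ≤ (K * ‖U‖) * Real.exp (L * r) / L := by
          apply kpp_integral_bound _ _ _ _ (by positivity) hL hs
          intro t ht
          refine (hXb _).trans ?_
          rw [norm_smul, Real.norm_eq_abs, abs_of_pos (Real.exp_pos _)]
          have := U.norm_coe_le_norm t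
          calc (K:ℝ) * (Real.exp (L * t) * ‖U t‖) ≤ K * (Real.exp (L * t) * ‖U‖) := by gcongr
            _ = _ := by ring
        calc Real.exp (-(L * r)) * ‖Γ U r‖
            ≤ Real.exp (-(L * r)) * (‖x0‖ + (K * ‖U‖) * Real.exp (L * r) / L) := by
              gcongr
              exact (norm_add_le _ _).trans (by gcongr)
          _ = Real.exp (-(L * r)) * ‖x0‖
              + (Real.exp (-(L * r)) * Real.exp (L * r)) * (K * ‖U‖ / L) := by ring
          _ ≤ 1 * ‖x0‖ + 1 * (K * ‖U‖ / L) := by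
              rw [← Real.exp_add]
              simp only [neg_add_cancel, Real.exp_zero]
              gcongr
              exact hexp1 r hs
          _ = _ := by ring)
  have hFapp : ∀ U s, 0 ≤ s → F U s = Real.exp (-(L * s)) • Γ U s := by
    intro U s hs
    show Real.exp (-(L * max s 0)) • Γ U (max s 0) = _
    rw [max_eq_left hs]
  have hcontr : ContractingWith (1/2 : ℝ≥0) F := by
    refine ⟨by norm_num, LipschitzWith.of_dist_le_mul ?_⟩
    intro U V
    rw [BoundedContinuousFunction.dist_le (by positivity)]
    intro s
    have hs : 0 ≤ max s 0 := le_max_right _ _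
    show dist (Real.exp (-(L * max s 0)) • Γ U (max s 0))
      (Real.exp (-(L * max s 0)) • Γ V (max s 0)) ≤ _
    generalize max s 0 = r at hs
    rw [dist_eq_norm, ← smul_sub, norm_smul, Real.norm_eq_abs, abs_of_pos (Real.exp_pos _)]
    have h1 : Γ U r - Γ V r = ∫ t in (0:ℝ)..r, (G U t - G V t) := by
      rw [intervalIntegral.integral_sub ((hGc U).intervalIntegrable _ _)
        ((hGc V).intervalIntegrable _ _)]
      simp [Γ]
    have h2 : ‖∫ t in (0:ℝ)..r, (G U t - G V t)‖ ≤ (K * dist U V) * Real.exp (L * r) / L := by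
      apply kpp_integral_bound _ _ _ _ (by positivity) hL hs
      intro t ht
      have h3 := hX.dist_le_mul (Real.exp (L * t) • U t) (Real.exp (L * t) • V t)
      rw [dist_eq_norm, dist_eq_norm, ← smul_sub, norm_smul, Real.norm_eq_abs,
        abs_of_pos (Real.exp_pos _)] at h3
      refine h3.trans ?_
      have := BoundedContinuousFunction.dist_coe_le_dist (f := U) (g := V) t
      rw [dist_eq_norm] at this
      calc (K:ℝ) * (Real.exp (L * t) * ‖U t - V t‖) ≤ K * (Real.exp (L * t) * dist U V) := by
            gcongr
        _ = _ := by ring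
    rw [h1]
    calc Real.exp (-(L * r)) * ‖∫ t in (0:ℝ)..r, (G U t - G V t)‖
        ≤ Real.exp (-(L * r)) * ((K * dist U V) * Real.exp (L * r) / L) := by gcongr
      _ = (Real.exp (-(L * r)) * Real.exp (L * r)) * (K / L) * dist U V := by ring
      _ = _ := by
        rw [← Real.exp_add, hLdef]
        simp only [neg_add_cancel, Real.exp_zero]
        have : (K:ℝ) / (2 * K) = 1 / 2 := by field_simp
        rw [this]; simp
  obtain ⟨U, hU⟩ : ∃ U, F U = U := ⟨_, hcontr.fixedPoint_isFixedPt⟩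
  refine ⟨Γ U, by simp [Γ], ?_⟩
  intro s hs
  have h1 := hΓd U s
  have h2 : Real.exp (L * s) • U s = Γ U s := by
    have : U s = Real.exp (-(L * s)) • Γ U s := by
      conv_lhs => rw [← hU]
      exact hFapp U s hs
    rw [this, smul_smul, ← Real.exp_add]
    simp
  have h3 : G U s = X (Γ U s) := by
    show X (Real.exp (L * s) • U s) = _
    rw [h2]
  rwa [h3] at h1

/-- first-order system form on `[0,∞)` -/
def KppSys (κ : ℝ) (φ χ v : ℝ → ℝ) : Prop :=
  ∀ s, 0 ≤ s → HasDerivWithinAt χ (v s) (Ici 0) s ∧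
    HasDerivWithinAt v (κ * v s - φ (χ s)) (Ici 0) s

theorem kpp_mono {f f' : ℝ → ℝ} (hf : ∀ s, 0 ≤ s → HasDerivWithinAt f (f' s) (Ici 0) s)
    {t0 t1 : ℝ} (h0 : 0 ≤ t0) (h01 : t0 ≤ t1) (h : ∀ s ∈ Ioo t0 t1, 0 ≤ f' s) : f t0 ≤ f t1 := by
  have hm : MonotoneOn f (Icc t0 t1) := by
    apply monotoneOn_of_hasDerivWithinAt_nonneg (convex_Icc t0 t1) (f' := f')
    · intro s hs
      exact (hf s (h0.trans hs.1)).continuousWithinAt.mono (fun x hx => h0.trans hx.1)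
    · intro s hs
      rw [interior_Icc] at hs ⊢
      exact (hf s (h0.trans hs.1.le)).mono (fun x hx => h0.trans hx.1.le)
    · intro s hs
      rw [interior_Icc] at hs
      exact h s hs
  exact hm (left_mem_Icc.2 h01) (right_mem_Icc.2 h01) h01

theorem kpp_mono_lt {f f' : ℝ → ℝ} (hf : ∀ s, 0 ≤ s → HasDerivWithinAt f (f' s) (Ici 0) s)
    {t0 t1 : ℝ} (h0 : 0 ≤ t0) (h01 : t0 < t1) (h : ∀ s ∈ Ioo t0 t1, 0 < f' s) : f t0 < f t1 := by
  have hm : StrictMonoOn f (Icc t0 t1) := by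
    apply strictMonoOn_of_hasDerivWithinAt_pos (convex_Icc t0 t1) (f' := f')
    · intro s hs
      exact (hf s (h0.trans hs.1)).continuousWithinAt.mono (fun x hx => h0.trans hx.1)
    · intro s hs
      rw [interior_Icc] at hs ⊢
      exact (hf s (h0.trans hs.1.le)).mono (fun x hx => h0.trans hx.1.le)
    · intro s hs
      rw [interior_Icc] at hs
      exact h s hs
  exact hm (left_mem_Icc.2 h01.le) (right_mem_Icc.2 h01.le) h01

theorem kpp_anti {f f' : ℝ → ℝ} (hf : ∀ s, 0 ≤ s → HasDerivWithinAt f (f' s) (Ici 0) s)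
    {t0 t1 : ℝ} (h0 : 0 ≤ t0) (h01 : t0 ≤ t1) (h : ∀ s ∈ Ioo t0 t1, f' s ≤ 0) : f t1 ≤ f t0 := by
  have := kpp_mono (f := fun s => - f s) (f' := fun s => - f' s) (fun s hs => (hf s hs).fun_neg)
    h0 h01 (fun s hs => by have := h s hs; linarith)
  linarith

theorem kpp_anti_lt {f f' : ℝ → ℝ} (hf : ∀ s, 0 ≤ s → HasDerivWithinAt f (f' s) (Ici 0) s)
    {t0 t1 : ℝ} (h0 : 0 ≤ t0) (h01 : t0 < t1) (h : ∀ s ∈ Ioo t0 t1, f' s < 0) : f t1 < f t0 := by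
  have := kpp_mono_lt (f := fun s => - f s) (f' := fun s => - f' s) (fun s hs => (hf s hs).fun_neg)
    h0 h01 (fun s hs => by have := h s hs; linarith)
  linarith

theorem kpp_lin_lower {f f' : ℝ → ℝ} (hf : ∀ s, 0 ≤ s → HasDerivWithinAt f (f' s) (Ici 0) s)
    {t0 t1 C : ℝ} (h0 : 0 ≤ t0) (h01 : t0 ≤ t1) (h : ∀ s ∈ Ioo t0 t1, C ≤ f' s) :
    f t0 + C * (t1 - t0) ≤ f t1 := by
  have := kpp_mono (f := fun s => f s - C * s) (f' := fun s => f' s - C * 1)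
    (fun s hs => (hf s hs).fun_sub ((hasDerivWithinAt_id s _).const_mul C))
    h0 h01 (fun s hs => by have := h s hs; linarith)
  linarith

theorem kpp_lin_upper {f f' : ℝ → ℝ} (hf : ∀ s, 0 ≤ s → HasDerivWithinAt f (f' s) (Ici 0) s)
    {t0 t1 C : ℝ} (h0 : 0 ≤ t0) (h01 : t0 ≤ t1) (h : ∀ s ∈ Ioo t0 t1, f' s ≤ C) :
    f t1 ≤ f t0 + C * (t1 - t0) := by
  have := kpp_lin_lower (f := fun s => - f s) (f' := fun s => - f' s) (C := -C)
    (fun s hs => (hf s hs).fun_neg)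
    h0 h01 (fun s hs => by have := h s hs; linarith)
  linarith

/-- a function with derivative eventually at least `C > 0` is unbounded above -/
theorem kpp_unbdd {f f' : ℝ → ℝ} (hf : ∀ s, 0 ≤ s → HasDerivWithinAt f (f' s) (Ici 0) s)
    {t0 C : ℝ} (h0 : 0 ≤ t0) (hC : 0 < C) (h : ∀ s, t0 ≤ s → C ≤ f' s) (M : ℝ) :
    ∃ s, t0 ≤ s ∧ M < f s := by
  refine ⟨t0 + (|M - f t0| + 1) / C, ?_, ?_⟩
  · have : 0 ≤ (|M - f t0| + 1) / C := by positivity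
    linarith
  · have h1 : 0 ≤ (|M - f t0| + 1) / C := by positivity
    have := kpp_lin_lower hf h0 (t1 := t0 + (|M - f t0| + 1) / C) (by linarith)
      (fun s hs => h s hs.1.le)
    have h2 : C * (t0 + (|M - f t0| + 1) / C - t0) = |M - f t0| + 1 := by field_simp; ring
    rw [h2] at this
    have := le_abs_self (M - f t0)
    linarith

theorem kpp_unbdd_below {f f' : ℝ → ℝ} (hf : ∀ s, 0 ≤ s → HasDerivWithinAt f (f' s) (Ici 0) s)
    {t0 C : ℝ} (h0 : 0 ≤ t0) (hC : 0 < C) (h : ∀ s, t0 ≤ s → f' s ≤ -C) (M : ℝ) :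
    ∃ s, t0 ≤ s ∧ f s < M := by
  obtain ⟨s, hs, h1⟩ := kpp_unbdd (f := fun s => - f s) (f' := fun s => - f' s)
    (fun s hs => (hf s hs).fun_neg) h0 hC (fun s hs => by have := h s hs; linarith) (-M)
  exact ⟨s, hs, by linarith⟩

/-- first time a continuous function gets down to level `y` -/
theorem kpp_first {f : ℝ → ℝ} {t0 t1 y : ℝ} (h01 : t0 ≤ t1) (hf : ContinuousOn f (Icc t0 t1))
    (h0 : y < f t0) (h1 : f t1 ≤ y) :
    ∃ τ, t0 < τ ∧ τ ≤ t1 ∧ f τ = y ∧ ∀ s ∈ Ico t0 τ, y < f s := by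
  have hcl : IsCompact (Icc t0 t1 ∩ f ⁻¹' Iic y) :=
    (isCompact_Icc).of_isClosed_subset (hf.preimage_isClosed_of_isClosed isClosed_Icc isClosed_Iic)
      inter_subset_left
  obtain ⟨τ, ⟨hτ, hτy⟩, hmin⟩ := hcl.exists_isLeast ⟨t1, ⟨right_mem_Icc.2 h01, h1⟩⟩
  have hlt : ∀ s ∈ Ico t0 τ, y < f s := by
    intro s hs
    by_contra hcon
    exact absurd (hmin ⟨⟨hs.1, hs.2.le.trans hτ.2⟩, not_lt.1 hcon⟩) (not_le.2 hs.2)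
  have ht : t0 < τ := by
    rcases hτ.1.eq_or_lt with h | h
    · subst h; exact absurd hτy (not_le.2 h0)
    · exact h
  refine ⟨τ, ht, hτ.2, le_antisymm hτy ?_, hlt⟩
  obtain ⟨z, hz, hzy⟩ := intermediate_value_Icc' hτ.1
    (hf.mono (Icc_subset_Icc_right hτ.2)) ⟨hτy, h0.le⟩
  rcases hz.2.eq_or_lt with h | h
  · rw [← h, hzy]
  · exact absurd hzy (hlt z ⟨hz.1, h⟩).ne'

namespace KppSys

variable {κ : ℝ} {φ χ v : ℝ → ℝ}

theorem cont (h : KppSys κ φ χ v) : ContinuousOn χ (Ici 0) :=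
  fun s hs => (h s hs).1.continuousWithinAt

theorem contv (h : KppSys κ φ χ v) : ContinuousOn v (Ici 0) :=
  fun s hs => (h s hs).2.continuousWithinAt

theorem dχ (h : KppSys κ φ χ v) : ∀ s, 0 ≤ s → HasDerivWithinAt χ (v s) (Ici 0) s :=
  fun s hs => (h s hs).1

theorem dv (h : KppSys κ φ χ v) :
    ∀ s, 0 ≤ s → HasDerivWithinAt v (κ * v s - φ (χ s)) (Ici 0) s :=
  fun s hs => (h s hs).2

/-- derivative of `exp(-κ s) v` -/
theorem dg (h : KppSys κ φ χ v) : ∀ s, 0 ≤ s →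
    HasDerivWithinAt (fun s => Real.exp (-(κ * s)) * v s)
      (-(Real.exp (-(κ * s)) * φ (χ s))) (Ici 0) s := by
  intro s hs
  have h1 : HasDerivWithinAt (fun s : ℝ => -(κ * s)) (-(κ * 1)) (Ici 0) s :=
    ((hasDerivWithinAt_id s _).const_mul κ).fun_neg
  refine (h1.exp.fun_mul (h.dv s hs)).congr_deriv ?_
  ring

end KppSys

/-- vector field -/
def kppField (κ : ℝ) (φ : ℝ → ℝ) : ℝ × ℝ → ℝ × ℝ := fun x => (x.2, κ * x.2 - φ x.1)

theorem kppField_lip (κ : ℝ) (φ : ℝ → ℝ) (I : Set ℝ) (L : ℝ) (hL : 0 ≤ L)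
    (hφ : ∀ x ∈ I, ∀ y ∈ I, |φ x - φ y| ≤ L * |x - y|) :
    LipschitzOnWith (Real.toNNReal (1 + |κ| + L)) (kppField κ φ) {x | x.1 ∈ I} := by
  apply LipschitzOnWith.of_dist_le_mul
  intro x hx y hy
  rw [Real.coe_toNNReal _ (by positivity)]
  rw [Prod.dist_eq, Prod.dist_eq, Real.dist_eq, Real.dist_eq, Real.dist_eq, Real.dist_eq]
  simp only [kppField]
  set m := max |x.1 - y.1| |x.2 - y.2| with hm
  have h1 : |x.1 - y.1| ≤ m := le_max_left _ _
  have h2 : |x.2 - y.2| ≤ m := le_max_right _ _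
  have hm0 : 0 ≤ m := (abs_nonneg _).trans h1
  apply max_le
  · nlinarith [abs_nonneg κ, mul_nonneg (abs_nonneg κ) hm0, mul_nonneg hL hm0]
  · have h3 : |κ * x.2 - φ x.1 - (κ * y.2 - φ y.1)| ≤ |κ| * |x.2 - y.2| + |φ x.1 - φ y.1| := by
      rw [← abs_mul]
      have : κ * x.2 - φ x.1 - (κ * y.2 - φ y.1) = κ * (x.2 - y.2) - (φ x.1 - φ y.1) := by ring
      rw [this]
      exact abs_sub _ _
    have h4 := hφ _ hx _ hy
    have h5 : |κ| * |x.2 - y.2| ≤ |κ| * m := by gcongr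
    have h6 : L * |x.1 - y.1| ≤ L * m := by gcongr
    nlinarith

theorem KppSys.pair {κ : ℝ} {φ χ v : ℝ → ℝ} (h : KppSys κ φ χ v) (s : ℝ) (hs : 0 ≤ s) :
    HasDerivWithinAt (fun s => (χ s, v s)) (kppField κ φ (χ s, v s)) (Ici 0) s :=
  (h s hs).1.prodMk (h s hs).2

theorem KppSys.uniq {κ : ℝ} {φ χ₁ v₁ χ₂ v₂ : ℝ → ℝ} (h₁ : KppSys κ φ χ₁ v₁)
    (h₂ : KppSys κ φ χ₂ v₂) (I : Set ℝ) (L : ℝ) (hL : 0 ≤ L)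
    (hφ : ∀ x ∈ I, ∀ y ∈ I, |φ x - φ y| ≤ L * |x - y|)
    (hI₁ : ∀ s, 0 ≤ s → χ₁ s ∈ I) (hI₂ : ∀ s, 0 ≤ s → χ₂ s ∈ I)
    (t : ℝ) (ht : 0 ≤ t) (hχ : χ₁ t = χ₂ t) (hv : v₁ t = v₂ t) :
    ∀ s, 0 ≤ s → χ₁ s = χ₂ s := by
  intro s hs
  set b := max s t + 1 with hb
  have hlip := kppField_lip κ φ I L hL hφ
  have hc₁ : ContinuousOn (fun s => (χ₁ s, v₁ s)) (Icc 0 b) := fun s hs =>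
    (h₁.pair s hs.1).continuousWithinAt.mono (fun x hx => hx.1)
  have hc₂ : ContinuousOn (fun s => (χ₂ s, v₂ s)) (Icc 0 b) := fun s hs =>
    (h₂.pair s hs.1).continuousWithinAt.mono (fun x hx => hx.1)
  have hsb : s ∈ Icc 0 b := ⟨hs, by have := le_max_left s t; linarith⟩
  have key : EqOn (fun s => (χ₁ s, v₁ s)) (fun s => (χ₂ s, v₂ s)) (Icc 0 b) := by
    rcases ht.eq_or_lt with h | h
    · subst h
      apply ODE_solution_unique_of_mem_Icc_right (v := fun _ => kppField κ φ)
        (s := fun _ => {x | x.1 ∈ I}) (fun _ _ => hlip) hc₁ _ _ hc₂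
      · intro r hr
        exact (h₂.pair r hr.1).mono (Ici_subset_Ici.2 hr.1)
      · intro r hr
        exact hI₂ r hr.1
      · simp [hχ, hv]
      · intro r hr
        exact (h₁.pair r hr.1).mono (Ici_subset_Ici.2 hr.1)
      · intro r hr
        exact hI₁ r hr.1
    · apply ODE_solution_unique_of_mem_Icc (v := fun _ => kppField κ φ) (t₀ := t)
        (s := fun _ => {x | x.1 ∈ I}) (fun _ _ => hlip) _ hc₁ _ _ hc₂
      · intro r hr
        exact (h₂.pair r hr.1.le).hasDerivAt (Ici_mem_nhds hr.1)
      · intro r hr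
        exact hI₂ r hr.1.le
      · simp [hχ, hv]
      · exact ⟨h, by have := le_max_right s t; linarith⟩
      · intro r hr
        exact (h₁.pair r hr.1.le).hasDerivAt (Ici_mem_nhds hr.1)
      · intro r hr
        exact hI₁ r hr.1.le
  have := key hsb
  simpa using congrArg Prod.fst this

theorem kpp_lip (α b M : ℝ) (hα : 0 < α) (hb : 0 < b) (hM : 0 ≤ M) :
    ∀ x ∈ Icc (0:ℝ) M, ∀ y ∈ Icc (0:ℝ) M,
      |α * x * (b - x) - α * y * (b - y)| ≤ (α * (b + 2 * M)) * |x - y| := by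
  intro x hx y hy
  have : α * x * (b - x) - α * y * (b - y) = (α * (b - x - y)) * (x - y) := by ring
  rw [this, abs_mul, abs_mul, abs_of_pos hα]
  have h1 : |b - x - y| ≤ b + 2 * M := by
    rw [abs_le]; constructor <;> linarith [hx.1, hx.2, hy.1, hy.2]
  gcongr

/-- Positive bounded solution in system form. -/
structure KppPos (α b κ : ℝ) (χ v : ℝ → ℝ) : Prop where
  sys : KppSys κ (fun x => α * x * (b - x)) χ v
  hα : 0 < α
  hb : 0 < b
  hκ : 0 ≤ κ
  init : χ 0 = 0
  pos : ∀ s, 0 < s → 0 < χ s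
  bdd : ∃ M, ∀ s, 0 ≤ s → χ s ≤ M

namespace KppPos

variable {α b κ : ℝ} {χ v : ℝ → ℝ}

theorem nonneg (h : KppPos α b κ χ v) : ∀ s, 0 ≤ s → 0 ≤ χ s := by
  intro s hs
  rcases hs.eq_or_lt with h1 | h1
  · rw [← h1, h.init]
  · exact (h.pos s h1).le

theorem v_nonpos_of_ge (h : KppPos α b κ χ v) {t : ℝ} (ht : 0 ≤ t) (hχ : b ≤ χ t) : v t ≤ 0 := by
  by_contra hv
  push Not at hv
  have hα := h.hα
  have hb := h.hb
  have key : ∀ s, t ≤ s → v t / 2 ≤ v s := by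
    by_contra hcon
    push Not at hcon
    obtain ⟨s, hs, hvs⟩ := hcon
    obtain ⟨τ, h1, h2, h3, h4⟩ := kpp_first hs (h.sys.contv.mono (fun x hx => ht.trans hx.1))
      (by linarith : v t / 2 < v t) hvs.le
    have hge : ∀ r ∈ Icc t τ, b ≤ χ r := by
      intro r hr
      have := kpp_mono h.sys.dχ ht hr.1 (fun q hq => by
        have := h4 q ⟨hq.1.le, hq.2.trans_le hr.2⟩
        linarith)
      linarith
    have := kpp_mono h.sys.dv ht h1.le (fun r hr => by
      have h5 := h4 r ⟨hr.1.le, hr.2⟩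
      have h6 := hge r ⟨hr.1.le, hr.2.le⟩
      have h7 : 0 ≤ κ * v r := mul_nonneg h.hκ (by linarith)
      have h8 : 0 ≤ α * χ r * (χ r - b) :=
        mul_nonneg (mul_nonneg hα.le (by linarith)) (by linarith)
      nlinarith)
    linarith
  obtain ⟨M, hM⟩ := h.bdd
  obtain ⟨s, hs, hsM⟩ := kpp_unbdd h.sys.dχ ht (half_pos hv) key M
  exact absurd (hM s (ht.trans hs)) (not_le.2 hsM)

theorem le_b (h : KppPos α b κ χ v) : ∀ s, 0 ≤ s → χ s ≤ b := by
  intro t ht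
  by_contra hcon
  push Not at hcon
  have hb := h.hb
  -- reversed time
  have hc : ContinuousOn (fun r => χ (t - r)) (Icc 0 t) := by
    apply h.sys.cont.comp (by fun_prop)
    intro r hr
    exact sub_nonneg.2 hr.2
  obtain ⟨τ, h1, h2, h3, h4⟩ := kpp_first (y := b) ht hc (by simpa using hcon)
    (by simpa [h.init] using hb.le)
  have := kpp_anti h.sys.dχ (t0 := t - τ) (t1 := t) (by linarith) (by linarith) (fun r hr => by
    apply h.v_nonpos_of_ge (by linarith [hr.1])
    have := h4 (t - r) ⟨by linarith [hr.2], by linarith [hr.1]⟩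
    simp only [sub_sub_cancel] at this
    exact this.le)
  linarith

theorem g_anti (h : KppPos α b κ χ v) {s t : ℝ} (hs : 0 ≤ s) (hst : s ≤ t) :
    Real.exp (-(κ * t)) * v t ≤ Real.exp (-(κ * s)) * v s := by
  apply kpp_anti h.sys.dg hs hst
  intro r hr
  have h1 := h.le_b r (by linarith [hr.1])
  have h2 := h.nonneg r (by linarith [hr.1])
  have h3 : 0 ≤ α * χ r * (b - χ r) := mul_nonneg (mul_nonneg h.hα.le h2) (by linarith)
  have h4 := (Real.exp_pos (-(κ * r))).le
  have := mul_nonneg h4 h3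
  linarith

theorem v_nonpos_after (h : KppPos α b κ χ v) {s t : ℝ} (hs : 0 ≤ s) (hst : s ≤ t)
    (hv : v s ≤ 0) : v t ≤ 0 := by
  have h1 := h.g_anti hs hst
  have h2 := Real.exp_pos (-(κ * s))
  have h3 := Real.exp_pos (-(κ * t))
  by_contra hcon
  push Not at hcon
  have := mul_pos h3 hcon
  nlinarith

theorem v_pos (h : KppPos α b κ χ v) : ∀ s, 0 ≤ s → 0 < v s := by
  intro t ht
  by_contra hcon
  push Not at hcon
  have hα := h.hα
  have hb := h.hb
  have hanti : ∀ s r, t ≤ s → s ≤ r → v r ≤ v s := by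
    intro s r hs hsr
    apply kpp_anti h.sys.dv (ht.trans hs) hsr
    intro q hq
    have hq0 : 0 ≤ q := by linarith [hq.1]
    have h1 := h.le_b q hq0
    have h2 := h.nonneg q hq0
    have h3 : 0 ≤ α * χ q * (b - χ q) := mul_nonneg (mul_nonneg h.hα.le h2) (by linarith)
    have h4 := h.v_nonpos_after ht (by linarith [hq.1] : t ≤ q) hcon
    have h5 := mul_nonneg h.hκ (neg_nonneg.2 h4)
    linarith
  by_cases hz : ∃ s, t ≤ s ∧ v s < 0
  · obtain ⟨s, hs, hvs⟩ := hz
    obtain ⟨r, hr, hr1⟩ := kpp_unbdd_below h.sys.dχ (ht.trans hs) (neg_pos.2 hvs)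
      (fun r hr => by simpa using hanti s r hs hr) 0
    exact absurd (h.nonneg r (by linarith)) (not_le.2 hr1)
  · push Not at hz
    have hv0 : ∀ s, t ≤ s → v s = 0 := fun s hs =>
      le_antisymm (h.v_nonpos_after ht hs hcon) (hz s hs)
    have hpos := h.pos (t + 1) (by linarith)
    -- derivative of v vanishes at t + 1
    have hd : HasDerivAt v (κ * v (t+1) - α * χ (t+1) * (b - χ (t+1))) (t+1) :=
      (h.sys.dv (t+1) (by linarith)).hasDerivAt (Ici_mem_nhds (by linarith))
    have hd0 : HasDerivAt v 0 (t+1) := by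
      apply (hasDerivAt_const (t+1) (0:ℝ)).congr_of_eventuallyEq
      filter_upwards [Ici_mem_nhds (by linarith : t < t + 1)] with s hs using hv0 s hs
    have heq := hd.unique hd0
    rw [hv0 (t+1) (by linarith)] at heq
    have hχb : χ (t+1) = b := by
      have : α * χ (t+1) * (b - χ (t+1)) = 0 := by linarith
      rcases mul_eq_zero.1 this with h1 | h1
      · exact absurd h1 (mul_pos hα hpos).ne'
      · linarith
    have hconst : KppSys κ (fun x => α * x * (b - x)) (fun _ => b) (fun _ => 0) := by
      intro s hs
      refine ⟨hasDerivWithinAt_const _ _ _, ?_⟩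
      simpa using hasDerivWithinAt_const s (Ici 0) (0:ℝ)
    have := h.sys.uniq hconst (Icc 0 b) (α * (b + 2 * b)) (by positivity)
      (kpp_lip α b b hα hb hb.le) (fun s hs => ⟨h.nonneg s hs, h.le_b s hs⟩)
      (fun s hs => ⟨hb.le, le_rfl⟩) (t+1) (by linarith) hχb (hv0 _ (by linarith)) 0 le_rfl
    rw [h.init] at this
    linarith

theorem strictMono (h : KppPos α b κ χ v) : StrictMonoOn χ (Ici 0) := by
  intro s hs t _ hst
  exact kpp_mono_lt h.sys.dχ hs hst (fun r hr => h.v_pos r (le_trans hs hr.1.le))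

theorem lt_b (h : KppPos α b κ χ v) : ∀ s, 0 ≤ s → χ s < b := by
  intro s hs
  have := h.strictMono (mem_Ici.2 hs) (mem_Ici.2 (by linarith : (0:ℝ) ≤ s + 1)) (by linarith)
  exact this.trans_le (h.le_b _ (by linarith))

theorem tendsto (h : KppPos α b κ χ v) : Tendsto χ atTop (nhds b) := by
  have hα := h.hα
  have hb := h.hb
  rw [tendsto_order]
  refine ⟨fun y hy => ?_, fun y hy => ?_⟩
  · -- eventually above y
    have hex : ∃ s, 0 ≤ s ∧ y < χ s := by
      by_contra hcon
      push Not at hcon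
      -- κχ - v has derivative αχ(b-χ) ≥ C > 0
      have hd : ∀ s, 0 ≤ s → HasDerivWithinAt (fun s => κ * χ s - v s)
          (κ * v s - (κ * v s - α * χ s * (b - χ s))) (Ici 0) s := fun s hs =>
        ((h.sys.dχ s hs).const_mul κ).fun_sub (h.sys.dv s hs)
      have h1 := h.pos 1 one_pos
      obtain ⟨s, hs, hs1⟩ := kpp_unbdd hd (t0 := 1) (C := α * χ 1 * (b - y)) zero_le_one
        (mul_pos (mul_pos hα h1) (by linarith)) (fun s hs => by
          have h2 := hcon s (by linarith)
          have h3 : χ 1 ≤ χ s := h.strictMono.monotoneOn (mem_Ici.2 zero_le_one)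
            (mem_Ici.2 (by linarith)) hs
          have : α * χ 1 * (b - y) ≤ α * χ s * (b - χ s) := by
            have : 0 < b - y := by linarith
            have h6 : 0 < χ s := h1.trans_le h3
            gcongr
          linarith) (κ * b)
      have h4 := h.v_pos s (by linarith)
      have h5 := mul_le_mul_of_nonneg_left (h.le_b s (by linarith)) h.hκ
      linarith
    obtain ⟨s, hs, hys⟩ := hex
    filter_upwards [eventually_ge_atTop s] with t ht
    exact hys.trans_le (h.strictMono.monotoneOn (mem_Ici.2 hs) (mem_Ici.2 (by linarith)) ht)
  · filter_upwards [eventually_ge_atTop 0] with t ht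
    exact (h.le_b t ht).trans_lt hy

end KppPos

namespace KppPos

variable {α b κ : ℝ} {χ v : ℝ → ℝ}

theorem kpp_dexp (k s : ℝ) :
    HasDerivWithinAt (fun s : ℝ => Real.exp (-(k * s))) (-k * Real.exp (-(k * s))) (Ici 0) s := by
  have h1 : HasDerivWithinAt (fun s : ℝ => -(k * s)) (-(k * 1)) (Ici 0) s :=
    ((hasDerivWithinAt_id s _).const_mul k).fun_neg
  refine h1.exp.congr_deriv ?_
  ring

theorem asymp (h : KppPos α b κ χ v) (l : ℝ) (hl : l ^ 2 = κ * l + α * b) (hl0 : l < 0) :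
    ∃ B > (0:ℝ), Tendsto (fun s => (b - χ s) * Real.exp (-(l * s))) atTop (nhds B) := by
  have hα := h.hα
  have hb := h.hb
  have hκ := h.hκ
  obtain ⟨m, hm⟩ : ∃ m, m = κ - l := ⟨_, rfl⟩
  have hm0 : 0 < m := by linarith
  have hlm : l * m = -(α * b) := by rw [hm]; nlinarith
  have hwpos : ∀ s, 0 ≤ s → 0 < b - χ s := fun s hs => sub_pos.2 (h.lt_b s hs)
  have dw : ∀ s, 0 ≤ s → HasDerivWithinAt (fun s => b - χ s) (- v s) (Ici 0) s :=
    fun s hs => ((h.sys.dχ s hs).const_sub b)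
  -- y = -v - l w is positive
  have dy : ∀ s, 0 ≤ s → HasDerivWithinAt
      (fun s => (- v s - l * (b - χ s)) * Real.exp (-(m * s)))
      (-(α * (b - χ s) ^ 2 * Real.exp (-(m * s)))) (Ici 0) s := by
    intro s hs
    refine ((((h.sys.dv s hs).fun_neg).fun_sub ((dw s hs).const_mul l)).fun_mul
      (kpp_dexp m s)).congr_deriv ?_
    have e : (-(κ * v s - α * χ s * (b - χ s)) - l * -v s) + (- v s - l * (b - χ s)) * (-m)
        = -(α * (b - χ s) ^ 2) := by
      rw [show (- v s - l * (b - χ s)) * (-m) = m * v s + (l * m) * (b - χ s) by ring, hlm, hm]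
      ring
    linear_combination Real.exp (-(m * s)) * e
  have hy : ∀ s, 0 ≤ s → 0 < - v s - l * (b - χ s) := by
    intro t ht
    by_contra hcon
    push Not at hcon
    set ε := -((- v (t+1) - l * (b - χ (t+1))) * Real.exp (-(m * (t+1)))) with hε
    have h1 : 0 < ε := by
      have := kpp_anti_lt dy ht (by linarith : t < t + 1) (fun s hs => by
        have h1 := hwpos s (by linarith [hs.1])
        have h2 := Real.exp_pos (-(m * s))
        have : 0 < α * (b - χ s) ^ 2 * Real.exp (-(m * s)) := by positivity
        linarith)
      have h2 := mul_nonpos_of_nonpos_of_nonneg hcon (Real.exp_pos (-(m * t))).le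
      linarith
    have h2 : ∀ s, t + 1 ≤ s → - v s ≤ - ε := by
      intro s hs
      have := kpp_anti dy (by linarith : 0 ≤ t + 1) hs (fun s hs => by
        have h1 := hwpos s (by linarith [hs.1])
        have h2 := Real.exp_pos (-(m * s))
        have : 0 < α * (b - χ s) ^ 2 * Real.exp (-(m * s)) := by positivity
        linarith)
      have h3 : (- v s - l * (b - χ s)) * Real.exp (-(m * s)) ≤ - ε := by linarith
      have h4 : Real.exp (-(m * s)) ≤ 1 := by
        apply Real.exp_le_one_iff.2
        have := mul_nonneg hm0.le (by linarith : 0 ≤ s)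
        linarith
      have h5 := Real.exp_pos (-(m * s))
      have h6 : - v s - l * (b - χ s) ≤ - ε := by
        by_contra hc
        push Not at hc
        nlinarith
      have := mul_pos (neg_pos.2 hl0) (hwpos s (by linarith))
      linarith
    obtain ⟨s, hs, hs1⟩ := kpp_unbdd_below dw (by linarith : 0 ≤ t + 1) h1 h2 0
    exact absurd (hwpos s (by linarith)) (not_lt.2 hs1.le)
  -- u = w e^{-ls}
  have du : ∀ s, 0 ≤ s → HasDerivWithinAt (fun s => (b - χ s) * Real.exp (-(l * s)))
      ((- v s - l * (b - χ s)) * Real.exp (-(l * s))) (Ici 0) s := by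
    intro s hs
    refine ((dw s hs).fun_mul (kpp_dexp l s)).congr_deriv ?_
    ring
  have umono : ∀ s t, 0 ≤ s → s ≤ t →
      (b - χ s) * Real.exp (-(l * s)) ≤ (b - χ t) * Real.exp (-(l * t)) := by
    intro s t hs hst
    apply kpp_mono du hs hst
    intro r hr
    exact (mul_pos (hy r (by linarith [hr.1])) (Real.exp_pos _)).le
  -- H = (m w + v) e^{-ls}
  have dH : ∀ s, 0 ≤ s → HasDerivWithinAt
      (fun s => (m * (b - χ s) + v s) * Real.exp (-(l * s)))
      (α * (b - χ s) ^ 2 * Real.exp (-(l * s))) (Ici 0) s := by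
    intro s hs
    refine ((((dw s hs).const_mul m).fun_add (h.sys.dv s hs)).fun_mul
      (kpp_dexp l s)).congr_deriv ?_
    have e : (m * -v s + (κ * v s - α * χ s * (b - χ s))) + (m * (b - χ s) + v s) * (-l)
        = α * (b - χ s) ^ 2 := by
      rw [show (m * (b - χ s) + v s) * (-l) = -(l * m) * (b - χ s) - l * v s by ring, hlm, hm]
      ring
    linear_combination Real.exp (-(l * s)) * e
  -- z = -v - κ w ≤ 0, z' = α χ w
  have dz : ∀ s, 0 ≤ s → HasDerivWithinAt (fun s => - v s - κ * (b - χ s))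
      (α * χ s * (b - χ s)) (Ici 0) s := by
    intro s hs
    refine (((h.sys.dv s hs).fun_neg).fun_sub ((dw s hs).const_mul κ)).congr_deriv ?_
    ring
  have hχ1 := h.pos 1 one_pos
  obtain ⟨k, hk⟩ : ∃ k, k = 1 / (m * χ 1) := ⟨_, rfl⟩
  have hk0 : 0 < k := by rw [hk]; positivity
  have hkm : k * m * χ 1 = 1 := by rw [hk]; field_simp
  have dP : ∀ s, 0 ≤ s → HasDerivWithinAt
      (fun s => ((m * (b - χ s) + v s) * Real.exp (-(l * s))) *
        Real.exp (-(k * (- v s - κ * (b - χ s)))))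
      ((α * (b - χ s) ^ 2 - (m * (b - χ s) + v s) * (k * (α * χ s * (b - χ s)))) *
        (Real.exp (-(l * s)) * Real.exp (-(k * (- v s - κ * (b - χ s)))))) (Ici 0) s := by
    intro s hs
    have h1 := (((dz s hs).const_mul k).fun_neg).exp
    refine ((dH s hs).fun_mul h1).congr_deriv ?_
    ring
  obtain ⟨C, hC⟩ : ∃ C, C = ((m * (b - χ 1) + v 1) * Real.exp (-(l * 1))) *
        Real.exp (-(k * (- v 1 - κ * (b - χ 1)))) := ⟨_, rfl⟩
  have hbd : ∀ s, 1 ≤ s → (b - χ s) * Real.exp (-(l * s)) ≤ C / m := by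
    intro s hs
    have h0s : 0 ≤ s := by linarith
    have hP := kpp_anti dP zero_le_one hs (fun r hr => by
      have hr0 : 0 ≤ r := by linarith [hr.1]
      apply mul_nonpos_of_nonpos_of_nonneg _ (by positivity)
      have h1 := hwpos r hr0
      have h2 := h.v_pos r hr0
      have h3 : χ 1 ≤ χ r := h.strictMono.monotoneOn (mem_Ici.2 zero_le_one)
            (mem_Ici.2 hr0) hr.1.le
      have h4 : (m * (b - χ r)) * (k * (α * χ 1 * (b - χ r))) ≤
          (m * (b - χ r) + v r) * (k * (α * χ r * (b - χ r))) := by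
        have : 0 < χ r := hχ1.trans_le h3
        gcongr
        linarith
      have h5 : (m * (b - χ r)) * (k * (α * χ 1 * (b - χ r))) = α * (b - χ r) ^ 2 := by
        linear_combination α * (b - χ r) ^ 2 * hkm
      linarith)
    rw [← hC] at hP
    have h1 := hwpos s h0s
    have h2 := h.v_pos s h0s
    have h3 : 1 ≤ Real.exp (-(k * (- v s - κ * (b - χ s)))) := by
      apply Real.one_le_exp
      have : 0 ≤ κ * (b - χ s) := by positivity
      have : 0 ≤ k * (v s + κ * (b - χ s)) := by positivity
      linarith
    rw [le_div_iff₀ hm0]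
    have h4 := Real.exp_pos (-(l * s))
    calc (b - χ s) * Real.exp (-(l * s)) * m
        = (m * (b - χ s)) * Real.exp (-(l * s)) * 1 := by ring
      _ ≤ (m * (b - χ s) + v s) * Real.exp (-(l * s)) *
          Real.exp (-(k * (- v s - κ * (b - χ s)))) := by
        gcongr
        linarith
      _ ≤ C := hP
  -- monotone bounded convergence
  let f : ℝ → ℝ := fun s => (b - χ (max s 1)) * Real.exp (-(l * (max s 1)))
  have hfm : Monotone f := by
    intro s t hst
    exact umono _ _ (by have := le_max_right s (1:ℝ); linarith) (max_le_max_right _ hst)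
  have hfb : BddAbove (range f) := by
    refine ⟨C / m, ?_⟩
    rintro _ ⟨s, rfl⟩
    exact hbd _ (le_max_right _ _)
  have hft := tendsto_atTop_ciSup hfm hfb
  refine ⟨⨆ i, f i, ?_, ?_⟩
  · have : f 1 ≤ ⨆ i, f i := le_ciSup hfb 1
    refine lt_of_lt_of_le ?_ this
    show 0 < (b - χ (max 1 1)) * Real.exp (-(l * (max 1 1)))
    exact mul_pos (hwpos _ (by norm_num)) (Real.exp_pos _)
  · apply hft.congr'
    filter_upwards [eventually_ge_atTop 1] with s hs
    show (b - χ (max s 1)) * Real.exp (-(l * (max s 1))) = _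
    rw [max_eq_left hs]

/-- Wronskian comparison -/
theorem not_lt_slope {χ₁ v₁ χ₂ v₂ : ℝ → ℝ} (h₁ : KppPos α b κ χ₁ v₁)
    (h₂ : KppPos α b κ χ₂ v₂) : ¬ v₂ 0 < v₁ 0 := by
  intro hlt
  have hα := h₁.hα
  have hb := h₁.hb
  have dW : ∀ s, 0 ≤ s → HasDerivWithinAt
      (fun s => (v₁ s * χ₂ s - χ₁ s * v₂ s) * Real.exp (-(κ * s)))
      (α * χ₁ s * χ₂ s * (χ₁ s - χ₂ s) * Real.exp (-(κ * s))) (Ici 0) s := by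
    intro s hs
    refine ((((h₁.sys.dv s hs).fun_mul (h₂.sys.dχ s hs)).fun_sub
      ((h₁.sys.dχ s hs).fun_mul (h₂.sys.dv s hs))).fun_mul (kpp_dexp κ s)).congr_deriv ?_
    ring
  -- near 0
  have hnear : ∃ ε > (0:ℝ), ∀ s, 0 < s → s ≤ ε → χ₂ s < χ₁ s := by
    have hc : ContinuousWithinAt (fun s => v₁ s - v₂ s) (Ici 0) 0 :=
      (h₁.sys.contv 0 (mem_Ici.2 le_rfl)).sub (h₂.sys.contv 0 (mem_Ici.2 le_rfl))
    have hev : ∀ᶠ s in nhdsWithin 0 (Ici (0:ℝ)), 0 < v₁ s - v₂ s :=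
      hc.eventually (lt_mem_nhds (by linarith))
    obtain ⟨ε, hε, hε1⟩ := Metric.mem_nhdsWithin_iff.1 hev
    refine ⟨ε / 2, by positivity, fun s hs hs1 => ?_⟩
    have := kpp_mono_lt (f := fun s => χ₁ s - χ₂ s) (f' := fun s => v₁ s - v₂ s)
      (fun s hs => (h₁.sys.dχ s hs).fun_sub (h₂.sys.dχ s hs)) le_rfl hs (fun r hr => by
        apply hε1
        refine ⟨?_, hr.1.le⟩
        rw [Metric.mem_ball, Real.dist_eq, sub_zero, abs_of_pos hr.1]
        linarith [hr.2])
    simp only [h₁.init, h₂.init] at this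
    linarith
  obtain ⟨ε, hε, hnear⟩ := hnear
  -- if χ₁ > χ₂ on (0,T) then the ratio is monotone
  have hratio : ∀ s T, 0 < s → s ≤ T → (∀ r, 0 < r → r < T → χ₂ r < χ₁ r) →
      χ₁ s / χ₂ s ≤ χ₁ T / χ₂ T := by
    intro s T hs hsT hT
    have hW : ∀ r, 0 ≤ r → r ≤ T → 0 ≤ v₁ r * χ₂ r - χ₁ r * v₂ r := by
      intro r hr hrT
      have := kpp_mono dW le_rfl hr (fun q hq => by
        have h3 := h₁.pos q hq.1
        have h4 := h₂.pos q hq.1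
        have h5 := hT q hq.1 (hq.2.trans_le hrT)
        have h6 := sub_pos.2 h5
        positivity)
      simp only [h₁.init, h₂.init] at this
      have h7 := Real.exp_pos (-(κ * r))
      by_contra hc
      push Not at hc
      have := mul_neg_of_neg_of_pos hc h7
      linarith
    have hm : MonotoneOn (fun s => χ₁ s / χ₂ s) (Icc s T) := by
      have hd : ∀ r ∈ Icc s T, HasDerivAt (fun s => χ₁ s / χ₂ s)
          ((v₁ r * χ₂ r - χ₁ r * v₂ r) / χ₂ r ^ 2) r := by
        intro r hr
        have hr0 : 0 < r := hs.trans_le hr.1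
        exact ((h₁.sys.dχ r hr0.le).hasDerivAt (Ici_mem_nhds hr0)).fun_div
          ((h₂.sys.dχ r hr0.le).hasDerivAt (Ici_mem_nhds hr0)) (h₂.pos r hr0).ne'
      apply monotoneOn_of_hasDerivWithinAt_nonneg (convex_Icc s T)
        (f' := fun r => (v₁ r * χ₂ r - χ₁ r * v₂ r) / χ₂ r ^ 2)
      · exact fun r hr => (hd r hr).continuousAt.continuousWithinAt
      · exact fun r hr => (hd r (interior_subset hr)).hasDerivWithinAt
      · intro r hr
        have := interior_subset hr
        have := hW r (by linarith [this.1]) this.2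
        positivity
    exact hm (left_mem_Icc.2 hsT) (right_mem_Icc.2 hsT) hsT
  have hε1 : 1 < χ₁ ε / χ₂ ε := by
    rw [one_lt_div (h₂.pos ε hε)]
    exact hnear ε hε le_rfl
  have hall : ∀ s, 0 < s → χ₂ s < χ₁ s := by
    intro s hs
    by_contra hcon
    push Not at hcon
    have hεs : ε ≤ s := by
      by_contra hc
      push Not at hc
      exact absurd (hnear s hs hc.le) (not_lt.2 hcon)
    obtain ⟨τ, g1, g2, g3, g4⟩ := kpp_first (f := fun s => χ₁ s - χ₂ s) (y := 0) hεs
      ((h₁.sys.cont.sub h₂.sys.cont).mono (fun x hx => (hε.le.trans hx.1)))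
      (by have := hnear ε hε le_rfl; linarith) (by linarith)
    have := hratio ε τ hε g1.le (fun r hr hrτ => by
      rcases le_total r ε with hc | hc
      · exact hnear r hr hc
      · have := g4 r ⟨hc, hrτ⟩
        linarith)
    have h5 : χ₁ τ = χ₂ τ := by linarith
    rw [h5, div_self (h₂.pos τ (hε.trans g1)).ne'] at this
    linarith
  have hlim : Tendsto (fun s => χ₁ s / χ₂ s) atTop (nhds (b / b)) :=
    h₁.tendsto.div h₂.tendsto hb.ne'
  rw [div_self hb.ne'] at hlim
  have := ge_of_tendsto hlim (b := χ₁ ε / χ₂ ε) (by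
    filter_upwards [eventually_ge_atTop ε] with s hs
    exact hratio ε s hε hs (fun r hr _ => hall r hr))
  linarith

theorem unique {χ₁ v₁ χ₂ v₂ : ℝ → ℝ} (h₁ : KppPos α b κ χ₁ v₁)
    (h₂ : KppPos α b κ χ₂ v₂) : ∀ s, 0 ≤ s → χ₁ s = χ₂ s := by
  have hv : v₁ 0 = v₂ 0 :=
    le_antisymm (not_lt.1 (not_lt_slope h₁ h₂)) (not_lt.1 (not_lt_slope h₂ h₁))
  have hα := h₁.hα
  have hb := h₁.hb
  exact h₁.sys.uniq h₂.sys (Icc 0 b) (α * (b + 2 * b)) (by positivity)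
      (kpp_lip α b b hα hb hb.le) (fun s hs => ⟨h₁.nonneg s hs, h₁.le_b s hs⟩)
      (fun s hs => ⟨h₂.nonneg s hs, h₂.le_b s hs⟩) 0 le_rfl (by rw [h₁.init, h₂.init]) hv

end KppPos

/-- clamp to `[0,b]` -/
noncomputable def kppClamp (b x : ℝ) : ℝ := max 0 (min x b)

/-- truncated nonlinearity -/
noncomputable def kppPhi (α b x : ℝ) : ℝ := α * kppClamp b x * (b - kppClamp b x)

theorem kppClamp_mem {b : ℝ} (hb : 0 < b) (x : ℝ) : kppClamp b x ∈ Icc (0:ℝ) b :=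
  ⟨le_max_left _ _, max_le hb.le (min_le_right _ _)⟩

theorem kppClamp_eq {b x : ℝ} (hx : x ∈ Icc (0:ℝ) b) : kppClamp b x = x := by
  rw [kppClamp, min_eq_left hx.2, max_eq_right hx.1]

theorem kppClamp_ge {b x : ℝ} (hb : 0 < b) (hx : b ≤ x) : kppClamp b x = b := by
  rw [kppClamp, min_eq_right hx, max_eq_right hb.le]

theorem kppClamp_lip (b x y : ℝ) : |kppClamp b x - kppClamp b y| ≤ |x - y| := by
  unfold kppClamp
  refine (abs_max_sub_max_le_max _ _ _ _).trans ?_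
  simp only [sub_self, abs_zero]
  apply max_le (abs_nonneg _)
  refine (abs_min_sub_min_le_max _ _ _ _).trans ?_
  simp

theorem kppPhi_lip {α b : ℝ} (hα : 0 < α) (hb : 0 < b) (x y : ℝ) :
    |kppPhi α b x - kppPhi α b y| ≤ (α * (b + 2 * b)) * |x - y| :=
  (kpp_lip α b b hα hb hb.le _ (kppClamp_mem hb x) _ (kppClamp_mem hb y)).trans (by
    have := kppClamp_lip b x y
    gcongr)

theorem kppPhi_nonneg {α b : ℝ} (hα : 0 < α) (hb : 0 < b) (x : ℝ) : 0 ≤ kppPhi α b x := by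
  have := kppClamp_mem hb x
  exact mul_nonneg (mul_nonneg hα.le this.1) (by linarith [this.2])

theorem kppPhi_le {α b : ℝ} (hα : 0 < α) (hb : 0 < b) (x : ℝ) : kppPhi α b x ≤ α * b * b := by
  have := kppClamp_mem hb x
  have h1 : 0 ≤ b - kppClamp b x := by linarith [this.2]
  unfold kppPhi
  gcongr
  · exact this.2
  · linarith [this.1]

theorem kpp_flow {α b : ℝ} (κ : ℝ) (hα : 0 < α) (hb : 0 < b) :
    ∃ χ v : ℝ → ℝ → ℝ, (∀ p, KppSys κ (kppPhi α b) (χ p) (v p) ∧ χ p 0 = 0 ∧ v p 0 = p) ∧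
      ∀ s, 0 ≤ s → Continuous (fun p => χ p s) := by
  have hlip := kppField_lip κ (kppPhi α b) univ (α * (b + 2 * b)) (by positivity)
    (fun x _ y _ => kppPhi_lip hα hb x y)
  set K := Real.toNNReal (1 + |κ| + α * (b + 2 * b)) with hK
  have hK0 : 0 < K := Real.toNNReal_pos.2 (by positivity)
  have hlip' : LipschitzWith K (kppField κ (kppPhi α b)) := by
    rw [← lipschitzOnWith_univ]
    simpa using hlip
  have h0 : kppField κ (kppPhi α b) 0 = 0 := by
    have : kppClamp b 0 = 0 := kppClamp_eq ⟨le_rfl, hb.le⟩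
    simp [kppField, kppPhi, this]
  have hex := fun p : ℝ => kpp_global_ode _ K hK0 hlip' h0 ((0, p) : ℝ × ℝ)
  choose γ hγ0 hγ using hex
  refine ⟨fun p s => (γ p s).1, fun p s => (γ p s).2, ?_, ?_⟩
  · intro p
    refine ⟨fun s hs => ?_, by simp [hγ0], by simp [hγ0]⟩
    have h1 := (hγ p s hs)
    have e1 := (ContinuousLinearMap.fst ℝ ℝ ℝ).hasFDerivAt.comp_hasDerivWithinAt s
      (h1.hasDerivWithinAt (s := Ici 0))
    have e2 := (ContinuousLinearMap.snd ℝ ℝ ℝ).hasFDerivAt.comp_hasDerivWithinAt s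
      (h1.hasDerivWithinAt (s := Ici 0))
    exact ⟨e1, e2⟩
  · intro s hs
    have hL : LipschitzWith (Real.toNNReal (Real.exp (K * (s - 0)))) (fun p => γ p s) := by
      apply LipschitzWith.of_dist_le_mul
      intro p q
      rw [Real.coe_toNNReal _ (Real.exp_pos _).le]
      have := dist_le_of_trajectories_ODE (v := fun _ => kppField κ (kppPhi α b)) (K := K)
        (f := γ p) (g := γ q) (a := 0) (b := s) (δ := dist p q) (fun _ => hlip')
        (fun r hr => (hγ p r hr.1).continuousAt.continuousWithinAt)
        (fun r hr => (hγ p r hr.1).hasDerivWithinAt)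
        (fun r hr => (hγ q r hr.1).continuousAt.continuousWithinAt)
        (fun r hr => (hγ q r hr.1).hasDerivWithinAt)
        (by rw [hγ0, hγ0, Prod.dist_eq]; simp) s ⟨hs, le_rfl⟩
      linarith
    exact continuous_fst.comp hL.continuous

section traj

variable {α b κ p : ℝ} {χ v : ℝ → ℝ}

theorem traj_g_anti (hα : 0 < α) (hb : 0 < b) (h : KppSys κ (kppPhi α b) χ v) {s t : ℝ}
    (hs : 0 ≤ s) (hst : s ≤ t) : Real.exp (-(κ * t)) * v t ≤ Real.exp (-(κ * s)) * v s := by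
  apply kpp_anti h.dg hs hst
  intro r _
  have := mul_nonneg (Real.exp_pos (-(κ * r))).le (kppPhi_nonneg hα hb (χ r))
  linarith

theorem traj_v_nonpos (hα : 0 < α) (hb : 0 < b) (h : KppSys κ (kppPhi α b) χ v) {s t : ℝ}
    (hs : 0 ≤ s) (hst : s ≤ t) (hv : v s < 0) : v t < 0 := by
  have h1 := traj_g_anti hα hb h hs hst
  have h2 := mul_neg_of_pos_of_neg (Real.exp_pos (-(κ * s))) hv
  by_contra hc
  push Not at hc
  have := mul_nonneg (Real.exp_pos (-(κ * t))).le hc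
  linarith

theorem traj_g_lower (hα : 0 < α) (hb : 0 < b) (hκ : 0 ≤ κ) (h : KppSys κ (kppPhi α b) χ v)
    (hv : v 0 = p) {t : ℝ} (ht : 0 ≤ t) :
    p - α * b * b * t ≤ Real.exp (-(κ * t)) * v t := by
  have := kpp_lin_lower h.dg le_rfl ht (C := -(α * b * b)) (fun r hr => by
    have h1 := kppPhi_nonneg hα hb (χ r)
    have h2 := kppPhi_le hα hb (χ r)
    have h3 : Real.exp (-(κ * r)) ≤ 1 := by
      apply Real.exp_le_one_iff.2
      have := mul_nonneg hκ hr.1.le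
      linarith
    have := mul_le_mul h3 h2 h1 zero_le_one
    linarith)
  simp only [mul_zero, neg_zero, Real.exp_zero, hv] at this
  linarith

theorem traj_v_ge (hα : 0 < α) (hb : 0 < b) (hκ : 0 ≤ κ) (h : KppSys κ (kppPhi α b) χ v)
    (hv : v 0 = p) {t : ℝ} (ht : 0 ≤ t) (hp : 0 < p - α * b * b * t) :
    p - α * b * b * t ≤ v t := by
  have h1 := traj_g_lower hα hb hκ h hv ht
  have h2 : 0 < v t := by
    by_contra hc
    push Not at hc
    have := mul_nonpos_of_nonneg_of_nonpos (Real.exp_pos (-(κ * t))).le hc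
    linarith
  have h3 : Real.exp (-(κ * t)) ≤ 1 := by
    apply Real.exp_le_one_iff.2
    have := mul_nonneg hκ ht
    linarith
  nlinarith

theorem traj_pos (hα : 0 < α) (hb : 0 < b) (hκ : 0 ≤ κ) (h : KppSys κ (kppPhi α b) χ v)
    (h0 : χ 0 = 0) (hv : v 0 = p) (hp : 0 < p) (hnn : ∀ s, 0 ≤ s → 0 ≤ χ s) :
    ∀ s, 0 < s → 0 < χ s := by
  intro s0 hs0
  by_contra hcon
  push Not at hcon
  have hM : 0 < α * b * b := by positivity
  obtain ⟨δ, hδ⟩ : ∃ δ, δ = min s0 (p / (2 * (α * b * b))) := ⟨_, rfl⟩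
  have hδ0 : 0 < δ := by rw [hδ]; exact lt_min hs0 (by positivity)
  have hδs : δ ≤ s0 := by rw [hδ]; exact min_le_left _ _
  have hδp : α * b * b * δ ≤ p / 2 := by
    have : δ ≤ p / (2 * (α * b * b)) := by rw [hδ]; exact min_le_right _ _
    calc α * b * b * δ ≤ α * b * b * (p / (2 * (α * b * b))) := by gcongr
      _ = p / 2 := by field_simp
  have h1 : χ 0 < χ δ := kpp_mono_lt h.dχ le_rfl hδ0 (fun r hr => by
    have h2 : α * b * b * r ≤ α * b * b * δ := by
      have := hr.2.le
      gcongr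
    have h3 := traj_v_ge hα hb hκ h hv hr.1.le (by linarith)
    linarith)
  by_cases hξ : ∃ ξ ∈ Ioo δ s0, v ξ < 0
  · obtain ⟨ξ, hξ, hvξ⟩ := hξ
    have h2 : χ (s0 + 1) < χ s0 := kpp_anti_lt h.dχ hs0.le (by linarith) (fun r hr =>
      traj_v_nonpos hα hb h (by linarith [hξ.1]) (by linarith [hξ.2, hr.1] : ξ ≤ r) hvξ)
    have := hnn (s0 + 1) (by linarith)
    linarith
  · push Not at hξ
    have := kpp_mono h.dχ hδ0.le hδs hξ
    linarith

theorem traj_disjoint (hα : 0 < α) (hb : 0 < b) (h : KppSys κ (kppPhi α b) χ v)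
    (h0 : χ 0 = 0) {s1 s2 : ℝ} (hs1 : 0 ≤ s1) (hs2 : 0 ≤ s2) (h1 : b < χ s1) (h2 : χ s2 < 0) :
    False := by
  have hξ : ∃ ξ ∈ Ioo 0 s2, v ξ < 0 := by
    by_contra hc
    push Not at hc
    have := kpp_mono h.dχ le_rfl hs2 hc
    linarith
  obtain ⟨ξ, hξ, hvξ⟩ := hξ
  have hlt : s1 < s2 := by
    by_contra hc
    push Not at hc
    have := kpp_anti h.dχ hs2 hc (fun r hr =>
      (traj_v_nonpos hα hb h hξ.1.le (by linarith [hξ.2, hr.1] : ξ ≤ r) hvξ).le)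
    linarith
  obtain ⟨t, ht, hmax⟩ := (isCompact_Icc (a := (0:ℝ)) (b := s2)).exists_isMaxOn
    ⟨0, left_mem_Icc.2 hs2⟩ (h.cont.mono (fun x hx => hx.1))
  have htb : b < χ t := h1.trans_le (hmax ⟨hs1, hlt.le⟩)
  have ht0 : 0 < t := by
    rcases ht.1.eq_or_lt with hc | hc
    · rw [← hc, h0] at htb; linarith
    · exact hc
  have ht2 : t < s2 := by
    rcases ht.2.eq_or_lt with hc | hc
    · rw [hc] at htb; linarith
    · exact hc
  have hvt : v t = 0 := by
    have hloc : IsLocalMax χ t := hmax.isLocalMax (Icc_mem_nhds ht0 ht2)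
    exact hloc.hasDerivAt_eq_zero ((h.dχ t ht0.le).hasDerivAt (Ici_mem_nhds ht0))
  have hconst : KppSys κ (kppPhi α b) (fun _ => χ t) (fun _ => 0) := by
    intro s hs
    refine ⟨hasDerivWithinAt_const _ _ _, ?_⟩
    have : kppPhi α b (χ t) = 0 := by simp [kppPhi, kppClamp_ge hb htb.le]
    simpa [this] using hasDerivWithinAt_const s (Ici 0) (0:ℝ)
  have := h.uniq hconst univ (α * (b + 2 * b)) (by positivity)
    (fun x _ y _ => kppPhi_lip hα hb x y) (fun _ _ => mem_univ _) (fun _ _ => mem_univ _)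
    t ht0.le rfl hvt s2 hs2
  linarith

/-- Sturm comparison: small slopes produce trajectories that become negative. -/
theorem traj_small (hα : 0 < α) (hb : 0 < b) (hκ : 0 ≤ κ) (hκ2 : κ ^ 2 < 4 * (α * b)) :
    ∃ p > (0:ℝ), ∀ χ v : ℝ → ℝ, KppSys κ (kppPhi α b) χ v → χ 0 = 0 → v 0 = p →
      ∃ s, 0 ≤ s ∧ χ s < 0 := by
  obtain ⟨β, hβ⟩ : ∃ β, β = κ / 2 := ⟨_, rfl⟩
  obtain ⟨ω, hω⟩ : ∃ ω, ω = Real.sqrt ((α * b - β ^ 2) / 2) := ⟨_, rfl⟩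
  have hpos : 0 < (α * b - β ^ 2) / 2 := by rw [hβ]; nlinarith
  have hω0 : 0 < ω := by rw [hω]; exact Real.sqrt_pos.2 hpos
  have hω2 : ω ^ 2 = (α * b - β ^ 2) / 2 := by rw [hω]; exact Real.sq_sqrt hpos.le
  obtain ⟨k, hk⟩ : ∃ k, k = β ^ 2 + ω ^ 2 := ⟨_, rfl⟩
  have hk0 : 0 < k := by rw [hk]; positivity
  have hkab : k < α * b := by rw [hk, hω2]; linarith
  obtain ⟨δ, hδ⟩ : ∃ δ, δ = b - k / α := ⟨_, rfl⟩
  have hδ0 : 0 < δ := by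
    rw [hδ, sub_pos, div_lt_iff₀ hα]; linarith
  have hδb : δ ≤ b := by
    have : 0 < k / α := by positivity
    linarith
  have hδk : α * (b - δ) = k := by rw [hδ]; field_simp; ring
  obtain ⟨T, hT⟩ : ∃ T, T = Real.pi / ω := ⟨_, rfl⟩
  have hT0 : 0 < T := by rw [hT]; positivity
  have hωT : ω * T = Real.pi := by rw [hT]; field_simp
  refine ⟨δ / (Real.exp (κ * T) * T), by positivity, ?_⟩
  intro χ v h h0 hv
  by_contra hcon
  push Not at hcon
  have hχpos := traj_pos hα hb hκ h h0 hv (by positivity) hcon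
  have hle : ∀ s, 0 ≤ s → s ≤ T → χ s ≤ δ := by
    intro s hs hsT
    have h1 := kpp_lin_upper h.dχ le_rfl hs (C := δ / T) (fun r hr => by
      have h2 := traj_g_anti hα hb h le_rfl hr.1.le
      simp only [mul_zero, neg_zero, Real.exp_zero, hv, one_mul] at h2
      rw [Real.exp_neg, inv_mul_le_iff₀ (Real.exp_pos _)] at h2
      refine h2.trans ?_
      have h3 : Real.exp (κ * r) ≤ Real.exp (κ * T) := by
        apply Real.exp_le_exp.2
        have : r ≤ T := by linarith [hr.2]
        gcongr
      calc Real.exp (κ * r) * (δ / (Real.exp (κ * T) * T))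
          ≤ Real.exp (κ * T) * (δ / (Real.exp (κ * T) * T)) := by gcongr
        _ = δ / T := by field_simp)
    rw [h0] at h1
    have : δ / T * (s - 0) ≤ δ / T * T := by
      rw [sub_zero]; gcongr
    rw [div_mul_cancel₀ _ hT0.ne'] at this
    linarith
  have dexp : ∀ s : ℝ, HasDerivWithinAt (fun s : ℝ => Real.exp (β * s)) (Real.exp (β * s) * β)
      (Ici 0) s := by
    intro s
    have h1 : HasDerivWithinAt (fun s : ℝ => β * s) (β * 1) (Ici 0) s :=
      (hasDerivWithinAt_id s _).const_mul β
    simpa using h1.exp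
  have dl : ∀ s : ℝ, HasDerivWithinAt (fun s : ℝ => ω * s) ω (Ici 0) s := by
    intro s
    simpa using (hasDerivWithinAt_id s (Ici 0)).const_mul ω
  have dsin : ∀ s : ℝ, HasDerivWithinAt (fun s : ℝ => Real.sin (ω * s)) (Real.cos (ω * s) * ω)
      (Ici 0) s := fun s => (dl s).sin
  have dcos : ∀ s : ℝ, HasDerivWithinAt (fun s : ℝ => Real.cos (ω * s)) (-Real.sin (ω * s) * ω)
      (Ici 0) s := fun s => (dl s).cos
  have du : ∀ s : ℝ, HasDerivWithinAt (fun s : ℝ => Real.exp (β * s) * Real.sin (ω * s))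
      (Real.exp (β * s) * (β * Real.sin (ω * s) + ω * Real.cos (ω * s))) (Ici 0) s := by
    intro s
    refine ((dexp s).fun_mul (dsin s)).congr_deriv ?_
    ring
  have du1 : ∀ s : ℝ, HasDerivWithinAt
      (fun s : ℝ => Real.exp (β * s) * (β * Real.sin (ω * s) + ω * Real.cos (ω * s)))
      (κ * (Real.exp (β * s) * (β * Real.sin (ω * s) + ω * Real.cos (ω * s)))
        - k * (Real.exp (β * s) * Real.sin (ω * s))) (Ici 0) s := by
    intro s
    refine ((dexp s).fun_mul (((dsin s).const_mul β).fun_add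
      ((dcos s).const_mul ω))).congr_deriv ?_
    have : κ = 2 * β := by rw [hβ]; ring
    rw [this, hk]
    ring
  have dW : ∀ s, 0 ≤ s → HasDerivWithinAt
      (fun s => (v s * (Real.exp (β * s) * Real.sin (ω * s)) -
        χ s * (Real.exp (β * s) * (β * Real.sin (ω * s) + ω * Real.cos (ω * s)))) *
          Real.exp (-(κ * s)))
      (Real.exp (β * s) * Real.sin (ω * s) * (k * χ s - kppPhi α b (χ s)) * Real.exp (-(κ * s)))
      (Ici 0) s := by
    intro s hs
    refine ((((h.dv s hs).fun_mul (du s)).fun_sub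
      ((h.dχ s hs).fun_mul (du1 s))).fun_mul (KppPos.kpp_dexp κ s)).congr_deriv ?_
    ring
  have hW := kpp_anti dW le_rfl hT0.le (fun s hs => by
    have h1 := hle s hs.1.le hs.2.le
    have h2 := hχpos s hs.1
    have h3 : kppPhi α b (χ s) = α * χ s * (b - χ s) := by
      rw [kppPhi, kppClamp_eq ⟨h2.le, h1.trans hδb⟩]
    have h4 : k * χ s - kppPhi α b (χ s) ≤ 0 := by
      rw [h3, ← hδk]
      have : 0 ≤ α * χ s * (δ - χ s) := mul_nonneg (by positivity) (by linarith)
      linarith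
    have h5 : 0 ≤ Real.sin (ω * s) := by
      apply Real.sin_nonneg_of_nonneg_of_le_pi
      · have := hs.1
        positivity
      · rw [← hωT]
        have := hs.2.le
        gcongr
    apply mul_nonpos_of_nonpos_of_nonneg _ (Real.exp_pos _).le
    exact mul_nonpos_of_nonneg_of_nonpos (by positivity) h4)
  simp only [hωT, h0, Real.sin_pi, Real.cos_pi, mul_zero, Real.sin_zero, zero_mul, sub_zero,
    zero_add, zero_sub] at hW
  have h7 : 0 < χ T * (Real.exp (β * T) * ω) * Real.exp (-(κ * T)) := by
    have := hχpos T hT0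
    positivity
  linarith

end traj

theorem kpp_exists {α b κ : ℝ} (hα : 0 < α) (hb : 0 < b) (hκ : 0 ≤ κ)
    (hκ2 : κ ^ 2 < 4 * (α * b)) : ∃ χ v : ℝ → ℝ, KppPos α b κ χ v := by
  obtain ⟨χ, v, hsol, hcont⟩ := kpp_flow κ hα hb
  let A : Set ℝ := {p | ∃ s, 0 ≤ s ∧ b < χ p s}
  let B : Set ℝ := {p | ∃ s, 0 ≤ s ∧ χ p s < 0}
  have hA : IsOpen A := by
    have : A = ⋃ s ∈ Ici (0:ℝ), {p | b < χ p s} := by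
      ext p; simp [A]
    rw [this]
    exact isOpen_biUnion (fun s hs => isOpen_lt continuous_const (hcont s hs))
  have hB : IsOpen B := by
    have : B = ⋃ s ∈ Ici (0:ℝ), {p | χ p s < 0} := by
      ext p; simp [B]
    rw [this]
    exact isOpen_biUnion (fun s hs => isOpen_lt (hcont s hs) continuous_const)
  have hAn : (Ioi (0:ℝ) ∩ A).Nonempty := by
    refine ⟨α * b * b + b + 1, mem_Ioi.2 (by positivity), 1, zero_le_one, ?_⟩
    obtain ⟨h, h0, hv⟩ := hsol (α * b * b + b + 1)
    have hM : 0 < α * b * b := by positivity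
    have := kpp_lin_lower h.dχ le_rfl zero_le_one (C := b + 1) (fun r hr => by
      have h1 : α * b * b * r ≤ α * b * b * 1 := by
        have := hr.2.le
        gcongr
      have := traj_v_ge hα hb hκ h hv hr.1.le (by linarith)
      linarith)
    rw [h0] at this
    linarith
  have hBn : (Ioi (0:ℝ) ∩ B).Nonempty := by
    obtain ⟨p, hp, hp1⟩ := traj_small hα hb hκ hκ2
    obtain ⟨h, h0, hv⟩ := hsol p
    exact ⟨p, hp, hp1 _ _ h h0 hv⟩
  have hnot : ¬ (Ioi (0:ℝ) ⊆ A ∪ B) := by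
    intro hsub
    obtain ⟨p, _, ⟨s1, hs1, h1⟩, ⟨s2, hs2, h2⟩⟩ :=
      isPreconnected_Ioi A B hA hB hsub hAn hBn
    obtain ⟨h, h0, hv⟩ := hsol p
    exact traj_disjoint hα hb h h0 hs1 hs2 h1 h2
  rw [not_subset] at hnot
  obtain ⟨p, hp, hpn⟩ := hnot
  obtain ⟨h, h0, hv⟩ := hsol p
  have hle : ∀ s, 0 ≤ s → χ p s ≤ b := by
    intro s hs
    by_contra hc
    exact hpn (Or.inl ⟨s, hs, not_le.1 hc⟩)
  have hge : ∀ s, 0 ≤ s → 0 ≤ χ p s := by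
    intro s hs
    by_contra hc
    exact hpn (Or.inr ⟨s, hs, not_le.1 hc⟩)
  refine ⟨χ p, v p, ⟨?_, hα, hb, hκ, h0, traj_pos hα hb hκ h h0 hv hp hge, ⟨b, hle⟩⟩⟩
  intro s hs
  refine ⟨(h s hs).1, (h s hs).2.congr_deriv ?_⟩
  rw [kppPhi, kppClamp_eq ⟨hge s hs, hle s hs⟩]

theorem kpp_to_pos {a b c d : ℝ} {χ : ℝ → ℝ} (ha : 0 < a) (hb : 0 < b) (hd : 0 < d)
    (hc0 : 0 ≤ c) (h : IsKPPSolution a b c d χ) :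
    KppPos (a / d) b (c / d) χ (derivWithin χ (Ici 0)) := by
  have hu : UniqueDiffOn ℝ (Ici (0:ℝ)) := uniqueDiffOn_Ici 0
  have hs1 : ContDiffOn ℝ 1 (derivWithin χ (Ici 0)) (Ici 0) :=
    h.smooth.derivWithin hu (by norm_num)
  have hdχ : DifferentiableOn ℝ χ (Ici 0) := h.smooth.differentiableOn (by norm_num)
  have hdv : DifferentiableOn ℝ (derivWithin χ (Ici 0)) (Ici 0) :=
    hs1.differentiableOn (by norm_num)
  have hcw : ContinuousOn (derivWithin (derivWithin χ (Ici 0)) (Ici 0)) (Ici 0) :=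
    hs1.continuousOn_derivWithin hu le_rfl
  have hderiv : ∀ s, 0 < s → derivWithin χ (Ici 0) s = deriv χ s := fun s hs =>
    derivWithin_of_mem_nhds (Ici_mem_nhds hs)
  have hode : ∀ s ∈ Ioi (0:ℝ), derivWithin (derivWithin χ (Ici 0)) (Ici 0) s =
      c / d * derivWithin χ (Ici 0) s - a / d * χ s * (b - χ s) := by
    intro s hs
    have h1 : derivWithin (derivWithin χ (Ici 0)) (Ici 0) s = deriv (deriv χ) s := by
      rw [derivWithin_of_mem_nhds (Ici_mem_nhds hs)]
      apply Filter.EventuallyEq.deriv_eq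
      filter_upwards [Ioi_mem_nhds hs] with r hr using hderiv r hr
    have h2 := h.ode s hs
    rw [h1, hderiv s hs]
    field_simp
    linarith
  have hode' : ∀ s ∈ Ici (0:ℝ), derivWithin (derivWithin χ (Ici 0)) (Ici 0) s =
      c / d * derivWithin χ (Ici 0) s - a / d * χ s * (b - χ s) := by
    have hcr : ContinuousOn
        (fun s => c / d * derivWithin χ (Ici 0) s - a / d * χ s * (b - χ s)) (Ici 0) := by
      have h1 := hdχ.continuousOn
      have h2 := hdv.continuousOn
      fun_prop
    have : EqOn (derivWithin (derivWithin χ (Ici 0)) (Ici 0))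
        (fun s => c / d * derivWithin χ (Ici 0) s - a / d * χ s * (b - χ s)) (Ici 0) :=
      EqOn.of_subset_closure hode hcw hcr Ioi_subset_Ici_self (by rw [closure_Ioi])
    exact this
  obtain ⟨M, hM⟩ := h.bounded
  refine ⟨?_, by positivity, hb, by positivity, h.init, h.pos,
    ⟨M, fun s hs => (le_abs_self _).trans (hM s hs)⟩⟩
  intro s hs
  refine ⟨(hdχ s hs).hasDerivWithinAt, ?_⟩
  exact (hdv s hs).hasDerivWithinAt.congr_deriv (hode' s hs)

theorem kpp_of_pos {a b c d : ℝ} {χ v : ℝ → ℝ} (hd : 0 < d)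
    (h : KppPos (a / d) b (c / d) χ v) : IsKPPSolution a b c d χ := by
  have hu : UniqueDiffOn ℝ (Ici (0:ℝ)) := uniqueDiffOn_Ici 0
  have hv : EqOn (derivWithin χ (Ici 0)) v (Ici 0) := fun s hs =>
    (h.sys.dχ s hs).derivWithin (hu s hs)
  have hv2 : EqOn (derivWithin v (Ici 0))
      (fun s => c / d * v s - a / d * χ s * (b - χ s)) (Ici 0) := fun s hs =>
    (h.sys.dv s hs).derivWithin (hu s hs)
  refine ⟨?_, h.init, ?_, h.pos, ⟨b, ?_⟩⟩
  · have h1 : ContDiffOn ℝ 1 v (Ici 0) := by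
      rw [contDiffOn_one_iff_derivWithin hu]
      refine ⟨fun s hs => (h.sys.dv s hs).differentiableWithinAt, ?_⟩
      refine ContinuousOn.congr ?_ hv2
      have h2 := h.sys.cont
      have h3 := h.sys.contv
      fun_prop
    rw [show (2 : WithTop ℕ∞) = 1 + 1 by norm_num, contDiffOn_succ_iff_derivWithin hu]
    exact ⟨fun s hs => (h.sys.dχ s hs).differentiableWithinAt, by simp, h1.congr hv⟩
  · intro s hs
    have h1 : ∀ r, 0 < r → deriv χ r = v r := fun r hr =>
      ((h.sys.dχ r hr.le).hasDerivAt (Ici_mem_nhds hr)).deriv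
    have h2 : deriv (deriv χ) s = c / d * v s - a / d * χ s * (b - χ s) := by
      have : deriv (deriv χ) s = deriv v s := by
        apply Filter.EventuallyEq.deriv_eq
        filter_upwards [Ioi_mem_nhds hs] with r hr using h1 r hr
      rw [this]
      exact ((h.sys.dv s hs.le).hasDerivAt (Ici_mem_nhds hs)).deriv
    rw [h2, h1 s hs]
    field_simp
    ring
  · intro s hs
    rw [abs_of_nonneg (h.nonneg s hs)]
    exact h.le_b s hs

theorem stmt0 (a b c d : ℝ) (ha : 0 < a) (hb : 0 < b) (hd : 0 < d)
    (hc0 : 0 ≤ c) (hc : c < 2 * Real.sqrt (a * b * d)) :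
    (∃ χ : ℝ → ℝ, IsKPPSolution a b c d χ) ∧
    (∀ χ₁ χ₂ : ℝ → ℝ, IsKPPSolution a b c d χ₁ → IsKPPSolution a b c d χ₂ →
      Set.EqOn χ₁ χ₂ (Set.Ici 0)) ∧
    (∀ χ : ℝ → ℝ, IsKPPSolution a b c d χ →
      StrictMonoOn χ (Set.Ici 0) ∧
      Filter.Tendsto χ Filter.atTop (nhds b) ∧
      ∃ bχ > (0:ℝ), Filter.Tendsto
        (fun s => (b - χ s) *
          Real.exp (-(((c - Real.sqrt (c ^ 2 + 4 * a * b * d)) / (2 * d)) * s)))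
        Filter.atTop (nhds bχ)) := by
  have hα : 0 < a / d := by positivity
  have hκ : 0 ≤ c / d := by positivity
  refine ⟨?_, ?_, ?_⟩
  · have hκ2 : (c / d) ^ 2 < 4 * (a / d * b) := by
      have h1 : c ^ 2 < 4 * (a * b * d) := by
        have h2 : 0 ≤ a * b * d := by positivity
        have h3 := Real.sq_sqrt h2
        have h4 := Real.sqrt_nonneg (a * b * d)
        nlinarith
      have h5 : 4 * (a / d * b) = 4 * (a * b * d) / d ^ 2 := by field_simp
      rw [h5, div_pow]
      gcongr
    obtain ⟨χ, v, h⟩ := kpp_exists hα hb hκ hκ2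
    exact ⟨χ, kpp_of_pos hd h⟩
  · intro χ₁ χ₂ h₁ h₂ s hs
    exact KppPos.unique (kpp_to_pos ha hb hd hc0 h₁) (kpp_to_pos ha hb hd hc0 h₂) s hs
  · intro χ h
    have hp := kpp_to_pos ha hb hd hc0 h
    refine ⟨hp.strictMono, hp.tendsto, ?_⟩
    have h1 : 0 < 4 * a * b * d := by positivity
    have h2 := Real.sq_sqrt (by positivity : 0 ≤ c ^ 2 + 4 * a * b * d)
    apply hp.asymp
    · have h3 : Real.sqrt (c ^ 2 + 4 * a * b * d) ^ 2 = c ^ 2 + 4 * a * b * d := h2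
      generalize Real.sqrt (c ^ 2 + 4 * a * b * d) = q at h3
      field_simp
      linear_combination h3
    · apply div_neg_of_neg_of_pos _ (by positivity)
      have : c < Real.sqrt (c ^ 2 + 4 * a * b * d) := by
        apply Real.lt_sqrt_of_sq_lt
        linarith
      linarith
end

section
/- Fix constants d, r > 0, c ≥ 0, and h, k ∈ (0,1), and set u* = (1-k)/(1-hk). Then the problem dω''(s) + cω'(s) + r(hu* - ω(s))(1 - hu* + ω(s)) = 0 for s ∈ (0,∞), ω(0) = 0, admits a unique positive solution ω satisfying ω(s) → hu* as s → ∞ (i.e. ω is twice continuously differentiable on [0,∞), satisfies the equation on (0,∞), ω(0) = 0, ω(s) > 0 for s > 0, and ω(s) → hu* as s → ∞). Moreover ω is strictly increasing on (0,∞) and there exists b_ω > 0 such that (hu* - ω(s))·e^{((c + √(c² + 4dr))/(2d))·s} → b_ω as s → ∞. -/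
open Real Filter Set

/-- `ω` is a positive solution of `d ω'' + c ω' + r (hu - ω)(1 - hu + ω) = 0` on `(0,∞)`
with `ω(0) = 0` and `ω(s) → hu` as `s → ∞`. -/
structure IsOmegaSolution (d r c hu : ℝ) (ω : ℝ → ℝ) : Prop where
  smooth : ContDiffOn ℝ 2 ω (Set.Ici 0)
  init : ω 0 = 0
  ode : ∀ s > (0:ℝ),
    d * deriv (deriv ω) s + c * deriv ω s + r * (hu - ω s) * (1 - hu + ω s) = 0
  pos : ∀ s > (0:ℝ), 0 < ω s
  lim : Filter.Tendsto ω Filter.atTop (nhds hu)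

lemma mono_help {D : Set ℝ} (hD : Convex ℝ D) {f f' : ℝ → ℝ} (hc : ContinuousOn f D)
    (hd : ∀ x ∈ interior D, HasDerivAt f (f' x) x) (h0 : ∀ x ∈ interior D, 0 ≤ f' x) :
    MonotoneOn f D :=
  monotoneOn_of_deriv_nonneg hD hc (fun x hx => (hd x hx).differentiableAt.differentiableWithinAt)
    (fun x hx => by rw [(hd x hx).deriv]; exact h0 x hx)

lemma smono_help {D : Set ℝ} (hD : Convex ℝ D) {f f' : ℝ → ℝ} (hc : ContinuousOn f D)
    (hd : ∀ x ∈ interior D, HasDerivAt f (f' x) x) (h0 : ∀ x ∈ interior D, 0 < f' x) :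
    StrictMonoOn f D :=
  strictMonoOn_of_deriv_pos hD hc (fun x hx => by rw [(hd x hx).deriv]; exact h0 x hx)

lemma santi_help {D : Set ℝ} (hD : Convex ℝ D) {f f' : ℝ → ℝ} (hc : ContinuousOn f D)
    (hd : ∀ x ∈ interior D, HasDerivAt f (f' x) x) (h0 : ∀ x ∈ interior D, f' x < 0) :
    StrictAntiOn f D :=
  strictAntiOn_of_deriv_neg hD hc (fun x hx => by rw [(hd x hx).deriv]; exact h0 x hx)

lemma anti_help {D : Set ℝ} (hD : Convex ℝ D) {f f' : ℝ → ℝ} (hc : ContinuousOn f D)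
    (hd : ∀ x ∈ interior D, HasDerivAt f (f' x) x) (h0 : ∀ x ∈ interior D, f' x ≤ 0) :
    AntitoneOn f D :=
  antitoneOn_of_deriv_nonpos hD hc (fun x hx => (hd x hx).differentiableAt.differentiableWithinAt)
    (fun x hx => by rw [(hd x hx).deriv]; exact h0 x hx)

lemma hexp (m x : ℝ) : HasDerivAt (fun s => exp (m * s)) (m * exp (m * x)) x := by
  have := ((hasDerivAt_id x).const_mul m).exp
  simpa [mul_comm] using this

/-- The transformed solution `v = hu - ω`, with derivative `w`. -/
structure Sol (L K A : ℝ) (v w : ℝ → ℝ) : Prop where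
  cont : ContinuousOn v (Ici 0)
  v0 : v 0 = A
  d1 : ∀ s > (0:ℝ), HasDerivAt v (w s) s
  d2 : ∀ s > (0:ℝ), HasDerivAt w (L * K * v s * (1 - v s) - (L - K) * w s) s
  lt : ∀ s > (0:ℝ), v s < A
  lim : Tendsto v atTop (nhds 0)

section
variable {L K A : ℝ} {v w : ℝ → ℝ}

lemma exp_neg_lim (hK : 0 < K) : Tendsto (fun s : ℝ => exp (-K * s)) atTop (nhds 0) := by
  have h : Tendsto (fun s : ℝ => K * s) atTop atTop := tendsto_id.const_mul_atTop hK
  have := tendsto_exp_neg_atTop_nhds_zero.comp h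
  refine this.congr fun s => ?_
  simp [Function.comp]

lemma Sol.vpos (hL : 0 < L) (hK : 0 < K) (hA : 0 < A) (S : Sol L K A v w) :
    ∀ s > (0:ℝ), 0 < v s := by
  intro s1 hs1
  by_contra hneg
  push Not at hneg
  have hy : ∀ s > (0:ℝ), HasDerivAt (fun s => exp (L * s) * (K * v s - w s))
      (L * K * exp (L * s) * v s ^ 2) s := by
    intro s hs
    have := (hexp L s).mul (((S.d1 s hs).const_mul K).sub (S.d2 s hs))
    refine this.congr_deriv ?_
    simp only [Pi.sub_apply]
    ring
  have hv : ∀ s > (0:ℝ), HasDerivAt (fun s => exp (-K * s) * v s)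
      (-(exp (-K * s) * (K * v s - w s))) s := by
    intro s hs
    refine ((hexp (-K) s).mul (S.d1 s hs)).congr_deriv ?_
    ring
  have ymono : MonotoneOn (fun s => exp (L * s) * (K * v s - w s)) (Ioi 0) := by
    refine mono_help (convex_Ioi 0) (fun s hs => (hy s hs).continuousAt.continuousWithinAt)
      (f' := fun s => L * K * exp (L * s) * v s ^ 2) ?_ ?_
    · intro x hx; rw [interior_Ioi] at hx; exact hy x hx
    · intro x hx; positivity
  have hlim : Tendsto (fun s => exp (-K * s) * v s) atTop (nhds 0) := by
    simpa using (exp_neg_lim hK).mul S.lim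
  rcases le_or_gt (K * v s1 - w s1) 0 with h | h
  · have : MonotoneOn (fun s => exp (-K * s) * v s) (Icc 0 s1) := by
      refine mono_help (convex_Icc 0 s1) ?_
        (f' := fun s => (-(exp (-K * s) * (K * v s - w s)))) ?_ ?_
      · refine ContinuousOn.mul (by fun_prop) (S.cont.mono Icc_subset_Ici_self)
      · intro x hx; rw [interior_Icc] at hx; exact hv x hx.1
      · intro x hx; rw [interior_Icc] at hx
        have h1 := ymono hx.1 hs1 hx.2.le
        simp only at h1
        have h2 : exp (L * s1) * (K * v s1 - w s1) ≤ 0 :=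
          mul_nonpos_of_nonneg_of_nonpos (exp_pos _).le h
        have h3 : K * v x - w x ≤ 0 := by
          by_contra hc
          push Not at hc
          have := mul_pos (exp_pos (L * x)) hc
          linarith
        have := mul_nonpos_of_nonneg_of_nonpos (exp_pos (-K * x)).le h3
        linarith
    have h1 := this (left_mem_Icc.2 hs1.le) (right_mem_Icc.2 hs1.le) hs1.le
    simp [S.v0] at h1
    have := mul_nonpos_of_nonneg_of_nonpos (exp_pos (-(K * s1))).le hneg
    linarith
  · have : StrictAntiOn (fun s => exp (-K * s) * v s) (Ici s1) := by
      refine santi_help (convex_Ici s1) ?_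
        (f' := fun s => (-(exp (-K * s) * (K * v s - w s)))) ?_ ?_
      · intro x hx
        exact (hv x (lt_of_lt_of_le hs1 hx)).continuousAt.continuousWithinAt
      · intro x hx; rw [interior_Ici] at hx; exact hv x (lt_trans hs1 hx)
      · intro x hx; rw [interior_Ici] at hx
        have hx : s1 < x := hx
        have h1 := ymono hs1 (lt_trans hs1 hx) hx.le
        simp only at h1
        have h2 := mul_pos (exp_pos (L * s1)) h
        have h3 : 0 < K * v x - w x := by
          by_contra hc
          push Not at hc
          have := mul_nonpos_of_nonneg_of_nonpos (exp_pos (L * x)).le hc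
          linarith
        have := mul_pos (exp_pos (-K * x)) h3
        linarith
    have h1 : exp (-K * (s1 + 1)) * v (s1 + 1) < exp (-K * s1) * v s1 :=
      this (self_mem_Ici) (by simp) (by linarith)
    have h2 : 0 ≤ exp (-K * (s1 + 1)) * v (s1 + 1) := by
      refine le_of_tendsto hlim ?_
      filter_upwards [eventually_ge_atTop (s1 + 1)] with t ht
      exact this.antitoneOn (by simp) (by simp; linarith) ht
    have := mul_nonpos_of_nonneg_of_nonpos (exp_pos (-K * s1)).le hneg
    linarith

lemma Sol.hP (S : Sol L K A v w) : ∀ s > (0:ℝ), HasDerivAt (fun s => exp ((L - K) * s) * w s)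
    (exp ((L - K) * s) * (L * K * v s * (1 - v s))) s := by
  intro s hs
  refine ((hexp (L - K) s).mul (S.d2 s hs)).congr_deriv ?_
  ring

lemma Sol.Pmono (hL : 0 < L) (hK : 0 < K) (hA : 0 < A) (hA1 : A < 1) (S : Sol L K A v w) :
    StrictMonoOn (fun s => exp ((L - K) * s) * w s) (Ioi 0) := by
  refine smono_help (convex_Ioi 0) (fun s hs => (S.hP s hs).continuousAt.continuousWithinAt)
      (f' := fun s => exp ((L - K) * s) * (L * K * v s * (1 - v s))) ?_ ?_
  · intro x hx; rw [interior_Ioi] at hx; exact S.hP x hx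
  · intro x hx; rw [interior_Ioi] at hx
    have := S.vpos hL hK hA x hx
    have h2 := S.lt x hx
    have : 0 < 1 - v x := by linarith
    positivity

lemma Sol.wneg (hL : 0 < L) (hK : 0 < K) (hA : 0 < A) (hA1 : A < 1) (S : Sol L K A v w) :
    ∀ s > (0:ℝ), w s < 0 := by
  intro s1 hs1
  by_contra hneg
  push Not at hneg
  have : StrictMonoOn v (Ici s1) := by
    refine smono_help (convex_Ici s1) ?_ (f' := w) ?_ ?_
    · intro x hx
      exact (S.d1 x (lt_of_lt_of_le hs1 hx)).continuousAt.continuousWithinAt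
    · intro x hx; rw [interior_Ici] at hx; exact S.d1 x (lt_trans hs1 hx)
    · intro x hx; rw [interior_Ici] at hx
      have h1 := S.Pmono hL hK hA hA1 hs1 (lt_trans hs1 hx) hx
      simp only at h1
      have h2 : 0 ≤ exp ((L - K) * s1) * w s1 := by positivity
      by_contra hc
      push Not at hc
      have := mul_nonpos_of_nonneg_of_nonpos (exp_pos ((L - K) * x)).le hc
      linarith
  have h1 : v s1 ≤ 0 := by
    refine ge_of_tendsto S.lim ?_
    filter_upwards [eventually_ge_atTop s1] with t ht
    exact this.monotoneOn (by simp) (by simpa) ht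
  linarith [S.vpos hL hK hA s1 hs1]

lemma Sol.wlim (hL : 0 < L) (hK : 0 < K) (hA : 0 < A) (hA1 : A < 1) (hLK : K ≤ L)
    (S : Sol L K A v w) : Tendsto (fun s => exp (-K * s) * w s) atTop (nhds 0) := by
  refine Tendsto.zero_mul_isBoundedUnder_le (exp_neg_lim hK) ?_
  refine ⟨exp (L - K) * -w 1, ?_⟩
  rw [eventually_map]
  filter_upwards [eventually_ge_atTop 1] with t ht
  have h0 : (0:ℝ) < t := by linarith
  have h1 := (S.Pmono hL hK hA hA1).monotoneOn (show (0:ℝ) < 1 by norm_num) h0 ht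
  simp only [mul_one] at h1
  have h2 := S.wneg hL hK hA hA1 t h0
  simp only [Function.comp, Real.norm_eq_abs]
  rw [abs_of_neg h2]
  have h3 : 1 ≤ exp ((L - K) * t) := by
    apply one_le_exp
    apply mul_nonneg <;> linarith
  nlinarith

lemma Sol.z_nonneg (hL : 0 < L) (hK : 0 < K) (hA : 0 < A) (hA1 : A < 1) (hLK : K ≤ L)
    (S : Sol L K A v w) : ∀ s > (0:ℝ), 0 ≤ w s + L * v s := by
  have hz : ∀ s > (0:ℝ), HasDerivAt (fun s => exp (-K * s) * (w s + L * v s))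
      (-(L * K * exp (-K * s) * v s ^ 2)) s := by
    intro s hs
    refine ((hexp (-K) s).mul ((S.d2 s hs).add ((S.d1 s hs).const_mul L))).congr_deriv ?_
    simp only [Pi.add_apply]
    ring
  have zanti : AntitoneOn (fun s => exp (-K * s) * (w s + L * v s)) (Ioi 0) := by
    refine anti_help (convex_Ioi 0) (fun s hs => (hz s hs).continuousAt.continuousWithinAt)
      (f' := fun s => -(L * K * exp (-K * s) * v s ^ 2)) ?_ ?_
    · intro x hx; rw [interior_Ioi] at hx; exact hz x hx
    · intro x hx
      have : 0 ≤ L * K * exp (-K * x) * v x ^ 2 := by positivity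
      linarith
  have hl : Tendsto (fun s => exp (-K * s) * (w s + L * v s)) atTop (nhds 0) := by
    have := (S.wlim hL hK hA hA1 hLK).add (((exp_neg_lim hK).mul S.lim).const_mul L)
    simp only [mul_zero, add_zero] at this
    refine this.congr fun s => ?_
    ring
  intro s hs
  have h2 : 0 ≤ exp (-K * s) * (w s + L * v s) := by
    refine le_of_tendsto hl ?_
    filter_upwards [eventually_ge_atTop s] with t ht
    exact zanti hs (lt_of_lt_of_le hs ht) ht
  exact nonneg_of_mul_nonneg_right h2 (exp_pos _)

lemma Sol.z_le (hL : 0 < L) (hK : 0 < K) (hA : 0 < A) (hA1 : A < 1) (hLK : K ≤ L)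
    (S : Sol L K A v w) : ∀ s > (0:ℝ), w s + L * v s ≤ L * v s ^ 2 := by
  have hz : ∀ s > (0:ℝ), HasDerivAt (fun s => exp (-K * s) * (w s + L * v s - L * v s ^ 2))
      (exp (-K * s) * (2 * L * v s * (- w s))) s := by
    intro s hs
    refine ((hexp (-K) s).mul (((S.d2 s hs).add ((S.d1 s hs).const_mul L)).sub
      (((S.d1 s hs).pow 2).const_mul L))).congr_deriv ?_
    simp
    ring
  have zanti : MonotoneOn (fun s => exp (-K * s) * (w s + L * v s - L * v s ^ 2)) (Ioi 0) := by
    refine mono_help (convex_Ioi 0) (fun s hs => (hz s hs).continuousAt.continuousWithinAt)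
      (f' := fun s => (exp (-K * s) * (2 * L * v s * (- w s)))) ?_ ?_
    · intro x hx; rw [interior_Ioi] at hx; exact hz x hx
    · intro x hx; rw [interior_Ioi] at hx
      have h1 := S.vpos hL hK hA x hx
      have h2 : 0 < - w x := by linarith [S.wneg hL hK hA hA1 x hx]
      positivity
  have hl : Tendsto (fun s => exp (-K * s) * (w s + L * v s - L * v s ^ 2)) atTop (nhds 0) := by
    have := ((S.wlim hL hK hA hA1 hLK).add (((exp_neg_lim hK).mul S.lim).const_mul L)).sub
      (((exp_neg_lim hK).mul (S.lim.pow 2)).const_mul L)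
    simp only [mul_zero, add_zero, zero_mul, sub_zero] at this
    refine this.congr fun s => ?_
    ring
  intro s hs
  have h2 : exp (-K * s) * (w s + L * v s - L * v s ^ 2) ≤ 0 := by
    refine ge_of_tendsto hl ?_
    filter_upwards [eventually_ge_atTop s] with t ht
    exact zanti hs (lt_of_lt_of_le hs ht) ht
  by_contra hc
  push Not at hc
  have := mul_pos (exp_pos (-K * s)) (sub_pos.2 hc)
  linarith

lemma Sol.asymp (hL : 0 < L) (hK : 0 < K) (hA : 0 < A) (hA1 : A < 1) (hLK : K ≤ L)
    (S : Sol L K A v w) : ∃ b > (0:ℝ), Tendsto (fun s => v s * exp (L * s)) atTop (nhds b) := by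
  have hN : ∀ s > (0:ℝ), HasDerivAt (fun s => v s * exp (L * s))
      ((w s + L * v s) * exp (L * s)) s := by
    intro s hs
    refine ((S.d1 s hs).mul (hexp L s)).congr_deriv ?_
    ring
  have hmono : MonotoneOn (fun s => v s * exp (L * s)) (Ioi 0) := by
    refine mono_help (convex_Ioi 0) (fun s hs => (hN s hs).continuousAt.continuousWithinAt)
      (f' := fun s => ((w s + L * v s) * exp (L * s))) ?_ ?_
    · intro x hx; rw [interior_Ioi] at hx; exact hN x hx
    · intro x hx; rw [interior_Ioi] at hx
      exact mul_nonneg (S.z_nonneg hL hK hA hA1 hLK x hx) (exp_pos _).le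
  have hF : ∀ s > (0:ℝ), HasDerivAt (fun s => v s * exp (L * s) / (1 - v s))
      ((w s + L * v s - L * v s ^ 2) * exp (L * s) / (1 - v s) ^ 2) s := by
    intro s hs
    have h1 : 1 - v s ≠ 0 := by linarith [S.lt s hs]
    refine ((hN s hs).div ((S.d1 s hs).const_sub 1) h1).congr_deriv ?_
    ring
  have hanti : AntitoneOn (fun s => v s * exp (L * s) / (1 - v s)) (Ioi 0) := by
    refine anti_help (convex_Ioi 0) (fun s hs => (hF s hs).continuousAt.continuousWithinAt)
      (f' := fun s => ((w s + L * v s - L * v s ^ 2) * exp (L * s) / (1 - v s) ^ 2)) ?_ ?_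
    · intro x hx; rw [interior_Ioi] at hx; exact hF x hx
    · intro x hx; rw [interior_Ioi] at hx
      have := S.z_le hL hK hA hA1 hLK x hx
      apply div_nonpos_of_nonpos_of_nonneg
      · exact mul_nonpos_of_nonpos_of_nonneg (by linarith) (exp_pos _).le
      · positivity
  set f : ℝ → ℝ := fun s => v (max s 1) * exp (L * max s 1) with hf
  have fm : Monotone f := fun x y hxy =>
    hmono (mem_Ioi.2 (lt_of_lt_of_le one_pos (le_max_right _ _)))
      (mem_Ioi.2 (lt_of_lt_of_le one_pos (le_max_right _ _)))
      (max_le_max_right 1 hxy)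
  have fb : BddAbove (range f) := by
    refine ⟨v 1 * exp (L * 1) / (1 - v 1), ?_⟩
    rintro _ ⟨s, rfl⟩
    have hp : (0:ℝ) < max s 1 := (lt_of_lt_of_le one_pos (le_max_right _ _))
    have h1 := hanti (show (0:ℝ) < 1 by norm_num) hp (le_max_right _ _)
    refine le_trans ?_ h1
    simp only [hf]
    have h2 := S.vpos hL hK hA _ hp
    have h3 := S.lt _ hp
    rw [le_div_iff₀ (by linarith)]
    have := mul_pos h2 (exp_pos (L * max s 1))
    nlinarith
  have ht := tendsto_atTop_ciSup fm fb
  refine ⟨_, ?_, ht.congr' ?_⟩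
  · have : 0 < f 1 := by
      simp only [hf, max_self]
      exact mul_pos (S.vpos hL hK hA 1 one_pos) (exp_pos _)
    exact lt_of_lt_of_le this (le_ciSup fb 1)
  · filter_upwards [eventually_ge_atTop 1] with s hs
    simp [hf, max_eq_left hs]

end
lemma Sol.not_lt {L K A : ℝ} {v₁ w₁ v₂ w₂ : ℝ → ℝ} (hL : 0 < L) (hK : 0 < K) (hA : 0 < A)
    (hA1 : A < 1) (hLK : K ≤ L) (S₁ : Sol L K A v₁ w₁) (S₂ : Sol L K A v₂ w₂)
    (s₀ : ℝ) (hs₀ : 0 < s₀) : ¬ v₁ s₀ < v₂ s₀ := by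
  intro hlt
  set J : ℝ → ℝ := fun s => exp ((L - K) * s) * ((A - v₁ s) * w₂ s - w₁ s * (A - v₂ s)) with hJ
  set ρ : ℝ → ℝ := fun s => (A - v₁ s) / (A - v₂ s) with hρ
  have dJ : ∀ s > (0:ℝ), HasDerivAt J (exp ((L - K) * s) * (L * K) * ((v₂ s - v₁ s) *
      (A * (1 - A) + (A - v₁ s) * (A - v₂ s)))) s := by
    intro s hs
    refine ((hexp (L - K) s).mul ((((S₁.d1 s hs).const_sub A).mul (S₂.d2 s hs)).sub
      ((S₁.d2 s hs).mul ((S₂.d1 s hs).const_sub A)))).congr_deriv ?_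
    simp only [Pi.sub_apply, Pi.mul_apply]
    ring
  have dρ : ∀ s > (0:ℝ), HasDerivAt ρ (J s * exp (-((L - K) * s)) / (A - v₂ s) ^ 2) s := by
    intro s hs
    have h1 : A - v₂ s ≠ 0 := by linarith [S₂.lt s hs]
    refine (((S₁.d1 s hs).const_sub A).div ((S₂.d1 s hs).const_sub A) h1).congr_deriv ?_
    simp only [hJ]
    rw [mul_right_comm, ← Real.exp_add]
    simp only [add_neg_cancel, exp_zero]
    ring
  have Jmono : ∀ D : Set ℝ, Convex ℝ D → D ⊆ Ioi 0 → (∀ s ∈ interior D, v₁ s < v₂ s) →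
      StrictMonoOn J D := by
    intro D hD hsub hp
    refine smono_help hD (fun s hs => (dJ s (hsub hs)).continuousAt.continuousWithinAt)
      (fun x hx => dJ x (hsub (interior_subset hx))) ?_
    intro x hx
    have hx0 := hsub (interior_subset hx)
    have h1 := sub_pos.2 (hp x hx)
    have h2 := sub_pos.2 (S₁.lt x hx0)
    have h3 := sub_pos.2 (S₂.lt x hx0)
    have h4 := sub_pos.2 hA1
    positivity
  have hcont : ContinuousOn (fun s => v₂ s - v₁ s) (Ici 0) := S₂.cont.sub S₁.cont
  have ρgt : ∀ s > (0:ℝ), (1 < ρ s ↔ v₁ s < v₂ s) := by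
    intro s hs
    simp only [hρ]
    rw [one_lt_div (sub_pos.2 (S₂.lt s hs))]
    constructor <;> intro h <;> linarith
  have ρs := (ρgt s₀ hs₀).2 hlt
  -- Step A
  have hA0 : 0 < J s₀ := by
    by_contra hc
    push Not at hc
    obtain ⟨α, ⟨⟨hα0, hαs⟩, hα⟩, hmax⟩ : ∃ α, IsGreatest (Icc 0 s₀ ∩ {t | v₂ t - v₁ t ≤ 0}) α := by
      refine IsCompact.exists_isGreatest ?_ ⟨0, ⟨le_rfl, hs₀.le⟩, by simp [S₁.v0, S₂.v0]⟩
      refine isCompact_Icc.of_isClosed_subset ?_ inter_subset_left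
      exact (hcont.mono Icc_subset_Ici_self).preimage_isClosed_of_isClosed isClosed_Icc isClosed_Iic
    have hpos : ∀ t, α < t → t ≤ s₀ → v₁ t < v₂ t := by
      intro t h1 h2
      by_contra h3
      push Not at h3
      have : t ≤ α := hmax ⟨⟨by linarith, h2⟩, by simp; exact h3⟩
      linarith
    have hα' : v₂ α - v₁ α ≤ 0 := hα
    rcases hα0.eq_or_lt with h0 | h0
    · subst h0
      have hm := Jmono (Ioc 0 s₀) (convex_Ioc 0 s₀) (fun x hx => hx.1)
        (fun x hx => by rw [interior_Ioc] at hx; exact hpos x hx.1 hx.2.le)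
      have h1 : J (s₀ / 2) < 0 := by
        have := hm (a := s₀ / 2) (b := s₀) ⟨by linarith, by linarith⟩ ⟨hs₀, le_rfl⟩ (by linarith)
        linarith
      have hl : Tendsto (fun t => -(exp ((L - K) * t) * ((A - v₁ t) * (L * A))))
          (nhdsWithin 0 (Ioi 0)) (nhds 0) := by
        have c1 : Tendsto v₁ (nhdsWithin 0 (Ioi 0)) (nhds A) := by
          have := (S₁.cont 0 self_mem_Ici).mono (Ioi_subset_Ici_self)
          simpa [ContinuousWithinAt, S₁.v0] using this
        have c2 : Tendsto (fun t : ℝ => exp ((L - K) * t)) (nhdsWithin 0 (Ioi 0)) (nhds 1) := by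
          have : Continuous (fun t : ℝ => exp ((L - K) * t)) := by fun_prop
          simpa using (this.tendsto 0).mono_left nhdsWithin_le_nhds
        have := (c2.mul ((c1.const_sub A).mul_const (L * A))).neg
        simpa using this
      have : 0 ≤ J (s₀ / 2) := by
        refine le_of_tendsto hl ?_
        filter_upwards [Ioo_mem_nhdsGT (show (0:ℝ) < s₀ / 2 by linarith)] with t ht
        have h2 := hm (a := t) (b := s₀ / 2) ⟨ht.1, by linarith [ht.2]⟩
          ⟨by linarith, by linarith⟩ ht.2
        refine le_trans ?_ h2.le
        simp only [hJ]
        rw [← mul_neg]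
        apply mul_le_mul_of_nonneg_left _ (exp_pos _).le
        have e1 := sub_pos.2 (S₁.lt t ht.1)
        have e2 := sub_pos.2 (S₂.lt t ht.1)
        have e3 := S₁.wneg hL hK hA hA1 t ht.1
        have e4 := S₂.z_nonneg hL hK hA hA1 hLK t ht.1
        have e5 : -(L * A) ≤ w₂ t := by nlinarith
        nlinarith
      linarith
    · have hm := Jmono (Icc α s₀) (convex_Icc α s₀) (fun x hx => lt_of_lt_of_le h0 hx.1)
        (fun x hx => by rw [interior_Icc] at hx; exact hpos x hx.1 hx.2.le)
      have ha : AntitoneOn ρ (Icc α s₀) := by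
        refine anti_help (convex_Icc α s₀)
          (fun s hs => (dρ s (lt_of_lt_of_le h0 hs.1)).continuousAt.continuousWithinAt)
          (fun x hx => dρ x (lt_of_lt_of_le h0 (interior_subset hx).1)) ?_
        intro x hx
        have hx' := interior_subset hx
        have := hm.monotoneOn hx' ⟨hαs, le_rfl⟩ hx'.2
        apply div_nonpos_of_nonpos_of_nonneg
        · exact mul_nonpos_of_nonpos_of_nonneg (by linarith) (exp_pos _).le
        · positivity
      have h5 := ha ⟨le_rfl, hαs⟩ ⟨hαs, le_rfl⟩ hαs
      have h6 := (ρgt α h0).1 (by linarith)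
      linarith
  have ρmono : ∀ D : Set ℝ, Convex ℝ D → D ⊆ Ici s₀ → s₀ ∈ D → (∀ s ∈ interior D, v₁ s < v₂ s) →
      MonotoneOn ρ D := by
    intro D hD hsub hmem hp
    have hsub' : D ⊆ Ioi 0 := fun x hx => lt_of_lt_of_le hs₀ (hsub hx)
    have hm := Jmono D hD hsub' hp
    refine mono_help hD (fun s hs => (dρ s (hsub' hs)).continuousAt.continuousWithinAt)
      (fun x hx => dρ x (hsub' (interior_subset hx))) ?_
    intro x hx
    have hx' := interior_subset hx
    have := hm.monotoneOn hmem hx' (hsub hx')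
    apply div_nonneg
    · exact mul_nonneg (by linarith) (exp_pos _).le
    · positivity
  have hB : ∀ t ≥ s₀, v₁ t < v₂ t := by
    intro t ht
    by_contra hc
    obtain ⟨β, ⟨⟨hβ0, hβs⟩, hβ⟩, hmin⟩ : ∃ α, IsLeast (Icc s₀ t ∩ {t | v₂ t - v₁ t ≤ 0}) α := by
      refine IsCompact.exists_isLeast ?_ ⟨t, ⟨ht, le_rfl⟩, by simp; linarith⟩
      refine isCompact_Icc.of_isClosed_subset ?_ inter_subset_left
      exact (hcont.mono (fun x hx => le_trans hs₀.le hx.1)).preimage_isClosed_of_isClosed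
        isClosed_Icc isClosed_Iic
    have hβ' : v₂ β - v₁ β ≤ 0 := hβ
    have hm := ρmono (Icc s₀ β) (convex_Icc _ _) Icc_subset_Ici_self ⟨le_rfl, hβ0⟩ (by
      intro x hx
      rw [interior_Icc] at hx
      by_contra h3
      push Not at h3
      have : β ≤ x := hmin ⟨⟨hx.1.le, by linarith [hx.2]⟩, by simp; exact h3⟩
      linarith [hx.2])
    have h5 := hm ⟨le_rfl, hβ0⟩ ⟨hβ0, le_rfl⟩ hβ0
    have h6 := (ρgt β (by linarith)).1 (by linarith)
    linarith
  have hm := ρmono (Ici s₀) (convex_Ici _) le_rfl self_mem_Ici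
    (fun x hx => hB x (interior_subset hx))
  have hl : Tendsto ρ atTop (nhds 1) := by
    have := (S₁.lim.const_sub A).div (S₂.lim.const_sub A) (by simpa using hA.ne')
    rw [sub_zero, div_self hA.ne'] at this
    exact this
  have : ρ s₀ ≤ 1 := by
    refine ge_of_tendsto hl ?_
    filter_upwards [eventually_ge_atTop s₀] with t ht
    exact hm self_mem_Ici ht ht
  linarith

lemma Sol.unique {L K A : ℝ} {v₁ w₁ v₂ w₂ : ℝ → ℝ} (hL : 0 < L) (hK : 0 < K) (hA : 0 < A)
    (hA1 : A < 1) (hLK : K ≤ L) (S₁ : Sol L K A v₁ w₁) (S₂ : Sol L K A v₂ w₂) :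
    EqOn v₁ v₂ (Ici 0) := by
  intro s hs
  rcases (mem_Ici.1 hs).eq_or_lt with h | h
  · rw [← h, S₁.v0, S₂.v0]
  · have h1 := S₁.not_lt hL hK hA hA1 hLK S₂ s h
    have h2 := S₂.not_lt hL hK hA hA1 hLK S₁ s h
    linarith

/-- Green kernel of the linearised operator on the half line. -/
noncomputable def Gk (L K s t : ℝ) : ℝ :=
  ((if t ≤ s then exp (-L * s) * exp (L * t) else exp (K * s) * exp (-K * t))
    - exp (-L * s) * exp (-K * t)) / (L + K)

section
variable {L K : ℝ}

lemma Gk_meas : Measurable (fun p : ℝ × ℝ => Gk L K p.1 p.2) := by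
  unfold Gk
  refine Measurable.div_const (Measurable.sub ?_ (by fun_prop)) _
  exact Measurable.ite (measurableSet_le measurable_snd measurable_fst) (by fun_prop) (by fun_prop)

lemma Gk_nonneg (hL : 0 < L) (hK : 0 < K) {s t : ℝ} (hs : 0 ≤ s) (ht : 0 ≤ t) :
    0 ≤ Gk L K s t := by
  unfold Gk
  refine div_nonneg ?_ (by linarith)
  rw [sub_nonneg]
  split_ifs with h
  · apply mul_le_mul_of_nonneg_left _ (exp_pos _).le
    apply exp_le_exp.2
    nlinarith
  · apply mul_le_mul_of_nonneg_right _ (exp_pos _).le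
    apply exp_le_exp.2
    nlinarith

lemma Gk_le (hL : 0 < L) (hK : 0 < K) {s t : ℝ} :
    Gk L K s t ≤ exp (K * s) / (L + K) * exp (-K * t) := by
  unfold Gk
  rw [div_mul_eq_mul_div]
  apply div_le_div_of_nonneg_right _ (by linarith)
  have h0 : 0 < exp (-L * s) * exp (-K * t) := by positivity
  split_ifs with h
  · have : exp (-L * s) * exp (L * t) ≤ exp (K * s) * exp (-K * t) := by
      rw [← Real.exp_add, ← Real.exp_add]
      apply exp_le_exp.2
      nlinarith
    linarith
  · linarith

lemma expg_int (hK : 0 < K) {g : ℝ → ℝ} (hg : Measurable g) (hb : ∀ t, |g t| ≤ 1) (C : ℝ) :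
    MeasureTheory.IntegrableOn (fun t => C * exp (-K * t) * g t) (Ioi 0) := by
  have h0 : MeasureTheory.IntegrableOn (fun t => C * exp (-K * t)) (Ioi 0) :=
    (integrableOn_exp_mul_Ioi (show -K < 0 by linarith) 0).const_mul C
  refine MeasureTheory.Integrable.mul_bdd (c := 1) h0 hg.aestronglyMeasurable ?_
  filter_upwards with t
  exact hb t

lemma Gk_int (hL : 0 < L) (hK : 0 < K) {g : ℝ → ℝ} (hg : Measurable g) (hb : ∀ t, |g t| ≤ 1)
    {s : ℝ} (hs : 0 ≤ s) :
    MeasureTheory.IntegrableOn (fun t => Gk L K s t * g t) (Ioi 0) := by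
  have hG : Measurable (fun t => Gk L K s t) := Gk_meas.comp (measurable_const.prodMk measurable_id)
  have h0 : MeasureTheory.IntegrableOn (fun t => exp (K * s) / (L + K) * exp (-K * t)) (Ioi 0) :=
    (integrableOn_exp_mul_Ioi (show -K < 0 by linarith) 0).const_mul _
  have h1 : MeasureTheory.IntegrableOn (fun t => Gk L K s t) (Ioi 0) := by
    refine MeasureTheory.Integrable.mono' h0 hG.aestronglyMeasurable ?_
    filter_upwards [MeasureTheory.ae_restrict_mem measurableSet_Ioi] with t ht
    rw [Real.norm_eq_abs, abs_of_nonneg (Gk_nonneg hL hK hs (le_of_lt ht))]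
    exact Gk_le hL hK
  refine MeasureTheory.Integrable.mul_bdd (c := 1) h1 hg.aestronglyMeasurable ?_
  filter_upwards with t
  exact hb t

lemma loc_int {g : ℝ → ℝ} (hg : Measurable g) (hb : ∀ t, |g t| ≤ 1) (m a b : ℝ) :
    IntervalIntegrable (fun t => exp (m * t) * g t) MeasureTheory.volume a b := by
  have h0 : IntervalIntegrable (fun t => exp (m * t)) MeasureTheory.volume a b :=
    (by fun_prop : Continuous fun t : ℝ => exp (m * t)).intervalIntegrable _ _
  rw [intervalIntegrable_iff] at h0 ⊢
  refine MeasureTheory.Integrable.mul_bdd (c := 1) h0 hg.aestronglyMeasurable ?_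
  filter_upwards with t
  exact hb t

lemma Gk_split (hL : 0 < L) (hK : 0 < K) {g : ℝ → ℝ} (hg : Measurable g) (hb : ∀ t, |g t| ≤ 1)
    {s : ℝ} (hs : 0 ≤ s) :
    ∫ t in Ioi 0, Gk L K s t * g t =
      (exp (-L * s) * (∫ t in (0:ℝ)..s, exp (L * t) * g t) +
        exp (K * s) * ((∫ t in Ioi 0, exp (-K * t) * g t) - ∫ t in (0:ℝ)..s, exp (-K * t) * g t)
        - exp (-L * s) * ∫ t in Ioi 0, exp (-K * t) * g t) / (L + K) := by
  have hE : MeasureTheory.IntegrableOn (fun t => exp (-K * t) * g t) (Ioi 0) := by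
    simpa using expg_int hK hg hb 1
  have hGi := Gk_int hL hK hg hb hs
  have hsub : Ioi s ⊆ Ioi (0:ℝ) := Ioi_subset_Ioi hs
  rw [← intervalIntegral.integral_interval_add_Ioi hGi (hGi.mono_set hsub)]
  have e1 : ∫ t in (0:ℝ)..s, Gk L K s t * g t =
      (exp (-L * s) * (∫ t in (0:ℝ)..s, exp (L * t) * g t)
        - exp (-L * s) * ∫ t in (0:ℝ)..s, exp (-K * t) * g t) / (L + K) := by
    rw [← intervalIntegral.integral_const_mul, ← intervalIntegral.integral_const_mul,
      ← intervalIntegral.integral_sub, ← intervalIntegral.integral_div]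
    · apply intervalIntegral.integral_congr
      intro t ht
      rw [uIcc_of_le hs] at ht
      simp only [Gk, if_pos ht.2]
      ring
    · exact (loc_int hg hb _ _ _).const_mul _
    · exact (loc_int hg hb _ _ _).const_mul _
  have e2 : ∫ t in Ioi s, Gk L K s t * g t =
      ((exp (K * s) - exp (-L * s)) * ∫ t in Ioi s, exp (-K * t) * g t) / (L + K) := by
    rw [← MeasureTheory.integral_const_mul, ← MeasureTheory.integral_div]
    apply MeasureTheory.setIntegral_congr_fun measurableSet_Ioi
    intro t ht
    simp only [Gk, if_neg (not_le.2 (mem_Ioi.1 ht))]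
    ring
  rw [e1, e2, ← intervalIntegral.integral_interval_add_Ioi hE (hE.mono_set hsub)]
  ring

lemma Gk_exp (hL : 0 < L) (hK : 0 < K) {m : ℝ} (hm : 0 < m) (hmL : m < L) {s : ℝ} (hs : 0 ≤ s) :
    ∫ t in Ioi 0, Gk L K s t * exp (-m * max t 0) =
      (exp (-m * s) - exp (-L * s)) / ((L - m) * (K + m)) := by
  have hb : ∀ t : ℝ, |exp (-m * max t 0)| ≤ 1 := by
    intro t
    rw [abs_of_pos (exp_pos _)]
    apply exp_le_one_iff.2
    have := le_max_right t 0
    nlinarith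
  rw [Gk_split hL hK (g := fun t => exp (-m * max t 0)) (by fun_prop) hb hs]
  have i1 : ∀ n : ℝ, n - m ≠ 0 → ∫ t in (0:ℝ)..s, exp (n * t) * exp (-m * max t 0) =
      (exp (n * s) * exp (-m * s) - 1) / (n - m) := by
    intro n hn
    have : ∫ t in (0:ℝ)..s, exp (n * t) * exp (-m * max t 0) =
        ∫ t in (0:ℝ)..s, exp ((n - m) * t) := by
      apply intervalIntegral.integral_congr
      intro t ht
      rw [uIcc_of_le hs] at ht
      simp only [max_eq_left ht.1, ← Real.exp_add]
      ring_nf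
    rw [this, intervalIntegral.integral_eq_sub_of_hasDerivAt
      (f := fun t => exp ((n - m) * t) / (n - m))]
    · rw [← Real.exp_add]
      simp
      ring_nf
    · intro x hx
      refine ((hexp (n - m) x).div_const (n - m)).congr_deriv ?_
      field_simp
    · exact (by fun_prop : Continuous fun t : ℝ => exp ((n - m) * t)).intervalIntegrable _ _
  have i2 : ∫ t in Ioi 0, exp (-K * t) * exp (-m * max t 0) = 1 / (K + m) := by
    have : ∫ t in Ioi 0, exp (-K * t) * exp (-m * max t 0) = ∫ t in Ioi 0, exp (-(K + m) * t) := by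
      apply MeasureTheory.setIntegral_congr_fun measurableSet_Ioi
      intro t ht
      simp only [max_eq_left (le_of_lt (mem_Ioi.1 ht)), ← Real.exp_add]
      ring_nf
    rw [this, integral_exp_mul_Ioi (by linarith)]
    simp
    rw [← neg_add, ← one_div, div_neg, neg_div]
    simp [add_comm]
  rw [i1 L (by linarith), i1 (-K) (by linarith), i2]
  have h1 : exp (-L * s) = (exp (L * s))⁻¹ := by rw [← Real.exp_neg]; ring_nf
  have h2 : exp (-K * s) = (exp (K * s))⁻¹ := by rw [← Real.exp_neg]; ring_nf
  rw [h1, h2]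
  have := exp_pos (L * s)
  have := exp_pos (K * s)
  have a1 : L - m ≠ 0 := by linarith
  have a2 : K + m ≠ 0 := by linarith
  have a3 : L + K ≠ 0 := by linarith
  have a4 : -K - m = -(K + m) := by ring
  rw [a4]
  field_simp
  ring

/-- Monotone iteration. -/
noncomputable def uit (L K A : ℝ) : ℕ → ℝ → ℝ
  | 0, _ => 0
  | n + 1, s => A * exp (-L * max s 0) + L * K * ∫ t in Ioi 0, Gk L K (max s 0) t * uit L K A n t ^ 2

lemma uit_meas (A : ℝ) (n : ℕ) : Measurable (uit L K A n) := by
  induction n with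
  | zero => exact measurable_const
  | succ n ih =>
    have h : MeasureTheory.StronglyMeasurable (fun s => ∫ t in Ioi 0, Gk L K (max s 0) t * uit L K A n t ^ 2) := by
      refine MeasureTheory.StronglyMeasurable.integral_prod_right
        (f := fun s t => Gk L K (max s 0) t * uit L K A n t ^ 2) ?_
      apply Measurable.stronglyMeasurable
      have : Measurable (fun p : ℝ × ℝ => Gk L K (max p.1 0) p.2) :=
        Gk_meas.comp (f := fun p : ℝ × ℝ => (max p.1 0, p.2)) (by fun_prop)
      exact this.mul ((ih.comp measurable_snd).pow_const 2)
    show Measurable (fun s => A * exp (-L * max s 0) + L * K * ∫ t in Ioi 0, Gk L K (max s 0) t * uit L K A n t ^ 2)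
    exact Measurable.add (by fun_prop) (h.measurable.const_mul _)

lemma supsol_le {A m : ℝ} (hA : 0 < A) (hm : 0 < m) (t : ℝ) : A * exp (-m * max t 0) ≤ A := by
  have : exp (-m * max t 0) ≤ 1 := by
    apply exp_le_one_iff.2
    have := le_max_right t 0
    nlinarith
  nlinarith

lemma sq_bd {A x : ℝ} (hA1 : A < 1) (h0 : 0 ≤ x) (h1 : x ≤ A) : |x ^ 2| ≤ 1 := by
  rw [abs_of_nonneg (by positivity)]
  nlinarith

lemma step_mono {A : ℝ} (hL : 0 < L) (hK : 0 < K) {f g : ℝ → ℝ} (hf : Measurable f)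
    (hg : Measurable g) (hA1 : A < 1) (h0 : ∀ t, 0 ≤ f t) (hfg : ∀ t, f t ≤ g t)
    (hgA : ∀ t, g t ≤ A) {s : ℝ} (hs : 0 ≤ s) :
    ∫ t in Ioi 0, Gk L K s t * f t ^ 2 ≤ ∫ t in Ioi 0, Gk L K s t * g t ^ 2 := by
  refine MeasureTheory.setIntegral_mono_on
    (Gk_int hL hK (hf.pow_const 2) (fun t => sq_bd hA1 (h0 t) ((hfg t).trans (hgA t))) hs)
    (Gk_int hL hK (hg.pow_const 2) (fun t => sq_bd hA1 ((h0 t).trans (hfg t)) (hgA t)) hs)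
    measurableSet_Ioi ?_
  intro t ht
  apply mul_le_mul_of_nonneg_left _ (Gk_nonneg hL hK hs (le_of_lt ht))
  exact pow_le_pow_left₀ (h0 t) (hfg t) 2

lemma uit_bd {A m : ℝ} (hL : 0 < L) (hK : 0 < K) (hA : 0 < A) (hA1 : A < 1) (hm : 0 < m)
    (hmL : m < L) (hme : (L - m) * (K + m) = L * K * A) (n : ℕ) :
    ∀ s, 0 ≤ uit L K A n s ∧ uit L K A n s ≤ A * exp (-m * max s 0) := by
  induction n with
  | zero => intro s; exact ⟨le_rfl, by simp only [uit]; positivity⟩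
  | succ n ih =>
    intro s
    have hs : 0 ≤ max s 0 := le_max_right _ _
    have hLK : 0 < L * K := mul_pos hL hK
    constructor
    · simp only [uit]
      have : 0 ≤ ∫ t in Ioi 0, Gk L K (max s 0) t * uit L K A n t ^ 2 := by
        apply MeasureTheory.setIntegral_nonneg measurableSet_Ioi
        intro t ht
        exact mul_nonneg (Gk_nonneg hL hK hs (le_of_lt ht)) (sq_nonneg _)
      positivity
    · simp only [uit]
      have h1 : ∫ t in Ioi 0, Gk L K (max s 0) t * uit L K A n t ^ 2 ≤
          ∫ t in Ioi 0, A ^ 2 * (Gk L K (max s 0) t * exp (-m * max t 0)) := by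
        refine MeasureTheory.setIntegral_mono_on
          (Gk_int hL hK ((uit_meas A n).pow_const 2)
            (fun t => sq_bd hA1 (ih t).1 ((ih t).2.trans (supsol_le hA hm t))) hs) ?_
          measurableSet_Ioi ?_
        · apply MeasureTheory.Integrable.const_mul
          refine Gk_int hL hK (g := fun t => exp (-m * max t 0)) (by fun_prop) ?_ hs
          intro t
          rw [abs_of_pos (exp_pos _)]
          have := supsol_le one_pos hm t
          linarith
        · intro t ht
          have h2 := Gk_nonneg hL hK hs (le_of_lt ht)
          have h3 : uit L K A n t ^ 2 ≤ A ^ 2 * exp (-m * max t 0) := by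
            have := (ih t).1
            have := (ih t).2
            have := supsol_le hA hm t
            calc uit L K A n t ^ 2 ≤ A * (A * exp (-m * max t 0)) := by nlinarith
              _ = _ := by ring
          calc _ ≤ Gk L K (max s 0) t * (A ^ 2 * exp (-m * max t 0)) :=
                mul_le_mul_of_nonneg_left h3 h2
            _ = _ := by ring
      rw [MeasureTheory.integral_const_mul, Gk_exp hL hK hm hmL hs, hme] at h1
      have h2 := mul_le_mul_of_nonneg_left h1 hLK.le
      have h3 : L * K * (A ^ 2 * ((exp (-m * max s 0) - exp (-L * max s 0)) / (L * K * A))) =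
          A * exp (-m * max s 0) - A * exp (-L * max s 0) := by
        field_simp
      linarith

lemma uit_mono {A m : ℝ} (hL : 0 < L) (hK : 0 < K) (hA : 0 < A) (hA1 : A < 1) (hm : 0 < m)
    (hmL : m < L) (hme : (L - m) * (K + m) = L * K * A) (n : ℕ) :
    ∀ s, uit L K A n s ≤ uit L K A (n + 1) s := by
  induction n with
  | zero => intro s; exact (uit_bd hL hK hA hA1 hm hmL hme 1 s).1
  | succ n ih =>
    intro s
    have h := step_mono hL hK (uit_meas (L := L) (K := K) A n) (uit_meas A (n + 1)) hA1
      (fun t => (uit_bd hL hK hA hA1 hm hmL hme n t).1) ih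
      (fun t => (uit_bd hL hK hA hA1 hm hmL hme (n + 1) t).2.trans (supsol_le hA hm t))
      (le_max_right s 0)
    rw [uit, uit]
    have hLK : 0 < L * K := mul_pos hL hK
    have := mul_le_mul_of_nonneg_left h hLK.le
    linarith

lemma exists_fix {A m : ℝ} (hL : 0 < L) (hK : 0 < K) (hA : 0 < A) (hA1 : A < 1) (hm : 0 < m)
    (hmL : m < L) (hme : (L - m) * (K + m) = L * K * A) :
    ∃ v : ℝ → ℝ, Measurable v ∧ (∀ s, 0 ≤ v s ∧ v s ≤ A * exp (-m * max s 0)) ∧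
      ∀ s, v s = A * exp (-L * max s 0) + L * K * ∫ t in Ioi 0, Gk L K (max s 0) t * v t ^ 2 := by
  have hbd := fun n => uit_bd hL hK hA hA1 hm hmL hme n
  have hlim : ∀ s, Tendsto (fun n => uit L K A n s) atTop (nhds (⨆ n, uit L K A n s)) := by
    intro s
    apply tendsto_atTop_ciSup
    · exact monotone_nat_of_le_succ (fun n => uit_mono hL hK hA hA1 hm hmL hme n s)
    · exact ⟨_, by rintro _ ⟨n, rfl⟩; exact (hbd n s).2⟩
  have hvm : Measurable (fun s => ⨆ n, uit L K A n s) :=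
    measurable_of_tendsto_metrizable (fun n => uit_meas A n) (tendsto_pi_nhds.2 hlim)
  refine ⟨fun s => ⨆ n, uit L K A n s, hvm, ?_, ?_⟩
  · intro s
    exact ⟨ge_of_tendsto' (hlim s) (fun n => (hbd n s).1),
      le_of_tendsto' (hlim s) (fun n => (hbd n s).2)⟩
  · intro s
    have hs : 0 ≤ max s 0 := le_max_right _ _
    have h1 := (hlim s).comp (tendsto_add_atTop_nat 1)
    refine tendsto_nhds_unique h1 ?_
    show Tendsto (fun n => A * exp (-L * max s 0) + L * K * ∫ t in Ioi 0, Gk L K (max s 0) t * uit L K A n t ^ 2) atTop _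
    refine Tendsto.const_add _ (Tendsto.const_mul _ ?_)
    refine MeasureTheory.tendsto_integral_of_dominated_convergence
      (fun t => exp (K * max s 0) / (L + K) * exp (-K * t)) ?_ ?_ ?_ ?_
    · intro n
      exact (Gk_int hL hK ((uit_meas A n).pow_const 2)
            (fun t => sq_bd hA1 (hbd n t).1 ((hbd n t).2.trans (supsol_le hA hm t))) hs).1
    · exact (integrableOn_exp_mul_Ioi (show -K < 0 by linarith) 0).const_mul _
    · intro n
      filter_upwards [MeasureTheory.ae_restrict_mem measurableSet_Ioi] with t ht
      have h2 := Gk_nonneg hL hK hs (le_of_lt ht)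
      have h3 := sq_bd hA1 (hbd n t).1 ((hbd n t).2.trans (supsol_le hA hm t))
      rw [norm_mul, Real.norm_eq_abs, Real.norm_eq_abs, abs_of_nonneg h2]
      exact (mul_le_of_le_one_right h2 h3).trans (Gk_le hL hK)
    · filter_upwards with t
      exact ((hlim t).pow 2).const_mul _

lemma exists_sol {A : ℝ} (hL : 0 < L) (hK : 0 < K) (hA : 0 < A) (hA1 : A < 1) :
    ∃ W W1 W2 : ℝ → ℝ, (∀ s, HasDerivAt W (W1 s) s) ∧ (∀ s, HasDerivAt W1 (W2 s) s) ∧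
      Continuous W2 ∧ W 0 = A ∧
      (∀ s > 0, W2 s = L * K * W s * (1 - W s) - (L - K) * W1 s) ∧
      (∀ s > 0, W s < A) ∧ Tendsto W atTop (nhds 0) := by
  obtain ⟨m, ⟨hm, hmL⟩, hme⟩ : ∃ m ∈ Ioo 0 L, (L - m) * (K + m) = L * K * A := by
    have hc : ContinuousOn (fun m => (L - m) * (K + m)) (Icc 0 L) := by fun_prop
    have := intermediate_value_Ioo' hL.le hc
    apply this
    have hLK : 0 < L * K := mul_pos hL hK
    constructor
    · simp; positivity
    · nlinarith
  obtain ⟨v, hvm, hvb, hv⟩ := exists_fix hL hK hA hA1 hm hmL hme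
  set g : ℝ → ℝ := fun t => v t ^ 2 with hg
  have hgm : Measurable g := hvm.pow_const 2
  have hgb : ∀ t, |g t| ≤ 1 := fun t => sq_bd hA1 (hvb t).1 ((hvb t).2.trans (supsol_le hA hm t))
  set Qi := ∫ t in Ioi 0, exp (-K * t) * g t with hQi
  set P : ℝ → ℝ := fun s => ∫ t in (0:ℝ)..s, exp (L * t) * g t with hP
  set Q : ℝ → ℝ := fun s => ∫ t in (0:ℝ)..s, exp (-K * t) * g t with hQ
  have cP : Continuous P := intervalIntegral.continuous_primitive (fun a b => loc_int hgm hgb _ a b) 0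
  have cQ : Continuous Q := intervalIntegral.continuous_primitive (fun a b => loc_int hgm hgb _ a b) 0
  set W : ℝ → ℝ := fun s => A * exp (-L * s) + L * K * ((exp (-L * s) * P s +
        exp (K * s) * (Qi - Q s) - exp (-L * s) * Qi) / (L + K)) with hW
  have cW : Continuous W := by fun_prop
  have hvW : ∀ s, v s = W (max s 0) := by
    intro s
    rw [hv s, Gk_split hL hK hgm hgb (le_max_right s 0)]
  have cg : Continuous g := by
    have : g = fun s => W (max s 0) ^ 2 := by
      funext s; simp only [hg, hvW s]
    rw [this]
    fun_prop
  have dP : ∀ s, HasDerivAt P (exp (L * s) * g s) s := by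
    intro s
    have : Continuous fun t => exp (L * t) * g t := by fun_prop
    exact intervalIntegral.integral_hasDerivAt_right (this.intervalIntegrable _ _)
      (this.stronglyMeasurableAtFilter _ _) this.continuousAt
  have dQ : ∀ s, HasDerivAt Q (exp (-K * s) * g s) s := by
    intro s
    have : Continuous fun t => exp (-K * t) * g t := by fun_prop
    exact intervalIntegral.integral_hasDerivAt_right (this.intervalIntegrable _ _)
      (this.stronglyMeasurableAtFilter _ _) this.continuousAt
  have h1 : ∀ s, exp (-L * s) * exp (L * s) = 1 := by
    intro s; rw [← Real.exp_add]; simp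
  have h2 : ∀ s, exp (K * s) * exp (-K * s) = 1 := by
    intro s; rw [← Real.exp_add]; simp
  have hne : L + K ≠ 0 := by linarith
  set W1 : ℝ → ℝ := fun s => -L * A * exp (-L * s) + L * K * ((-L * exp (-L * s) * P s +
        K * exp (K * s) * (Qi - Q s) + L * exp (-L * s) * Qi) / (L + K)) with hW1
  have cW1 : Continuous W1 := by fun_prop
  have dW : ∀ s, HasDerivAt W (W1 s) s := by
    intro s
    refine (((hexp (-L) s).const_mul A).add ((((((hexp (-L) s).mul (dP s)).add
      ((hexp K s).mul ((dQ s).const_sub Qi))).sub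
      ((hexp (-L) s).mul_const Qi)).div_const (L + K)).const_mul (L * K))).congr_deriv ?_
    simp only [hW1]
    linear_combination (L * K / (L + K)) * g s * (h1 s) - (L * K / (L + K)) * g s * (h2 s)
  have dW1 : ∀ s, HasDerivAt W1 (L * K * W s - L * K * g s - (L - K) * W1 s) s := by
    intro s
    refine (((hexp (-L) s).const_mul (-L * A)).add (((((((hexp (-L) s).const_mul (-L)).mul (dP s)).add
      (((hexp K s).const_mul K).mul ((dQ s).const_sub Qi))).add
      (((hexp (-L) s).const_mul L).mul_const Qi)).div_const (L + K)).const_mul (L * K))).congr_deriv ?_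
    simp only [hW1, hW]
    have e : L * K * g s = (L * K / (L + K)) * (L + K) * g s := by field_simp
    rw [e]
    linear_combination (L * K / (L + K)) * g s * (-L) * (h1 s) - (L * K / (L + K)) * g s * K * (h2 s)
  have hWs : ∀ s, 0 ≤ s → W s = v s := by
    intro s hs; rw [hvW s, max_eq_left hs]
  refine ⟨W, W1, _, dW, dW1, by fun_prop, ?_, ?_, ?_, ?_⟩
  · simp [hW, hP, hQ]
  · intro s hs
    simp only [hg, ← hWs s (le_of_lt hs)]
    ring
  · intro s hs
    rw [hWs s (le_of_lt hs)]
    refine lt_of_le_of_lt (hvb s).2 ?_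
    have : exp (-m * max s 0) < 1 := by
      rw [exp_lt_one_iff, max_eq_left (le_of_lt hs)]
      have : 0 < s := hs
      nlinarith
    nlinarith
  · have hz : Tendsto (fun s => A * exp (-m * s)) atTop (nhds 0) := by
      simpa using (exp_neg_lim hm).const_mul A
    refine tendsto_of_tendsto_of_tendsto_of_le_of_le' tendsto_const_nhds hz ?_ ?_
    · filter_upwards [eventually_ge_atTop 0] with s hs
      rw [hWs s hs]; exact (hvb s).1
    · filter_upwards [eventually_ge_atTop 0] with s hs
      rw [hWs s hs]
      have := (hvb s).2
      rwa [max_eq_left hs] at this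

end
lemma IsOmegaSolution.toSol {d r c A L K : ℝ} {ω : ℝ → ℝ} (hd : 0 < d) (hLK : L * K = r / d)
    (hsub : L - K = c / d) (h : IsOmegaSolution d r c A ω) :
    Sol L K A (fun s => A - ω s) (fun s => - deriv ω s) := by
  have hcd : ∀ s > (0:ℝ), ContDiffAt ℝ 2 ω s := fun s hs =>
    h.smooth.contDiffAt (Ici_mem_nhds hs)
  refine ⟨?_, ?_, ?_, ?_, ?_, ?_⟩
  · exact continuousOn_const.sub h.smooth.continuousOn
  · simp [h.init]
  · intro s hs
    exact ((hcd s hs).differentiableAt (by norm_num)).hasDerivAt.const_sub A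
  · intro s hs
    have h0 : ContDiffOn ℝ (1 + 1) ω (Ioi 0) := by
      have := h.smooth.mono (Ioi_subset_Ici_self)
      rwa [show (2 : WithTop ℕ∞) = 1 + 1 by norm_num] at this
    have h1 := ((contDiffOn_succ_iff_deriv_of_isOpen isOpen_Ioi).1 h0).2.2
    have h2 := ((h1.contDiffAt (Ioi_mem_nhds hs)).differentiableAt (by norm_num)).hasDerivAt.neg
    refine h2.congr_deriv ?_
    have := h.ode s hs
    rw [hLK, hsub]
    field_simp
    linarith
  · intro s hs
    have := h.pos s hs
    linarith
  · simpa using h.lim.const_sub A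

theorem stmt2 (d r c h k : ℝ) (hd : 0 < d) (hr : 0 < r) (hc : 0 ≤ c)
    (hh : h ∈ Set.Ioo (0:ℝ) 1) (hk : k ∈ Set.Ioo (0:ℝ) 1) :
    (∃ ω : ℝ → ℝ, IsOmegaSolution d r c (h * ((1 - k) / (1 - h * k))) ω) ∧
    (∀ ω₁ ω₂ : ℝ → ℝ,
      IsOmegaSolution d r c (h * ((1 - k) / (1 - h * k))) ω₁ →
      IsOmegaSolution d r c (h * ((1 - k) / (1 - h * k))) ω₂ →
      Set.EqOn ω₁ ω₂ (Set.Ici 0)) ∧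
    (∀ ω : ℝ → ℝ, IsOmegaSolution d r c (h * ((1 - k) / (1 - h * k))) ω →
      StrictMonoOn ω (Set.Ioi 0) ∧
      ∃ bω > (0:ℝ), Filter.Tendsto
        (fun s => (h * ((1 - k) / (1 - h * k)) - ω s) *
          Real.exp (((c + Real.sqrt (c ^ 2 + 4 * d * r)) / (2 * d)) * s))
        Filter.atTop (nhds bω)) := by
  obtain ⟨hh0, hh1⟩ := hh
  obtain ⟨hk0, hk1⟩ := hk
  have hhk : 0 < 1 - h * k := by nlinarith
  have hA : 0 < h * ((1 - k) / (1 - h * k)) :=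
    mul_pos hh0 (div_pos (by linarith) hhk)
  have hA1 : h * ((1 - k) / (1 - h * k)) < 1 := by
    rw [← mul_div_assoc, div_lt_one hhk]
    nlinarith
  generalize h * ((1 - k) / (1 - h * k)) = A at hA hA1 ⊢
  set q := Real.sqrt (c ^ 2 + 4 * d * r) with hq
  have hq2 : q ^ 2 = c ^ 2 + 4 * d * r := Real.sq_sqrt (by positivity)
  have hqc : c < q := by
    apply Real.lt_sqrt_of_sq_lt
    have : 0 < d * r := mul_pos hd hr
    linarith
  set L := (c + q) / (2 * d) with hLdef
  set K := (q - c) / (2 * d) with hKdef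
  have hL : 0 < L := div_pos (by linarith) (by linarith)
  have hK : 0 < K := div_pos (by linarith) (by linarith)
  have hsub : L - K = c / d := by
    rw [hLdef, hKdef]; field_simp; ring
  have hLK : L * K = r / d := by
    rw [hLdef, hKdef]; field_simp; linarith
  have hle : K ≤ L := by
    have : 0 ≤ c / d := by positivity
    linarith
  refine ⟨?_, ?_, ?_⟩
  · obtain ⟨W, W1, W2, d1, d2, c2, w0, hode, hlt, hlim⟩ := exists_sol hL hK hA hA1
    have e1 : deriv (fun s => A - W s) = fun s => -W1 s :=
      funext fun s => ((d1 s).const_sub A).deriv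
    have e2 : deriv (fun s => -W1 s) = fun s => -W2 s :=
      funext fun s => (d2 s).neg.deriv
    refine ⟨fun s => A - W s, ?_, ?_, ?_, ?_, ?_⟩
    · apply ContDiff.contDiffOn
      rw [show (2 : WithTop ℕ∞) = 1 + 1 by norm_num, contDiff_succ_iff_deriv]
      refine ⟨fun s => ((d1 s).const_sub A).differentiableAt, by simp, ?_⟩
      rw [e1, contDiff_one_iff_deriv, e2]
      exact ⟨fun s => (d2 s).neg.differentiableAt, c2.neg⟩
    · simp [w0]
    · intro s hs
      rw [e1, e2]
      simp only
      rw [hode s hs, hsub, hLK]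
      field_simp
      ring
    · intro s hs
      have := hlt s hs
      linarith
    · simpa using hlim.const_sub A
  · intro ω₁ ω₂ h1 h2 s hs
    have := (h1.toSol hd hLK hsub).unique hL hK hA hA1 hle (h2.toSol hd hLK hsub) hs
    linarith
  · intro ω hω
    have S := hω.toSol hd hLK hsub
    refine ⟨?_, S.asymp hL hK hA hA1 hle⟩
    have hd1 : ∀ s > (0:ℝ), HasDerivAt ω (deriv ω s) s := fun s hs =>
      ((hω.smooth.contDiffAt (Ici_mem_nhds hs)).differentiableAt (by norm_num)).hasDerivAt
    refine smono_help (convex_Ioi 0) (fun s hs => (hd1 s hs).continuousAt.continuousWithinAt)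
      (f' := deriv ω) ?_ ?_
    · intro x hx; rw [interior_Ioi] at hx; exact hd1 x hx
    · intro x hx; rw [interior_Ioi] at hx
      have := S.wneg hL hK hA hA1 x hx
      linarith
end

section
/- Fix constants d, r > 0 and h, k ∈ (0,1), and set u* = (1-k)/(1-hk). Let χ̂ be the unique bounded positive solution of χ̂'' + χ̂(u* - χ̂) = 0 on (0,∞) with χ̂(0) = 0, which is strictly increasing with χ̂(∞) = u*, and let ω be the unique positive solution of dω'' + r(hu* - ω)(1 - hu* + ω) = 0 on (0,∞) with ω(0) = 0 and ω(∞) = hu*. Define φ̄(s) = 0 for s < 0 and φ̄(s) = χ̂(s) for s ≥ 0, and ψ̄(s) = hu* - ω(-s) for s < 0 and ψ̄(s) = hu* for s ≥ 0. Then for every c ≥ 0: (a) φ̄''(s) - cφ̄'(s) + φ̄(s)(1 - k - φ̄(s) + kψ̄(s)) ≤ 0 for all s > 0; (b) dψ̄''(s) - cψ̄'(s) + r(1 - ψ̄(s))(hφ̄(s) - ψ̄(s)) ≤ 0 for all s ≠ 0; (c) the left derivative of ψ̄ at 0 is ≥ the right derivative of ψ̄ at 0; and φ̄(s) = 0 for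 s ≤ 0, ψ̄(s) → 0 as s → -∞, φ̄(s) → u* and ψ̄(s) → hu* as s → ∞. -/
open Real Filter Set

noncomputable def uStar (h k : ℝ) : ℝ := (1 - k) / (1 - h * k)

/-- The profile `ω` stays below its limit `a`. -/
lemma omega_le (a : ℝ) (ω : ℝ → ℝ) (ha : 0 < a)
    (hcont : ContinuousOn ω (Set.Ici 0)) (h0 : ω 0 = 0)
    (hpos : ∀ s > (0:ℝ), a < ω s → 0 < deriv (deriv ω) s)
    (hlim : Filter.Tendsto ω Filter.atTop (nhds a)) :
    ∀ s ≥ (0:ℝ), ω s ≤ a := by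
  intro s0 hs0
  by_contra! hgt
  obtain ⟨N, hN⟩ := Filter.eventually_atTop.1 (hlim.eventually_lt_const hgt)
  have hsub : Set.Icc (0:ℝ) (max N s0) ⊆ Set.Ici 0 := fun x hx => hx.1
  obtain ⟨m, hm, hmax⟩ := (isCompact_Icc (a := (0:ℝ)) (b := max N s0)).exists_isMaxOn
    ⟨s0, hs0, le_max_right _ _⟩ (hcont.mono hsub)
  have hms0 : ω s0 ≤ ω m := hmax ⟨hs0, le_max_right _ _⟩
  have hglob : ∀ x ≥ (0:ℝ), ω x ≤ ω m := by
    intro x hx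
    rcases le_total x (max N s0) with h | h
    · exact hmax ⟨hx, h⟩
    · exact (hN x ((le_max_left _ _).trans h)).le.trans hms0
  have hm0 : 0 < m := by
    rcases hm.1.lt_or_eq with h | h
    · exact h
    · rw [← h, h0] at hms0
      linarith
  have hnhds : ∀ᶠ x in nhds m, 0 < x := lt_mem_nhds hm0
  have hlmax : IsLocalMax ω m := hnhds.mono fun x hx => hglob x hx.le
  have hd2 := hpos m hm0 (hgt.trans_le hms0)
  have hlmin : IsLocalMin ω m := isLocalMin_of_deriv_deriv_pos hd2 hlmax.deriv_eq_zero
    (hcont.continuousAt (Ici_mem_nhds hm0))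
  have hconst : ω =ᶠ[nhds m] fun _ => ω m := by
    filter_upwards [hlmax, hlmin] with x h1 h2 using le_antisymm h1 h2
  have := hconst.deriv.deriv_eq
  simp at this
  linarith

/-- A nonnegative concave function on `[0,∞)` is nondecreasing. -/
lemma concave_mono (ω : ℝ → ℝ) (hc : ConcaveOn ℝ (Set.Ici 0) ω)
    (hn : ∀ s ≥ (0:ℝ), 0 ≤ ω s) : MonotoneOn ω (Set.Ici 0) := by
  intro x hx y hy hxy
  rcases hxy.lt_or_eq with hlt | rfl
  swap
  · exact le_rfl
  by_contra! hgt
  have hx0 : (0:ℝ) ≤ x := hx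
  have hy0 : (0:ℝ) ≤ y := hy
  set δ := (ω x - ω y) / (y - x) with hδ
  have hδpos : 0 < δ := div_pos (by linarith) (by linarith)
  set t := (ω y + 1) / δ with ht
  have hyn := hn y hy0
  have htpos : 0 < t := div_pos (by linarith) hδpos
  have h1 := hc.slope_anti_adjacent hx (z := y + t) (show (0:ℝ) ≤ y + t by linarith) hlt
    (by linarith)
  have h2 : (ω y - ω x) / (y - x) = -δ := by rw [hδ, ← neg_div]; congr 1; ring
  rw [h2, div_le_iff₀ (by linarith)] at h1
  have h3 : δ * t = ω y + 1 := by rw [ht]; field_simp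
  have h4 := hn (y + t) (by linarith)
  nlinarith

theorem stmt3 (d r h k : ℝ) (hd : 0 < d) (hr : 0 < r)
    (hh : h ∈ Set.Ioo (0:ℝ) 1) (hk : k ∈ Set.Ioo (0:ℝ) 1)
    (χhat ω : ℝ → ℝ)
    -- χhat is the unique bounded positive solution of χ'' + χ(u* - χ) = 0, χ(0) = 0,
    -- strictly increasing with χhat(∞) = u*
    (hχ_smooth : ContDiffOn ℝ 2 χhat (Set.Ici 0))
    (hχ_init : χhat 0 = 0)
    (hχ_ode : ∀ s > (0:ℝ),
      deriv (deriv χhat) s + χhat s * (uStar h k - χhat s) = 0)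
    (hχ_pos : ∀ s > (0:ℝ), 0 < χhat s)
    (hχ_bdd : ∃ M : ℝ, ∀ s ≥ (0:ℝ), |χhat s| ≤ M)
    (hχ_mono : StrictMonoOn χhat (Set.Ici 0))
    (hχ_lim : Filter.Tendsto χhat Filter.atTop (nhds (uStar h k)))
    -- ω is the unique positive solution of d ω'' + r (hu* - ω)(1 - hu* + ω) = 0,
    -- ω(0) = 0, ω(∞) = hu*
    (hω_smooth : ContDiffOn ℝ 2 ω (Set.Ici 0))
    (hω_init : ω 0 = 0)
    (hω_ode : ∀ s > (0:ℝ),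
      d * deriv (deriv ω) s +
        r * (h * uStar h k - ω s) * (1 - h * uStar h k + ω s) = 0)
    (hω_pos : ∀ s > (0:ℝ), 0 < ω s)
    (hω_lim : Filter.Tendsto ω Filter.atTop (nhds (h * uStar h k)))
    -- the piecewise defined pair (φbar, ψbar)
    (φbar ψbar : ℝ → ℝ)
    (hφbar : ∀ s : ℝ, φbar s = if s < 0 then 0 else χhat s)
    (hψbar : ∀ s : ℝ, ψbar s = if s < 0 then h * uStar h k - ω (-s) else h * uStar h k)
    (c : ℝ) (hc : 0 ≤ c) :
    (∀ s > (0:ℝ),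
      deriv (deriv φbar) s - c * deriv φbar s +
        φbar s * (1 - k - φbar s + k * ψbar s) ≤ 0) ∧
    (∀ s : ℝ, s ≠ 0 →
      d * deriv (deriv ψbar) s - c * deriv ψbar s +
        r * (1 - ψbar s) * (h * φbar s - ψbar s) ≤ 0) ∧
    derivWithin ψbar (Set.Ioi 0) 0 ≤ derivWithin ψbar (Set.Iio 0) 0 ∧
    (∀ s ≤ (0:ℝ), φbar s = 0) ∧
    Filter.Tendsto ψbar Filter.atBot (nhds 0) ∧
    Filter.Tendsto φbar Filter.atTop (nhds (uStar h k)) ∧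
    Filter.Tendsto ψbar Filter.atTop (nhds (h * uStar h k)) := by
  obtain ⟨hh0, hh1⟩ := hh
  obtain ⟨hk0, hk1⟩ := hk
  have hhk : 0 < 1 - h * k := by nlinarith
  have hu0 : 0 < uStar h k := div_pos (by linarith) hhk
  have hu1 : uStar h k < 1 := by
    unfold uStar
    rw [div_lt_one hhk]
    nlinarith
  have hueq : uStar h k * (1 - h * k) = 1 - k := by
    unfold uStar
    exact div_mul_cancel₀ _ hhk.ne'
  generalize uStar h k = u at *
  have ha0 : 0 < h * u := mul_pos hh0 hu0
  have ha1 : h * u < 1 := by nlinarith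
  have hχle : ∀ s ≥ (0:ℝ), χhat s ≤ u := by
    intro s hs
    refine ge_of_tendsto hχ_lim ?_
    filter_upwards [Filter.eventually_ge_atTop s] with x hx
    exact hχ_mono.monotoneOn hs (hs.le.trans hx) hx
  have hωle : ∀ s ≥ (0:ℝ), ω s ≤ h * u := by
    refine omega_le (h * u) ω ha0 hω_smooth.continuousOn hω_init ?_ hω_lim
    intro s hs hgt
    have h1 := hω_ode s hs
    have h2 := hω_pos s hs
    have h3 : 0 < r * (ω s - h * u) * (1 - h * u + ω s) :=
      mul_pos (mul_pos hr (by linarith)) (by linarith)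
    have h4 : 0 < d * deriv (deriv ω) s := by nlinarith
    exact pos_of_mul_pos_right h4 hd.le
  have hωnn : ∀ s ≥ (0:ℝ), 0 ≤ ω s := by
    intro s hs
    rcases hs.lt_or_eq with h1 | h1
    · exact (hω_pos s h1).le
    · rw [← h1, hω_init]
  have hωI : ContDiffOn ℝ 2 ω (Set.Ioi 0) := hω_smooth.mono Set.Ioi_subset_Ici_self
  have hωconc : ConcaveOn ℝ (Set.Ici 0) ω := by
    refine concaveOn_of_deriv2_nonpos (convex_Ici 0) hω_smooth.continuousOn ?_ ?_ ?_
    · rw [interior_Ici]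
      exact hωI.differentiableOn (by norm_num)
    · rw [interior_Ici]
      exact ((contDiffOn_succ_iff_deriv_of_isOpen (n := 1) isOpen_Ioi).1
        (by simpa [one_add_one_eq_two] using hωI)).2.2.differentiableOn (by norm_num)
    · rw [interior_Ici]
      intro s hs
      have hs : 0 < s := hs
      have h1 := hω_ode s hs
      have h2 := hω_pos s hs
      have h5 := hωle s hs.le
      have h3 : 0 ≤ r * (h * u - ω s) * (1 - h * u + ω s) :=
        mul_nonneg (mul_nonneg hr.le (by linarith)) (by linarith)
      simp only [Function.iterate_succ, Function.iterate_zero, Function.comp_apply, id_eq]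
      by_contra! h6
      have := mul_pos hd h6
      linarith
  have hωmono := concave_mono ω hωconc hωnn
  have hφmono : Monotone φbar := by
    intro x y hxy
    rw [hφbar, hφbar]
    split_ifs with h1 h2 h2
    · exact le_rfl
    · rcases (not_lt.1 h2).lt_or_eq with h3 | h3
      · exact (hχ_pos y h3).le
      · rw [← h3, hχ_init]
    · linarith
    · exact hχ_mono.monotoneOn (not_lt.1 h1) (not_lt.1 h2) hxy
  have hψmono : Monotone ψbar := by
    intro x y hxy
    rw [hψbar, hψbar]
    split_ifs with h1 h2 h2
    · have := hωmono (show (0:ℝ) ≤ -y by linarith) (show (0:ℝ) ≤ -x by linarith)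
        (by linarith)
      linarith
    · have := hωnn (-x) (by linarith)
      linarith
    · linarith
    · exact le_rfl
  have hφev : ∀ s > (0:ℝ), φbar =ᶠ[nhds s] χhat := by
    intro s hs
    filter_upwards [lt_mem_nhds hs] with x hx
    rw [hφbar, if_neg (not_lt.2 hx.le)]
  have hψevp : ∀ s > (0:ℝ), ψbar =ᶠ[nhds s] fun _ => h * u := by
    intro s hs
    filter_upwards [lt_mem_nhds hs] with x hx
    rw [hψbar, if_neg (not_lt.2 hx.le)]
  have hψevn : ∀ s < (0:ℝ), ψbar =ᶠ[nhds s] fun x => h * u - ω (-x) := by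
    intro s hs
    filter_upwards [gt_mem_nhds hs] with x hx
    rw [hψbar, if_pos hx]
  refine ⟨?_, ?_, ?_, ?_, ?_, ?_, ?_⟩
  · intro s hs
    have h1 : 0 ≤ c * deriv φbar s := mul_nonneg hc hφmono.deriv_nonneg
    have h2 : deriv (deriv φbar) s = deriv (deriv χhat) s := (hφev s hs).deriv.deriv_eq
    have h3 : φbar s = χhat s := (hφev s hs).eq_of_nhds
    have h4 : ψbar s = h * u := (hψevp s hs).eq_of_nhds
    have h5 := hχ_ode s hs
    have h6 : 1 - k - φbar s + k * ψbar s = u - χhat s := by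
      rw [h3, h4]; linarith
    rw [h6, h2, h3]
    linarith
  · intro s hs
    have h1 : 0 ≤ c * deriv ψbar s := mul_nonneg hc hψmono.deriv_nonneg
    rcases hs.lt_or_gt with hs | hs
    · have h2 : deriv (deriv ψbar) s = - deriv (deriv ω) (-s) := by
        rw [(hψevn s hs).deriv.deriv_eq]
        have : deriv (fun x => h * u - ω (-x)) = fun x => deriv ω (-x) := by
          funext x
          rw [deriv_const_sub, deriv_comp_neg, neg_neg]
        rw [this, deriv_comp_neg]
      have h3 : φbar s = 0 := by rw [hφbar, if_pos hs]
      have h4 : ψbar s = h * u - ω (-s) := (hψevn s hs).eq_of_nhds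
      have h5 := hω_ode (-s) (by linarith)
      rw [h2, h3, h4]
      nlinarith
    · have h2 : deriv (deriv ψbar) s = 0 := by
        rw [(hψevp s hs).deriv.deriv_eq]
        simp
      have h3 : φbar s = χhat s := (hφev s hs).eq_of_nhds
      have h4 : ψbar s = h * u := (hψevp s hs).eq_of_nhds
      have h5 := hχle s hs.le
      have h6 : 0 ≤ r * (1 - h * u) * (h * (u - χhat s)) :=
        mul_nonneg (mul_nonneg hr.le (by linarith)) (mul_nonneg hh0.le (by linarith))
      rw [h2, h3, h4]
      linarith
  · have h1 : derivWithin ψbar (Set.Ioi 0) 0 = 0 := by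
      rw [derivWithin_congr (f := fun _ => h * u)]
      · simp
      · intro x hx
        rw [hψbar, if_neg (not_lt.2 (le_of_lt hx))]
      · rw [hψbar, if_neg (lt_irrefl _)]
    rw [h1]
    exact (hψmono.monotoneOn _).derivWithin_nonneg
  · intro s hs
    rw [hφbar]
    split_ifs with h1
    · rfl
    · rw [le_antisymm hs (not_lt.1 h1), hχ_init]
  · have h1 : Filter.Tendsto (fun x => h * u - ω (-x)) Filter.atBot (nhds (h * u - h * u)) :=
      (hω_lim.comp tendsto_neg_atBot_atTop).const_sub (h * u)
    rw [sub_self] at h1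
    refine h1.congr' ?_
    filter_upwards [Filter.eventually_lt_atBot 0] with x hx
    rw [hψbar, if_pos hx]
  · refine hχ_lim.congr' ?_
    filter_upwards [Filter.eventually_ge_atTop 0] with x hx
    rw [hφbar, if_neg (not_lt.2 hx)]
  · refine tendsto_const_nhds.congr' ?_
    filter_upwards [Filter.eventually_ge_atTop 0] with x hx
    rw [hψbar, if_neg (not_lt.2 hx)]
end

section
/- Fix constants d, r > 0, h, k ∈ (0,1), c ≥ 0, and set u* = (1-k)/(1-hk), v* = (1-h)/(1-hk). Let P₁(μ) = (μ² - cμ - u*)(dμ² - cμ - rv*) - khr·u*·v*, and let μ̂₂ be the larger of the two negative real roots of P₁. Let (φ, ψ) be a semi-wave with speed c. Then there exist positive constants C₁ and C₂ such that (u* - φ(s))·e^{-μ̂₂ s} → C₁ and (ψ(s) - v*)·e^{-μ̂₂ s} → C₂ as s → ∞, and (C₁, C₂) satisfies the eigenvector equations (μ̂₂² - cμ̂₂ - u*)·C₁ + ku*·C₂ = 0 and hrv*·C₁ + (dμ̂₂² - cμ̂₂ - rv*)·C₂ = 0. -/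
open Real Filter Set

noncomputable def vStar (h k : ℝ) : ℝ := (1 - h) / (1 - h * k)

/-- A semi-wave with speed `c` for the system
`φ'' - cφ' + φ(1 - φ - kψ) = 0` on `(0,∞)`,
`dψ'' - cψ' + rψ(1 - ψ - hφ) = 0` on `ℝ`,
with `φ ≡ 0` on `(-∞,0]`, `ψ(-∞) = 1`, `(φ,ψ)(∞) = (u*, v*)`. -/
structure IsSemiWave (d r h k c : ℝ) (φ ψ : ℝ → ℝ) : Prop where
  cont_phi : Continuous φ
  smooth_phi : ContDiffOn ℝ 2 φ (Set.Ici 0)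
  phi_zero : ∀ s ≤ (0:ℝ), φ s = 0
  smooth_psi : ContDiff ℝ 2 ψ
  ode_phi : ∀ s > (0:ℝ),
    deriv (deriv φ) s - c * deriv φ s + φ s * (1 - φ s - k * ψ s) = 0
  phi_deriv_pos : ∀ s > (0:ℝ), 0 < deriv φ s
  ode_psi : ∀ s : ℝ,
    d * deriv (deriv ψ) s - c * deriv ψ s + r * ψ s * (1 - ψ s - h * φ s) = 0
  psi_deriv_neg : ∀ s : ℝ, deriv ψ s < 0
  psi_atBot : Filter.Tendsto ψ Filter.atBot (nhds 1)
  phi_atTop : Filter.Tendsto φ Filter.atTop (nhds (uStar h k))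
  psi_atTop : Filter.Tendsto ψ Filter.atTop (nhds (vStar h k))

/-- The characteristic quartic `P₁(μ)` obtained by linearizing at `(u*, v*)`. -/
noncomputable def P1 (d r h k c μ : ℝ) : ℝ :=
  (μ ^ 2 - c * μ - uStar h k) * (d * μ ^ 2 - c * μ - r * vStar h k) -
    k * h * r * uStar h k * vStar h k


lemma sw_upper_neg {ν : ℝ} (hν : ν < 0) {y n : ℝ → ℝ}
    (hy : ∀ s > (0:ℝ), HasDerivAt y (ν * y s + n s) s)
    (hn : Tendsto n atTop (nhds 0)) (ε : ℝ) (hε : 0 < ε) :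
    ∀ᶠ s in atTop, y s < ε := by
  have h1 : ∀ᶠ s in atTop, n s < (-ν) * (ε / 2) := by
    have : (0:ℝ) < (-ν) * (ε / 2) := by
      have : 0 < -ν := by linarith
      positivity
    exact hn.eventually (gt_mem_nhds this)
  obtain ⟨S0, hS0⟩ := eventually_atTop.1 h1
  set S := max S0 1 with hS
  have hS1 : 1 ≤ S := le_max_right _ _
  have hder : ∀ s, S ≤ s → HasDerivAt (fun s => (y s - ε / 2) * exp (-(ν * s)))
      ((ν * y s + n s) * exp (-(ν * s)) + (y s - ε / 2) * (exp (-(ν * s)) * -(ν * 1))) s := by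
    intro s hs
    have := ((hy s (by linarith)).sub_const (ε / 2)).fun_mul
      (((hasDerivAt_id s).const_mul ν).neg.exp)
    simpa using this
  have hanti : AntitoneOn (fun s => (y s - ε / 2) * exp (-(ν * s))) (Set.Ici S) := by
    apply antitoneOn_of_deriv_nonpos (convex_Ici S)
    · intro s hs
      exact (hder s hs).continuousAt.continuousWithinAt
    · intro s hs
      rw [interior_Ici] at hs
      exact (hder s (le_of_lt hs)).differentiableAt.differentiableWithinAt
    · intro s hs
      rw [interior_Ici] at hs
      rw [(hder s (le_of_lt hs)).deriv]
      have h2 := hS0 s (le_trans (le_max_left _ _) (le_of_lt hs))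
      have h3 := exp_pos (-(ν * s))
      have : (ν * y s + n s) * exp (-(ν * s)) + (y s - ε / 2) * (exp (-(ν * s)) * -(ν * 1))
        = (n s - (-ν) * (ε / 2)) * exp (-(ν * s)) := by ring
      rw [this]
      exact mul_nonpos_of_nonpos_of_nonneg (by linarith) h3.le
  set K := (y S - ε / 2) * exp (-(ν * S))
  have hlim : Tendsto (fun s => K * exp (ν * s)) atTop (nhds 0) := by
    have : Tendsto (fun s => exp (ν * s)) atTop (nhds 0) :=
      tendsto_exp_atBot.comp (tendsto_id.const_mul_atTop_of_neg hν)
    simpa using this.const_mul K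
  filter_upwards [hlim.eventually (gt_mem_nhds (half_pos hε)), eventually_ge_atTop S] with s h4 h5
  have h6 := hanti (Set.mem_Ici.2 le_rfl) (Set.mem_Ici.2 h5) h5
  simp only at h6
  have h7 : y s - ε / 2 ≤ K * exp (ν * s) := by
    have h8 := mul_le_mul_of_nonneg_right h6 (exp_pos (ν * s)).le
    rw [mul_assoc, ← exp_add] at h8
    simpa using h8
  linarith

lemma sw_decay {ν : ℝ} (hν : ν ≠ 0) {y n : ℝ → ℝ}
    (hy : ∀ s > (0:ℝ), HasDerivAt y (ν * y s + n s) s)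
    (hn : Tendsto n atTop (nhds 0)) (B : ℝ) (hB : ∀ᶠ s in atTop, |y s| ≤ B) :
    Tendsto y atTop (nhds 0) := by
  rcases lt_or_gt_of_ne hν with h | h
  · rw [tendsto_order]
    constructor
    · intro a ha
      have := sw_upper_neg h (y := fun s => - y s) (n := fun s => - n s)
        (fun s hs => by
          have := (hy s hs).fun_neg
          exact this.congr_deriv (by ring)) (by simpa using hn.neg) (-a) (by linarith)
      filter_upwards [this] with s hs
      linarith
    · intro a ha
      exact sw_upper_neg h hy hn a ha
  · have hexp : Tendsto (fun s => exp (-(ν * s))) atTop (nhds 0) :=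
      tendsto_exp_neg_atTop_nhds_zero.comp (tendsto_id.const_mul_atTop h)
    have hE : ∀ s, HasDerivAt (fun s => exp (-(ν * s))) (exp (-(ν * s)) * -(ν * 1)) s := by
      intro s
      simpa using (((hasDerivAt_id s).const_mul ν).neg.exp)
    have key := HasDerivAt.lhopital_zero_atTop (l := nhds 0)
      (f := fun s => y s * exp (-(ν * s))) (g := fun s => exp (-(ν * s)))
      (f' := fun s => (ν * y s + n s) * exp (-(ν * s)) + y s * (exp (-(ν * s)) * -(ν * 1)))
      (g' := fun s => exp (-(ν * s)) * -(ν * 1))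
      (by
        filter_upwards [eventually_gt_atTop 0] with s hs
        exact (hy s hs).mul (hE s))
      (Eventually.of_forall hE)
      (Eventually.of_forall fun s => by
        have := exp_pos (-(ν * s))
        have : exp (-(ν * s)) * ν ≠ 0 := by positivity
        simpa using this)
      (by
        refine squeeze_zero_norm' (a := fun s => B * exp (-(ν * s))) ?_ (by simpa using hexp.const_mul B)
        filter_upwards [hB] with s hs
        rw [norm_mul, Real.norm_eq_abs, Real.norm_eq_abs, abs_of_pos (exp_pos _)]
        exact mul_le_mul_of_nonneg_right hs (exp_pos _).le)
      hexp
      (by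
        have : Tendsto (fun s => n s * (-ν)⁻¹) atTop (nhds 0) := by
          simpa using hn.mul_const ((-ν)⁻¹)
        refine this.congr fun s => ?_
        have := exp_pos (-(ν * s))
        field_simp
        ring)
    refine key.congr fun s => ?_
    have := exp_pos (-(ν * s))
    field_simp

/-- Core: positive solution of `Z' = μ Z + N` with `|N| ≤ K w Z`, `w → 0`, `w ≤ K' Z`. -/
lemma sw_core {μ K K' : ℝ} (hμ : μ < 0) (hK : 0 < K) (hK' : 0 < K') {Z N w : ℝ → ℝ}
    (hZ : ∀ s > (0:ℝ), HasDerivAt Z (μ * Z s + N s) s)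
    (hZpos : ∀ s > (0:ℝ), 0 < Z s)
    (hNc : ContinuousOn N (Set.Ioi 0))
    (hN : ∀ s > (0:ℝ), |N s| ≤ K * w s * Z s)
    (hw : Tendsto w atTop (nhds 0))
    (hwZ : ∀ s > (0:ℝ), w s ≤ K' * Z s) :
    ∃ C > (0:ℝ), Tendsto (fun s => Z s * exp (-(μ * s))) atTop (nhds C) := by
  have h1 : ∀ᶠ s in atTop, K * w s < -μ / 2 := by
    have h0 : Tendsto (fun s => K * w s) atTop (nhds 0) := by simpa using hw.const_mul K
    exact h0.eventually (gt_mem_nhds (by linarith))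
  obtain ⟨S0, hS0⟩ := eventually_atTop.1 h1
  set S := max S0 1 with hS
  have hS1 : 1 ≤ S := le_max_right _ _
  have hder : ∀ (ν : ℝ) (s : ℝ), 0 < s → HasDerivAt (fun s => Z s * exp (-(ν * s)))
      ((μ * Z s + N s) * exp (-(ν * s)) + Z s * (exp (-(ν * s)) * -(ν * 1))) s := by
    intro ν s hs
    have := (hZ s hs).fun_mul (((hasDerivAt_id s).const_mul ν).neg.exp)
    simpa using this
  have hanti : AntitoneOn (fun s => Z s * exp (-(μ / 2 * s))) (Set.Ici S) := by
    apply antitoneOn_of_deriv_nonpos (convex_Ici S)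
    · intro s hs
      exact (hder _ s (by linarith [Set.mem_Ici.1 hs])).continuousAt.continuousWithinAt
    · intro s hs
      rw [interior_Ici] at hs
      exact (hder _ s (by linarith [Set.mem_Ioi.1 hs])).differentiableAt.differentiableWithinAt
    · intro s hs
      rw [interior_Ici] at hs
      have hs' := Set.mem_Ioi.1 hs
      have hs0 : 0 < s := by linarith
      rw [(hder _ s hs0).deriv]
      have h2 := hS0 s (le_trans (le_max_left _ _) (le_of_lt hs))
      have h3 := exp_pos (-(μ / 2 * s))
      have h4 := hN s hs0
      have h5 := mul_lt_mul_of_pos_right h2 (hZpos s hs0)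
      have : (μ * Z s + N s) * exp (-(μ / 2 * s)) + Z s * (exp (-(μ / 2 * s)) * -(μ / 2 * 1))
        = (N s - (-μ / 2) * Z s) * exp (-(μ / 2 * s)) := by ring
      rw [this]
      exact mul_nonpos_of_nonpos_of_nonneg (by linarith [le_abs_self (N s)]) h3.le
  set D := Z S * exp (-(μ / 2 * S))
  have hdec : ∀ s ≥ S, Z s ≤ D * exp (μ / 2 * s) := by
    intro s hs
    have h6 := hanti (Set.mem_Ici.2 le_rfl) (Set.mem_Ici.2 hs) hs
    have h8 := mul_le_mul_of_nonneg_right h6 (exp_pos (μ / 2 * s)).le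
    simp only at h8
    rw [mul_assoc, ← exp_add] at h8
    simpa using h8
  -- logarithm
  have hlog : ∀ s ∈ Set.Ioi S, HasDerivAt (fun s => Real.log (Z s) - μ * s) (N s / Z s) s := by
    intro s hs
    have hs0 : 0 < s := by linarith [Set.mem_Ioi.1 hs]
    have hz := hZpos s hs0
    have := ((hZ s hs0).log hz.ne').fun_sub ((hasDerivAt_id s).const_mul μ)
    refine this.congr_deriv ?_
    field_simp
    ring
  have hint : MeasureTheory.IntegrableOn (fun s => N s / Z s) (Set.Ioi S) := by
    have hb : MeasureTheory.IntegrableOn (fun s => K * K' * D * exp (μ / 2 * s)) (Set.Ioi S) :=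
      (integrableOn_exp_mul_Ioi (by linarith) S).const_mul _
    refine MeasureTheory.Integrable.mono' hb ?_ ?_
    · refine ContinuousOn.aestronglyMeasurable ?_ measurableSet_Ioi
      refine ContinuousOn.div (hNc.mono (Set.Ioi_subset_Ioi (by linarith))) ?_ ?_
      · intro s hs
        exact (hZ s (by linarith [Set.mem_Ioi.1 hs])).continuousAt.continuousWithinAt
      · intro s hs
        exact (hZpos s (by linarith [Set.mem_Ioi.1 hs])).ne'
    · refine (MeasureTheory.ae_restrict_iff' measurableSet_Ioi).2 (Eventually.of_forall ?_)
      intro s hs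
      have hs0 : 0 < s := by linarith [Set.mem_Ioi.1 hs]
      have hz := hZpos s hs0
      rw [Real.norm_eq_abs, abs_div, abs_of_pos hz, div_le_iff₀ hz]
      refine (hN s hs0).trans ?_
      refine mul_le_mul_of_nonneg_right ?_ hz.le
      have := (hwZ s hs0).trans (mul_le_mul_of_nonneg_left (hdec s (le_of_lt hs)) hK'.le)
      have := mul_le_mul_of_nonneg_left this hK.le
      linarith
  have hT := MeasureTheory.tendsto_limUnder_of_hasDerivAt_of_integrableOn_Ioi hlog hint
  refine ⟨_, exp_pos _, ((continuous_exp.tendsto _).comp hT).congr' ?_⟩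
  filter_upwards [eventually_gt_atTop 0] with s hs
  simp only [Function.comp]
  rw [sub_eq_add_neg, exp_add, exp_log (hZpos s hs)]

lemma sw_quad_root {d w c : ℝ} (hd : 0 < d) (hw : 0 < w) (hc : 0 ≤ c) :
    (∃ m < (0:ℝ), d * m ^ 2 - c * m - w = 0) ∧ (∃ m > (0:ℝ), d * m ^ 2 - c * m - w = 0) := by
  set q := Real.sqrt (c ^ 2 + 4 * d * w) with hq
  have hdw : 0 < d * w := mul_pos hd hw
  have hq2 : q ^ 2 = c ^ 2 + 4 * d * w := Real.sq_sqrt (by nlinarith)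
  have hq0 : 0 ≤ q := Real.sqrt_nonneg _
  have hqc : c < q := by nlinarith
  refine ⟨⟨(c - q) / (2 * d), div_neg_of_neg_of_pos (by linarith) (by linarith), ?_⟩,
    ⟨(c + q) / (2 * d), div_pos (by linarith) (by linarith), ?_⟩⟩
  · field_simp
    linear_combination hq2
  · field_simp
    linear_combination hq2

lemma sw_quad_neg {d w c m μ : ℝ} (hd : 0 < d) (hc : 0 ≤ c)
    (hm : d * m ^ 2 - c * m - w = 0) (h1 : m < μ) (h2 : μ < 0) : d * μ ^ 2 - c * μ - w < 0 := by
  have h3 : d * μ ^ 2 - c * μ - w = (μ - m) * (d * (μ + m) - c) := by linear_combination hm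
  rw [h3]
  refine mul_neg_of_pos_of_neg (by linarith) ?_
  have := mul_neg_of_pos_of_neg hd (show μ + m < 0 by linarith)
  linarith

lemma sw_large {d c u w g : ℝ} (hd : 0 < d) (hc : 0 ≤ c) (hu : 0 < u)
    (hw : 0 < w) (hg : 0 < g) : ∃ T > (0:ℝ), 1 < T ^ 2 - c * T - u ∧ g < d * T ^ 2 - c * T - w := by
  have h1 : 0 ≤ (c + (w + g + 1)) / d := by positivity
  have h3 : d * ((c + (w + g + 1)) / d) = c + (w + g + 1) := by field_simp
  obtain ⟨q, hq⟩ : ∃ q, q = (c + (w + g + 1)) / d := ⟨_, rfl⟩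
  rw [← hq] at h1 h3
  refine ⟨c + u + 2 + q, by linarith, ?_, ?_⟩
  · have e : (c + u + 2 + q) ^ 2 - c * (c + u + 2 + q) - u
        = (c + u + 1 + q) * (u + 2 + q) + (2 + q) := by ring
    rw [e]
    have : 0 ≤ (c + u + 1 + q) * (u + 2 + q) := mul_nonneg (by linarith) (by linarith)
    linarith
  · have e : d * (c + u + 2 + q) ^ 2 - c * (c + u + 2 + q) - w
        = (c + u + 2 + q) * (d * (c + u + 2) + (w + g + 1)) - w := by
      linear_combination (c + u + 2 + q) * h3
    rw [e]
    have h4 : 0 ≤ d * (c + u + 2) := mul_nonneg hd.le (by linarith)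
    have h5 : 0 ≤ (c + u + 1 + q) * (d * (c + u + 2) + (w + g + 1)) :=
      mul_nonneg (by linarith) (by linarith)
    linarith

lemma sw_roots {d c u w g μ2 : ℝ} (hd : 0 < d) (hc : 0 ≤ c) (hu : 0 < u)
    (hw : 0 < w) (hg : 0 < g) (hguw : g < u * w)
    (hneg : μ2 < 0)
    (hmax : ∀ μ : ℝ, (μ ^ 2 - c * μ - u) * (d * μ ^ 2 - c * μ - w) - g = 0 → μ < 0 → μ ≤ μ2) :
    μ2 ^ 2 - c * μ2 - u < 0 ∧ d * μ2 ^ 2 - c * μ2 - w < 0 ∧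
    ∃ μ1 < μ2, ∃ μ3 > (0:ℝ), ∃ μ4 > μ3,
      (μ1 ^ 2 - c * μ1 - u) * (d * μ1 ^ 2 - c * μ1 - w) - g = 0 ∧
      (μ3 ^ 2 - c * μ3 - u) * (d * μ3 ^ 2 - c * μ3 - w) - g = 0 ∧
      (μ4 ^ 2 - c * μ4 - u) * (d * μ4 ^ 2 - c * μ4 - w) - g = 0 := by
  set P : ℝ → ℝ := fun μ => (μ ^ 2 - c * μ - u) * (d * μ ^ 2 - c * μ - w) - g with hP
  have hPc : Continuous P := by fun_prop
  obtain ⟨⟨m1, hm1, hm1r⟩, ⟨p1, hp1, hp1r⟩⟩ := sw_quad_root one_pos hu hc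
  obtain ⟨⟨m2, hm2, hm2r⟩, -⟩ := sw_quad_root hd hw hc
  have hP0 : 0 < P 0 := by simp only [hP]; nlinarith
  -- the point M
  obtain ⟨M, hM0, hMP, hMA, hMB⟩ : ∃ M < (0:ℝ), P M < 0 ∧
      (∀ μ, M < μ → μ < 0 → μ ^ 2 - c * μ - u < 0) ∧
      (∀ μ, M < μ → μ < 0 → d * μ ^ 2 - c * μ - w < 0) := by
    have hA : ∀ μ, m1 < μ → μ < 0 → μ ^ 2 - c * μ - u < 0 := fun μ h1 h2 => by
      simpa using sw_quad_neg one_pos hc hm1r h1 h2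
    have hB : ∀ μ, m2 < μ → μ < 0 → d * μ ^ 2 - c * μ - w < 0 := fun μ h1 h2 =>
      sw_quad_neg hd hc hm2r h1 h2
    rcases le_total m1 m2 with h | h
    · refine ⟨m2, hm2, ?_, fun μ h1 h2 => hA μ (by linarith) h2, hB⟩
      simp only [hP]; rw [hm2r]; linarith
    · refine ⟨m1, hm1, ?_, hA, fun μ h1 h2 => hB μ (by linarith) h2⟩
      simp only [hP]; rw [one_mul] at hm1r; rw [hm1r]; linarith
  obtain ⟨x, ⟨hx1, hx2⟩, hx⟩ := intermediate_value_Ioo hM0.le hPc.continuousOn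
    (show (0:ℝ) ∈ Set.Ioo (P M) (P 0) from ⟨hMP, hP0⟩)
  have hxμ : M < μ2 := lt_of_lt_of_le hx1 (hmax x hx hx2)
  obtain ⟨T, hT0, hTA, hTB⟩ := sw_large (c := c) hd hc hu hw hg
  have hlarge : ∀ a b : ℝ, 1 < a → g < b → 0 < a * b - g := by
    intro a b ha hb
    have h1 : 0 < (a - 1) * b := mul_pos (by linarith) (by linarith)
    linarith
  have hcT : 0 ≤ c * T := mul_nonneg hc hT0.le
  have hPT : 0 < P T := hlarge _ _ (by linarith) (by linarith)
  have hPmT : 0 < P (-T) := hlarge _ _ (by linarith) (by linarith)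
  have hPp : P p1 < 0 := by
    simp only [hP]; rw [one_mul] at hp1r; rw [hp1r]; linarith
  have hMT : -T < M := by
    by_contra hcon
    push Not at hcon
    have h1 : 0 < (-T) ^ 2 - c * (-T) - u := by linarith
    rcases eq_or_lt_of_le hcon with h | h
    · rw [h] at hMP
      linarith
    · linarith [hMA (-T) h (by linarith)]
  have hpT : p1 < T := by
    have h1 : 0 < (T - p1) * (T + p1 - c) := by linarith
    by_contra hcon
    push Not at hcon
    have h2 : T * (T - c) > 0 := by linarith
    have h3 : 0 < T - c := (pos_iff_pos_of_mul_pos h2).1 hT0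
    have h4 : (T - p1) * (T + p1 - c) ≤ 0 :=
      mul_nonpos_of_nonpos_of_nonneg (by linarith) (by linarith)
    linarith
  obtain ⟨μ1, ⟨ha1, ha2⟩, ha⟩ := intermediate_value_Ioo' hMT.le hPc.continuousOn
    (show (0:ℝ) ∈ Set.Ioo (P M) (P (-T)) from ⟨hMP, hPmT⟩)
  obtain ⟨μ3, ⟨hb1, hb2⟩, hb⟩ := intermediate_value_Ioo' hp1.le hPc.continuousOn
    (show (0:ℝ) ∈ Set.Ioo (P p1) (P 0) from ⟨hPp, hP0⟩)
  obtain ⟨μ4, ⟨hc1, hc2⟩, hc'⟩ := intermediate_value_Ioo hpT.le hPc.continuousOn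
    (show (0:ℝ) ∈ Set.Ioo (P p1) (P T) from ⟨hPp, hPT⟩)
  exact ⟨hMA μ2 hxμ hneg, hMB μ2 hxμ hneg, μ1, by linarith, μ3, hb1, μ4, by linarith, ha, hb, hc'⟩

lemma sw_lagrange {a b c d : ℝ} (h1 : a ≠ b) (h2 : a ≠ c) (h3 : a ≠ d) (h4 : b ≠ c) (h5 : b ≠ d)
    (h6 : c ≠ d) (q0 q1 q2 q3 : ℝ) :
    ((a - b) * (a - c) * (a - d))⁻¹ * (q0 + q1 * a + q2 * a ^ 2 + q3 * a ^ 3) +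
    ((b - a) * (b - c) * (b - d))⁻¹ * (q0 + q1 * b + q2 * b ^ 2 + q3 * b ^ 3) +
    ((c - a) * (c - b) * (c - d))⁻¹ * (q0 + q1 * c + q2 * c ^ 2 + q3 * c ^ 3) +
    ((d - a) * (d - b) * (d - c))⁻¹ * (q0 + q1 * d + q2 * d ^ 2 + q3 * d ^ 3) = q3 := by
  have e1 : a - b ≠ 0 := sub_ne_zero.2 h1
  have e2 : a - c ≠ 0 := sub_ne_zero.2 h2
  have e3 : a - d ≠ 0 := sub_ne_zero.2 h3
  have e4 : b - c ≠ 0 := sub_ne_zero.2 h4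
  have e5 : b - d ≠ 0 := sub_ne_zero.2 h5
  have e6 : c - d ≠ 0 := sub_ne_zero.2 h6
  rw [← neg_sub a b, ← neg_sub a c, ← neg_sub a d, ← neg_sub b c, ← neg_sub b d, ← neg_sub c d]
  field_simp
  ring

/-- The linear functional attached to a left eigenvector. -/
noncomputable def swZ (d c a b μ : ℝ) (U U1 V V1 : ℝ → ℝ) (s : ℝ) : ℝ :=
  a * (U1 s + (μ - c) * U s) + b * (d * V1 s + (d * μ - c) * V s)

/-- The quadratic remainder. -/
noncomputable def swN (r h k a b : ℝ) (U V : ℝ → ℝ) (s : ℝ) : ℝ :=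
  a * (-(U s * (U s - k * V s))) + b * (r * V s * (V s - h * U s))

lemma swZ_deriv {d r h k c u v a b μ : ℝ} (hd : 0 < d) {U U1 V V1 : ℝ → ℝ} {s : ℝ}
    (hU : HasDerivAt U (U1 s) s) (hV : HasDerivAt V (V1 s) s)
    (hU1 : HasDerivAt U1 (c * U1 s + (u - U s) * (U s - k * V s)) s)
    (hV1 : HasDerivAt V1 ((c * V1 s + r * (v + V s) * (V s - h * U s)) / d) s)
    (h1 : a * (μ ^ 2 - c * μ - u) + b * (h * r * v) = 0)
    (h2 : a * (k * u) + b * (d * μ ^ 2 - c * μ - r * v) = 0) :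
    HasDerivAt (swZ d c a b μ U U1 V V1)
      (μ * swZ d c a b μ U U1 V V1 s + swN r h k a b U V s) s := by
  have := ((hU1.fun_add (hU.const_mul (μ - c))).const_mul a).fun_add
    (((hV1.const_mul d).fun_add (hV.const_mul (d * μ - c))).const_mul b)
  refine this.congr_deriv ?_
  rw [mul_div_cancel₀ _ hd.ne']
  simp only [swZ, swN]
  linear_combination (-U s) * h1 - V s * h2

lemma swN_bound {r h k a b : ℝ} (hr : 0 < r) (hh0 : 0 < h) (hh1 : h < 1) (hk0 : 0 < k) (hk1 : k < 1)
    {U V : ℝ → ℝ} {s : ℝ} (hU : 0 < U s) (hV : 0 < V s) :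
    |swN r h k a b U V s| ≤ (|a| + |b| * r) * ((U s + V s) * (U s + V s)) := by
  have hkV : 0 < k * V s := mul_pos hk0 hV
  have hhU : 0 < h * U s := mul_pos hh0 hU
  have hkV' : k * V s ≤ V s := by nlinarith
  have hhU' : h * U s ≤ U s := by nlinarith
  have e1 : |U s * (U s - k * V s)| ≤ (U s + V s) * (U s + V s) := by
    rw [abs_mul, abs_of_pos hU]
    exact mul_le_mul (by linarith) (abs_le.2 ⟨by linarith, by linarith⟩) (abs_nonneg _) (by linarith)
  have e2 : |V s * (V s - h * U s)| ≤ (U s + V s) * (U s + V s) := by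
    rw [abs_mul, abs_of_pos hV]
    exact mul_le_mul (by linarith) (abs_le.2 ⟨by linarith, by linarith⟩) (abs_nonneg _) (by linarith)
  have e3 : swN r h k a b U V s = a * (-(U s * (U s - k * V s))) + (b * r) * (V s * (V s - h * U s)) := by
    simp only [swN]; ring
  rw [e3]
  refine (abs_add_le _ _).trans ?_
  rw [abs_mul, abs_mul (b * r), abs_neg, abs_mul b, abs_of_pos hr, add_mul]
  exact add_le_add (mul_le_mul_of_nonneg_left e1 (abs_nonneg _))
    (mul_le_mul_of_nonneg_left e2 (by positivity))

lemma sw_main {d r h k c u v μ2 : ℝ} (hd : 0 < d) (hr : 0 < r)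
    (hh0 : 0 < h) (hh1 : h < 1) (hk0 : 0 < k) (hk1 : k < 1) (hc : 0 ≤ c) (hu : 0 < u) (hv : 0 < v)
    (hroot : (μ2 ^ 2 - c * μ2 - u) * (d * μ2 ^ 2 - c * μ2 - r * v) - k * h * r * u * v = 0)
    (hneg : μ2 < 0)
    (hmax : ∀ μ : ℝ, (μ ^ 2 - c * μ - u) * (d * μ ^ 2 - c * μ - r * v) - k * h * r * u * v = 0 →
      μ < 0 → μ ≤ μ2)
    {U U1 V V1 : ℝ → ℝ}
    (hU : ∀ s > (0:ℝ), HasDerivAt U (U1 s) s) (hV : ∀ s > (0:ℝ), HasDerivAt V (V1 s) s)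
    (hU1 : ∀ s > (0:ℝ), HasDerivAt U1 (c * U1 s + (u - U s) * (U s - k * V s)) s)
    (hV1 : ∀ s > (0:ℝ), HasDerivAt V1 ((c * V1 s + r * (v + V s) * (V s - h * U s)) / d) s)
    (hUp : ∀ s > (0:ℝ), 0 < U s) (hVp : ∀ s > (0:ℝ), 0 < V s)
    (hU1n : ∀ s > (0:ℝ), U1 s < 0) (hV1n : ∀ s > (0:ℝ), V1 s < 0)
    (hUl : Tendsto U atTop (nhds 0)) (hVl : Tendsto V atTop (nhds 0)) :
    ∃ C₁ > (0:ℝ), ∃ C₂ > (0:ℝ),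
      Tendsto (fun s => U s * exp (-(μ2 * s))) atTop (nhds C₁) ∧
      Tendsto (fun s => V s * exp (-(μ2 * s))) atTop (nhds C₂) ∧
      (μ2 ^ 2 - c * μ2 - u) * C₁ + k * u * C₂ = 0 ∧
      h * r * v * C₁ + (d * μ2 ^ 2 - c * μ2 - r * v) * C₂ = 0 := by
  have hkh : k * h < 1 := by nlinarith
  have hruv : 0 < r * u * v := by positivity
  obtain ⟨hA, hB, μ1, h12, μ3, h3, μ4, h34, hr1, hr3, hr4⟩ := sw_roots (d := d) (c := c) (u := u)
    (w := r * v) (g := k * h * r * u * v) (μ2 := μ2) hd hc hu (by positivity) (by positivity)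
    (by nlinarith) hneg hmax
  -- the principal functional
  set a2 := h * r * v with ha2
  have ha2p : 0 < a2 := by positivity
  set b2 := -(μ2 ^ 2 - c * μ2 - u) with hb2
  have hb2p : 0 < b2 := by rw [hb2]; linarith
  set Z : ℝ → ℝ := fun s => - swZ d c a2 b2 μ2 U U1 V V1 s with hZ
  have hZe : ∀ s, Z s = a2 * (-U1 s) + a2 * (c - μ2) * U s + b2 * d * (-V1 s)
      + b2 * (c - d * μ2) * V s := by
    intro s; simp only [hZ, swZ]; ring
  have hdμ : d * μ2 < 0 := mul_neg_of_pos_of_neg hd hneg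
  have hk1p : 0 < a2 * (c - μ2) := mul_pos ha2p (by linarith)
  have hk2p : 0 < b2 * (c - d * μ2) := mul_pos hb2p (by linarith)
  have hb2d : 0 < b2 * d := mul_pos hb2p hd
  -- bounds
  obtain ⟨M, hM0, hM⟩ : ∃ M > (0:ℝ), ∀ s > (0:ℝ),
      |U s| ≤ M * Z s ∧ |U1 s| ≤ M * Z s ∧ |V s| ≤ M * Z s ∧ |V1 s| ≤ M * Z s ∧ 0 < Z s := by
    refine ⟨a2⁻¹ + (a2 * (c - μ2))⁻¹ + (b2 * d)⁻¹ + (b2 * (c - d * μ2))⁻¹, by positivity, ?_⟩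
    intro s hs
    have t1 := mul_pos ha2p (neg_pos.2 (hU1n s hs))
    have t2 := mul_pos hk1p (hUp s hs)
    have t3 := mul_pos hb2d (neg_pos.2 (hV1n s hs))
    have t4 := mul_pos hk2p (hVp s hs)
    have hZp : 0 < Z s := by rw [hZe]; linarith
    have aux : ∀ q x : ℝ, 0 < q → q * x ≤ Z s → x ≤ q⁻¹ * Z s := by
      intro q x hq hx
      rw [← div_eq_inv_mul, le_div_iff₀ hq]; linarith
    have i1 : 0 < a2⁻¹ * Z s := by positivity
    have i2 : 0 < (a2 * (c - μ2))⁻¹ * Z s := by positivity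
    have i3 : 0 < (b2 * d)⁻¹ * Z s := by positivity
    have i4 : 0 < (b2 * (c - d * μ2))⁻¹ * Z s := by positivity
    have j1 := aux a2 (-U1 s) ha2p (by rw [hZe]; linarith)
    have j2 := aux _ (U s) hk1p (by rw [hZe]; linarith)
    have j3 := aux _ (-V1 s) hb2d (by rw [hZe]; linarith)
    have j4 := aux _ (V s) hk2p (by rw [hZe]; linarith)
    rw [abs_of_pos (hUp s hs), abs_of_pos (hVp s hs), abs_of_neg (hU1n s hs),
      abs_of_neg (hV1n s hs)]
    simp only [add_mul]
    exact ⟨by linarith, by linarith, by linarith, by linarith, hZp⟩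
  set w : ℝ → ℝ := fun s => U s + V s with hw
  have hwl : Tendsto w atTop (nhds 0) := by simpa using hUl.add hVl
  have hwp : ∀ s > (0:ℝ), 0 < w s := fun s hs => add_pos (hUp s hs) (hVp s hs)
  have hwZ : ∀ s > (0:ℝ), w s ≤ 2 * M * Z s := by
    intro s hs
    obtain ⟨e1, -, e2, -, -⟩ := hM s hs
    have := le_abs_self (U s)
    have := le_abs_self (V s)
    simp only [hw]; linarith
  have hNw : ∀ a b : ℝ, ∀ s > (0:ℝ), |swN r h k a b U V s| ≤ (|a| + |b| * r) * (2 * M) * w s * Z s := by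
    intro a b s hs
    refine (swN_bound hr hh0 hh1 hk0 hk1 (hUp s hs) (hVp s hs)).trans ?_
    have e1 : w s * w s ≤ w s * (2 * M * Z s) := mul_le_mul_of_nonneg_left (hwZ s hs) (hwp s hs).le
    have e2 : 0 ≤ |a| + |b| * r := by positivity
    have := mul_le_mul_of_nonneg_left e1 e2
    simp only [hw] at this ⊢
    linarith
  have hUc : ContinuousOn U (Set.Ioi 0) := fun s hs => (hU s hs).continuousAt.continuousWithinAt
  have hVc : ContinuousOn V (Set.Ioi 0) := fun s hs => (hV s hs).continuousAt.continuousWithinAt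
  obtain ⟨C, hC, hCl⟩ := sw_core (μ := μ2) (K := (|a2| + |b2| * r) * (2 * M)) (K' := 2 * M)
    (Z := Z) (N := fun s => - swN r h k a2 b2 U V s) (w := w) hneg (by positivity) (by positivity)
    (by
      intro s hs
      have := (swZ_deriv (a := a2) (b := b2) (μ := μ2) hd (hU s hs) (hV s hs) (hU1 s hs) (hV1 s hs)
        (by rw [hb2, ha2]; ring) (by rw [hb2, ha2]; linear_combination -hroot)).fun_neg
      refine this.congr_deriv ?_
      simp only [hZ]; ring)
    (fun s hs => (hM s hs).2.2.2.2)
    (by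
      simp only [swN]
      fun_prop)
    (by intro s hs; rw [abs_neg]; exact hNw a2 b2 s hs)
    hwl hwZ
  -- the other functionals decay faster
  have hfast : ∀ a b μ : ℝ, μ ≠ μ2 → a * (μ ^ 2 - c * μ - u) + b * (h * r * v) = 0 →
      a * (k * u) + b * (d * μ ^ 2 - c * μ - r * v) = 0 →
      Tendsto (fun s => swZ d c a b μ U U1 V V1 s * exp (-(μ2 * s))) atTop (nhds 0) := by
    intro a b μ hμ h1 h2
    have hZb : ∀ᶠ s in atTop, Z s * exp (-(μ2 * s)) < C + 1 :=
      hCl.eventually (gt_mem_nhds (by linarith))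
    refine sw_decay (ν := μ - μ2) (sub_ne_zero.2 hμ)
      (n := fun s => swN r h k a b U V s * exp (-(μ2 * s))) ?_ ?_
      (((|a| * (1 + |μ - c|) + |b| * (d + |d * μ - c|)) * M) * (C + 1)) ?_
    · intro s hs
      have e := swZ_deriv (a := a) (b := b) (μ := μ) hd (hU s hs) (hV s hs) (hU1 s hs) (hV1 s hs) h1 h2
      have := e.fun_mul (((hasDerivAt_id s).const_mul μ2).fun_neg.exp)
      simp only [id] at this
      refine this.congr_deriv ?_
      ring
    · have hlim : Tendsto (fun s => ((|a| + |b| * r) * (2 * M)) * w s * (C + 1)) atTop (nhds 0) := by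
        simpa using (hwl.const_mul ((|a| + |b| * r) * (2 * M))).mul_const (C + 1)
      refine squeeze_zero_norm' ?_ hlim
      filter_upwards [hZb, eventually_gt_atTop 0] with s hs hs0
      rw [norm_mul, Real.norm_eq_abs, Real.norm_eq_abs, abs_of_pos (exp_pos _)]
      have e1 := mul_le_mul_of_nonneg_right (hNw a b s hs0) (exp_pos (-(μ2 * s))).le
      refine e1.trans ?_
      rw [mul_assoc]
      refine mul_le_mul_of_nonneg_left hs.le ?_
      have := hwp s hs0
      positivity
    · filter_upwards [hZb, eventually_gt_atTop 0] with s hs hs0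
      rw [abs_mul, abs_of_pos (exp_pos _)]
      obtain ⟨e1, e2, e3, e4, e5⟩ := hM s hs0
      have f1 : |swZ d c a b μ U U1 V V1 s| ≤
          ((|a| * (1 + |μ - c|) + |b| * (d + |d * μ - c|)) * M) * Z s := by
        simp only [swZ]
        refine (abs_add_le _ _).trans ?_
        rw [abs_mul, abs_mul b]
        have g1 : |U1 s + (μ - c) * U s| ≤ (1 + |μ - c|) * (M * Z s) := by
          refine (abs_add_le _ _).trans ?_
          rw [abs_mul]
          have := mul_le_mul_of_nonneg_left e1 (abs_nonneg (μ - c))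
          linarith
        have g2 : |d * V1 s + (d * μ - c) * V s| ≤ (d + |d * μ - c|) * (M * Z s) := by
          refine (abs_add_le _ _).trans ?_
          rw [abs_mul, abs_mul, abs_of_pos hd]
          have := mul_le_mul_of_nonneg_left e3 (abs_nonneg (d * μ - c))
          have := mul_le_mul_of_nonneg_left e4 hd.le
          linarith
        have := mul_le_mul_of_nonneg_left g1 (abs_nonneg a)
        have := mul_le_mul_of_nonneg_left g2 (abs_nonneg b)
        linarith
      have f2 := mul_le_mul_of_nonneg_right f1 (exp_pos (-(μ2 * s))).le
      refine f2.trans ?_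
      rw [mul_assoc]
      exact mul_le_mul_of_nonneg_left hs.le (by positivity)
  have h2l : Tendsto (fun s => swZ d c a2 b2 μ2 U U1 V V1 s * exp (-(μ2 * s))) atTop (nhds (-C)) := by
    refine hCl.neg.congr fun s => ?_
    simp only [hZ]; ring
  -- distinctness
  have n12 : μ1 ≠ μ2 := h12.ne
  have n13 : μ1 ≠ μ3 := by apply ne_of_lt; linarith
  have n14 : μ1 ≠ μ4 := by apply ne_of_lt; linarith
  have n23 : μ2 ≠ μ3 := by apply ne_of_lt; linarith
  have n24 : μ2 ≠ μ4 := by apply ne_of_lt; linarith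
  have n34 : μ3 ≠ μ4 := by apply ne_of_lt; linarith
  set l1 := ((μ1 - μ2) * (μ1 - μ3) * (μ1 - μ4))⁻¹ with hl1
  set l2 := ((μ2 - μ1) * (μ2 - μ3) * (μ2 - μ4))⁻¹ with hl2
  set l3 := ((μ3 - μ1) * (μ3 - μ2) * (μ3 - μ4))⁻¹ with hl3
  set l4 := ((μ4 - μ1) * (μ4 - μ2) * (μ4 - μ3))⁻¹ with hl4
  have hl2p : 0 < l2 := by
    rw [hl2]
    have : 0 < (μ2 - μ1) * (μ2 - μ3) * (μ2 - μ4) :=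
      mul_pos_of_neg_of_neg (mul_neg_of_pos_of_neg (by linarith) (by linarith)) (by linarith)
    positivity
  have hcomb : ∀ (f1 f2 f3 f4 : ℝ → ℝ) (D : ℝ), Tendsto f1 atTop (nhds 0) →
      Tendsto f2 atTop (nhds D) → Tendsto f3 atTop (nhds 0) → Tendsto f4 atTop (nhds 0) →
      Tendsto (fun s => -(l1 * f1 s + l2 * f2 s + l3 * f3 s + l4 * f4 s) / d) atTop
        (nhds (-(l2 * D) / d)) := by
    intro f1 f2 f3 f4 D t1 t2 t3 t4
    have := ((((t1.const_mul l1).add (t2.const_mul l2)).add (t3.const_mul l3)).add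
      (t4.const_mul l4)).neg.div_const d
    simpa using this
  have hBa : 0 < -(d * μ2 ^ 2 - c * μ2 - r * v) / a2 := div_pos (by linarith) ha2p
  refine ⟨l2 * C / d * (-(d * μ2 ^ 2 - c * μ2 - r * v) / a2), by positivity, l2 * C / d,
    by positivity, ?_, ?_, ?_, ?_⟩
  · have hgen : ∀ μ : ℝ, μ ≠ μ2 →
        (μ ^ 2 - c * μ - u) * (d * μ ^ 2 - c * μ - r * v) - k * h * r * u * v = 0 →
        Tendsto (fun s => swZ d c (-(d * μ ^ 2 - c * μ - r * v)) (k * u) μ U U1 V V1 s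
          * exp (-(μ2 * s))) atTop (nhds 0) := fun μ hμ hP =>
      hfast _ _ μ hμ (by linear_combination -hP) (by ring)
    have h2l' : Tendsto (fun s => swZ d c (-(d * μ2 ^ 2 - c * μ2 - r * v)) (k * u) μ2 U U1 V V1 s
          * exp (-(μ2 * s))) atTop (nhds (-(d * μ2 ^ 2 - c * μ2 - r * v) / a2 * -C)) := by
      refine (h2l.const_mul (-(d * μ2 ^ 2 - c * μ2 - r * v) / a2)).congr fun s => ?_
      have e1 : -(d * μ2 ^ 2 - c * μ2 - r * v) / a2 * a2 = -(d * μ2 ^ 2 - c * μ2 - r * v) := by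
        field_simp
      have e2 : -(d * μ2 ^ 2 - c * μ2 - r * v) / a2 * b2 = k * u := by
        rw [div_mul_eq_mul_div, div_eq_iff ha2p.ne', hb2, ha2]
        linear_combination hroot
      simp only [swZ]
      linear_combination (U1 s + (μ2 - c) * U s) * exp (-(μ2 * s)) * e1 +
        (d * V1 s + (d * μ2 - c) * V s) * exp (-(μ2 * s)) * e2
    have := hcomb _ _ _ _ _ (hgen μ1 n12 hr1) h2l' (hgen μ3 n23.symm hr3) (hgen μ4 n24.symm hr4)
    convert this using 1
    · funext s
      have key := sw_lagrange n12 n13 n14 n23 n24 n34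
        (r * v * (U1 s - c * U s) + k * u * (d * V1 s - c * V s))
        (c * (U1 s - c * U s) + r * v * U s + k * u * d * V s)
        (-(d * (U1 s - c * U s) - c * U s)) (-(d * U s))
      rw [← hl1, ← hl2, ← hl3, ← hl4] at key
      rw [eq_div_iff hd.ne']
      simp only [swZ]
      linear_combination exp (-(μ2 * s)) * key
    · congr 1; ring
  · have hgen : ∀ μ : ℝ, μ ≠ μ2 →
        (μ ^ 2 - c * μ - u) * (d * μ ^ 2 - c * μ - r * v) - k * h * r * u * v = 0 →
        Tendsto (fun s => swZ d c a2 (-(μ ^ 2 - c * μ - u)) μ U U1 V V1 s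
          * exp (-(μ2 * s))) atTop (nhds 0) := fun μ hμ hP =>
      hfast _ _ μ hμ (by rw [ha2]; ring) (by rw [ha2]; linear_combination -hP)
    have := hcomb _ _ _ _ _ (hgen μ1 n12 hr1) h2l (hgen μ3 n23.symm hr3) (hgen μ4 n24.symm hr4)
    convert this using 1
    · funext s
      have key := sw_lagrange n12 n13 n14 n23 n24 n34
        (a2 * U1 s - a2 * c * U s + u * (d * V1 s - c * V s))
        (a2 * U s + c * (d * V1 s - c * V s) + u * (d * V s))
        (-((d * V1 s - c * V s) - c * (d * V s))) (-(d * V s))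
      rw [← hl1, ← hl2, ← hl3, ← hl4] at key
      rw [eq_div_iff hd.ne']
      simp only [swZ, hb2]
      linear_combination exp (-(μ2 * s)) * key
    · congr 1; ring
  · have e2 : -(d * μ2 ^ 2 - c * μ2 - r * v) / a2 * b2 = k * u := by
      rw [div_mul_eq_mul_div, div_eq_iff ha2p.ne', hb2, ha2]
      linear_combination hroot
    rw [hb2] at e2
    linear_combination -(l2 * C / d) * e2
  · have e1 : -(d * μ2 ^ 2 - c * μ2 - r * v) / a2 * a2 = -(d * μ2 ^ 2 - c * μ2 - r * v) := by
      field_simp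
    linear_combination (l2 * C / d) * e1

theorem stmt4 (d r h k c : ℝ) (hd : 0 < d) (hr : 0 < r)
    (hh : h ∈ Set.Ioo (0:ℝ) 1) (hk : k ∈ Set.Ioo (0:ℝ) 1) (hc : 0 ≤ c)
    (μ2 : ℝ) (hμ2_root : P1 d r h k c μ2 = 0) (hμ2_neg : μ2 < 0)
    (hμ2_max : ∀ μ : ℝ, P1 d r h k c μ = 0 → μ < 0 → μ ≤ μ2)
    (φ ψ : ℝ → ℝ) (hsw : IsSemiWave d r h k c φ ψ) :
    ∃ C₁ > (0:ℝ), ∃ C₂ > (0:ℝ),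
      Filter.Tendsto (fun s => (uStar h k - φ s) * Real.exp (-(μ2 * s)))
        Filter.atTop (nhds C₁) ∧
      Filter.Tendsto (fun s => (ψ s - vStar h k) * Real.exp (-(μ2 * s)))
        Filter.atTop (nhds C₂) ∧
      (μ2 ^ 2 - c * μ2 - uStar h k) * C₁ + k * uStar h k * C₂ = 0 ∧
      h * r * vStar h k * C₁ + (d * μ2 ^ 2 - c * μ2 - r * vStar h k) * C₂ = 0 := by
  obtain ⟨hh0, hh1⟩ := hh
  obtain ⟨hk0, hk1⟩ := hk
  have hhk : 0 < 1 - h * k := by nlinarith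
  have hu : 0 < uStar h k := div_pos (by linarith) hhk
  have hv : 0 < vStar h k := div_pos (by linarith) hhk
  have huv : uStar h k + k * vStar h k = 1 := by
    have hne : 1 - h * k ≠ 0 := hhk.ne'
    simp only [uStar, vStar]
    rw [← mul_div_assoc, ← add_div, div_eq_one_iff_eq hne]
    ring
  have hvu : vStar h k + h * uStar h k = 1 := by
    have hne : 1 - h * k ≠ 0 := hhk.ne'
    simp only [uStar, vStar]
    rw [← mul_div_assoc, ← add_div, div_eq_one_iff_eq hne]
    ring
  have hφ2 : ∀ s > (0:ℝ), ContDiffAt ℝ 2 φ s := fun s hs =>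
    hsw.smooth_phi.contDiffAt (Ici_mem_nhds hs)
  have hφd : ∀ s > (0:ℝ), HasDerivAt φ (deriv φ s) s := fun s hs =>
    ((hφ2 s hs).differentiableAt (by norm_num)).hasDerivAt
  have hφdd : ∀ s > (0:ℝ), HasDerivAt (deriv φ) (deriv (deriv φ) s) s := fun s hs =>
    ((((hφ2 s hs).derivWithin (m := 1) (by norm_num)).differentiableAt (by norm_num))).hasDerivAt
  have hψd : ∀ s, HasDerivAt ψ (deriv ψ s) s := fun s =>
    (hsw.smooth_psi.differentiable (by norm_num) s).hasDerivAt
  have hψdd : ∀ s, HasDerivAt (deriv ψ) (deriv (deriv ψ) s) s := fun s =>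
    ((hsw.smooth_psi.iterate_deriv' 1 1).differentiable (by norm_num) s).hasDerivAt
  have hφm : StrictMonoOn φ (Set.Ici 0) := by
    refine strictMonoOn_of_deriv_pos (convex_Ici 0) hsw.cont_phi.continuousOn ?_
    intro s hs
    rw [interior_Ici] at hs
    exact hsw.phi_deriv_pos s hs
  have hψm : StrictAnti ψ := strictAnti_of_deriv_neg hsw.psi_deriv_neg
  have hφlt : ∀ s > (0:ℝ), φ s < uStar h k := by
    intro s hs
    have h1 : φ s < φ (s + 1) := hφm (Set.mem_Ici.2 hs.le) (Set.mem_Ici.2 (by linarith)) (by linarith)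
    refine lt_of_lt_of_le h1 (ge_of_tendsto hsw.phi_atTop ?_)
    filter_upwards [eventually_ge_atTop (s + 1)] with t ht
    exact hφm.monotoneOn (Set.mem_Ici.2 (by linarith)) (Set.mem_Ici.2 (by linarith)) ht
  have hψgt : ∀ s, vStar h k < ψ s := by
    intro s
    have h1 : ψ (s + 1) < ψ s := hψm (by linarith)
    refine lt_of_le_of_lt (le_of_tendsto hsw.psi_atTop ?_) h1
    filter_upwards [eventually_ge_atTop (s + 1)] with t ht
    exact hψm.antitone ht
  refine sw_main (U := fun s => uStar h k - φ s) (U1 := fun s => - deriv φ s)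
    (V := fun s => ψ s - vStar h k) (V1 := fun s => deriv ψ s) hd hr hh0 hh1 hk0 hk1 hc hu hv
    hμ2_root hμ2_neg hμ2_max ?_ ?_ ?_ ?_ ?_ ?_ ?_ ?_ ?_ ?_
  · intro s hs
    exact (hφd s hs).const_sub _
  · intro s hs
    exact (hψd s).sub_const _
  · intro s hs
    refine (hφdd s hs).fun_neg.congr_deriv ?_
    linear_combination -hsw.ode_phi s hs - φ s * huv
  · intro s hs
    refine (hψdd s).congr_deriv ?_
    rw [eq_div_iff hd.ne']
    linear_combination hsw.ode_psi s + r * ψ s * hvu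
  · intro s hs
    exact sub_pos.2 (hφlt s hs)
  · intro s hs
    exact sub_pos.2 (hψgt s)
  · intro s hs
    exact neg_neg_iff_pos.2 (hsw.phi_deriv_pos s hs)
  · intro s hs
    exact hsw.psi_deriv_neg s
  · simpa using hsw.phi_atTop.const_sub (uStar h k)
  · simpa using hsw.psi_atTop.sub_const (vStar h k)
end

section
/- Fix constants d, r > 0, h, k ∈ (0,1), c ≥ 0, and set u* = (1-k)/(1-hk), v* = (1-h)/(1-hk). Define the quartic polynomial P₁(μ) = (μ² - cμ - u*)(dμ² - cμ - rv*) - khr·u*·v*, and set μ₁^± = (c ± √(c² + 4u*))/2 and μ₂^± = (c ± √(c² + 4drv*))/(2d) (the roots of μ² - cμ - u* = 0 and dμ² - cμ - rv* = 0, respectively). Then P₁ has four distinct real roots μ̂₁ < μ̂₂ < μ̂₃ < μ̂₄ satisfying μ̂₁ < min(μ₁⁻, μ₂⁻) ≤ max(μ₁⁻, μ₂⁻) < μ̂₂ < 0 < μ̂₃ < min(μ₁⁺, μ₂⁺) ≤ max(μ₁⁺, μ₂⁺) < μ̂₄. -/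
open Real Filter Set

theorem quartic_lead_zero (A B C D E x y z w v : ℝ)
    (hx : A * x ^ 4 + B * x ^ 3 + C * x ^ 2 + D * x + E = 0)
    (hy : A * y ^ 4 + B * y ^ 3 + C * y ^ 2 + D * y + E = 0)
    (hz : A * z ^ 4 + B * z ^ 3 + C * z ^ 2 + D * z + E = 0)
    (hw : A * w ^ 4 + B * w ^ 3 + C * w ^ 2 + D * w + E = 0)
    (hv : A * v ^ 4 + B * v ^ 3 + C * v ^ 2 + D * v + E = 0)
    (hxy : x ≠ y) (hxz : x ≠ z) (hxw : x ≠ w) (hxv : x ≠ v) (hyz : y ≠ z) (hyw : y ≠ w)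
    (hyv : y ≠ v) (hzw : z ≠ w) (hzv : z ≠ v) (hwv : w ≠ v) : A = 0 := by
  have d1 : ∀ t, x ≠ t → A * t ^ 4 + B * t ^ 3 + C * t ^ 2 + D * t + E = 0 →
      A * (x ^ 3 + x ^ 2 * t + x * t ^ 2 + t ^ 3) + B * (x ^ 2 + x * t + t ^ 2)
        + C * (x + t) + D = 0 := by
    intro t ht h
    apply mul_left_cancel₀ (sub_ne_zero.mpr ht)
    linear_combination hx - h
  have ey := d1 y hxy hy
  have d2 : ∀ t, x ≠ t → y ≠ t → A * t ^ 4 + B * t ^ 3 + C * t ^ 2 + D * t + E = 0 →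
      A * (x ^ 2 + x * (y + t) + y ^ 2 + y * t + t ^ 2) + B * (x + y + t) + C = 0 := by
    intro t ht ht' h
    apply mul_left_cancel₀ (sub_ne_zero.mpr ht')
    linear_combination ey - d1 t ht h
  have ez := d2 z hxz hyz hz
  have d3 : ∀ t, x ≠ t → y ≠ t → z ≠ t →
      A * t ^ 4 + B * t ^ 3 + C * t ^ 2 + D * t + E = 0 →
      A * (x + y + z + t) + B = 0 := by
    intro t ht ht' ht2 h
    apply mul_left_cancel₀ (sub_ne_zero.mpr ht2)
    linear_combination ez - d2 t ht ht' h
  apply mul_left_cancel₀ (sub_ne_zero.mpr hwv)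
  linear_combination d3 w hxw hyw hzw hw - d3 v hxv hyv hzv hv

theorem quad_facts (d c q : ℝ) (hd : 0 < d) (hq : 0 < q) :
    (c - Real.sqrt (c ^ 2 + 4 * d * q)) / (2 * d) < 0 ∧
    0 < (c + Real.sqrt (c ^ 2 + 4 * d * q)) / (2 * d) ∧
    ∀ x, d * x ^ 2 - c * x - q = d * (x - (c - Real.sqrt (c ^ 2 + 4 * d * q)) / (2 * d)) *
      (x - (c + Real.sqrt (c ^ 2 + 4 * d * q)) / (2 * d)) := by
  have hdq : 0 < d * q := mul_pos hd hq
  have hs := Real.sq_sqrt (show 0 ≤ c ^ 2 + 4 * d * q by nlinarith [sq_nonneg c])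
  have hs0 := Real.sqrt_nonneg (c ^ 2 + 4 * d * q)
  set s := Real.sqrt (c ^ 2 + 4 * d * q)
  have ⟨h1, h2⟩ := abs_lt_of_sq_lt_sq' (show c ^ 2 < s ^ 2 by nlinarith) hs0
  refine ⟨div_neg_of_neg_of_pos (by linarith) (by linarith),
    div_pos (by linarith) (by linarith), fun x => ?_⟩
  field_simp
  linear_combination hs

theorem abstract_roots (f : ℝ → ℝ) (hf : Continuous f) (d K a₁ b₁ a₂ b₂ : ℝ) (hd : 0 < d)
    (hK : 0 < K) (ha₁ : a₁ < 0) (ha₂ : a₂ < 0) (hb₁ : 0 < b₁) (hb₂ : 0 < b₂)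
    (hP : ∀ x, f x = d * ((x - a₁) * (x - b₁) * ((x - a₂) * (x - b₂))) - K) (h0 : 0 < f 0) :
    ∃ m₁ m₂ m₃ m₄ : ℝ, f m₁ = 0 ∧ f m₂ = 0 ∧ f m₃ = 0 ∧ f m₄ = 0 ∧
      m₁ < min a₁ a₂ ∧ max a₁ a₂ < m₂ ∧ m₂ < 0 ∧ 0 < m₃ ∧ m₃ < min b₁ b₂ ∧
      max b₁ b₂ < m₄ := by
  have fa₁ : f a₁ < 0 := by rw [hP]; simp [hK]
  have fa₂ : f a₂ < 0 := by rw [hP]; simp [hK]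
  have fb₁ : f b₁ < 0 := by rw [hP]; simp [hK]
  have fb₂ : f b₂ < 0 := by rw [hP]; simp [hK]
  have e1 : f (min a₁ a₂) < 0 := by rcases min_choice a₁ a₂ with h | h <;> rw [h] <;> assumption
  have e2 : f (max a₁ a₂) < 0 := by rcases max_choice a₁ a₂ with h | h <;> rw [h] <;> assumption
  have e3 : f (min b₁ b₂) < 0 := by rcases min_choice b₁ b₂ with h | h <;> rw [h] <;> assumption
  have e4 : f (max b₁ b₂) < 0 := by rcases max_choice b₁ b₂ with h | h <;> rw [h] <;> assumption
  obtain ⟨t, ht0, ht⟩ : ∃ t : ℝ, 0 < t ∧ K < d * (t * t * (t * t)) := by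
    have hp : 0 < K / d := div_pos hK hd
    refine ⟨1 + K / d, by positivity, ?_⟩
    have h1 : K = d * (K / d) := by field_simp
    generalize K / d = q at *
    rw [h1]
    apply mul_lt_mul_of_pos_left _ hd
    nlinarith [mul_pos hp hp, mul_pos (mul_pos hp hp) hp, mul_pos (mul_pos hp hp) (mul_pos hp hp)]
  have big : ∀ p q r s : ℝ, t ≤ p → t ≤ q → t ≤ r → t ≤ s → 0 < d * (p * q * (r * s)) - K := by
    intro p q r s h1 h2 h3 h4
    have hp : 0 < p := by linarith
    have hq : 0 < q := by linarith
    have hr : 0 < r := by linarith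
    have : t * t * (t * t) ≤ p * q * (r * s) := by gcongr
    nlinarith
  have er : 0 < f (max b₁ b₂ + t) := by
    rw [hP]
    have := le_max_left b₁ b₂
    have := le_max_right b₁ b₂
    apply big <;> linarith
  have el : 0 < f (min a₁ a₂ - t) := by
    have := min_le_left a₁ a₂
    have := min_le_right a₁ a₂
    have h := big (a₁ - (min a₁ a₂ - t)) (b₁ - (min a₁ a₂ - t)) (a₂ - (min a₁ a₂ - t))
      (b₂ - (min a₁ a₂ - t)) (by linarith) (by linarith) (by linarith) (by linarith)
    rw [hP]
    linarith
  have up : ∀ x y, x < y → f x < 0 → 0 < f y → ∃ m, f m = 0 ∧ x < m ∧ m < y := by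
    intro x y hxy hx hy
    obtain ⟨m, hm, h⟩ := intermediate_value_Ioo hxy.le hf.continuousOn ⟨hx, hy⟩
    exact ⟨m, h, hm.1, hm.2⟩
  have dn : ∀ x y, x < y → 0 < f x → f y < 0 → ∃ m, f m = 0 ∧ x < m ∧ m < y := by
    intro x y hxy hx hy
    obtain ⟨m, hm, h⟩ := intermediate_value_Ioo' hxy.le hf.continuousOn ⟨hy, hx⟩
    exact ⟨m, h, hm.1, hm.2⟩
  obtain ⟨m₁, h1, -, l1⟩ := dn _ _ (by linarith) el e1
  obtain ⟨m₂, h2, l2, l2'⟩ := up _ _ (max_lt ha₁ ha₂) e2 h0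
  obtain ⟨m₃, h3, l3, l3'⟩ := dn _ _ (lt_min hb₁ hb₂) h0 e3
  obtain ⟨m₄, h4, l4, -⟩ := up _ _ (by linarith) e4 er
  exact ⟨m₁, m₂, m₃, m₄, h1, h2, h3, h4, l1, l2, l2', l3, l3', l4⟩

theorem stmt5 (d r h k c : ℝ) (hd : 0 < d) (hr : 0 < r)
    (hh : h ∈ Set.Ioo (0:ℝ) 1) (hk : k ∈ Set.Ioo (0:ℝ) 1) (hc : 0 ≤ c) :
    ∃ m₁ m₂ m₃ m₄ : ℝ,
      P1 d r h k c m₁ = 0 ∧ P1 d r h k c m₂ = 0 ∧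
      P1 d r h k c m₃ = 0 ∧ P1 d r h k c m₄ = 0 ∧
      m₁ < m₂ ∧ m₂ < 0 ∧ 0 < m₃ ∧ m₃ < m₄ ∧
      m₁ < min ((c - Real.sqrt (c ^ 2 + 4 * uStar h k)) / 2)
               ((c - Real.sqrt (c ^ 2 + 4 * d * r * vStar h k)) / (2 * d)) ∧
      max ((c - Real.sqrt (c ^ 2 + 4 * uStar h k)) / 2)
          ((c - Real.sqrt (c ^ 2 + 4 * d * r * vStar h k)) / (2 * d)) < m₂ ∧
      m₃ < min ((c + Real.sqrt (c ^ 2 + 4 * uStar h k)) / 2)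
               ((c + Real.sqrt (c ^ 2 + 4 * d * r * vStar h k)) / (2 * d)) ∧
      max ((c + Real.sqrt (c ^ 2 + 4 * uStar h k)) / 2)
          ((c + Real.sqrt (c ^ 2 + 4 * d * r * vStar h k)) / (2 * d)) < m₄ ∧
      (∀ μ : ℝ, P1 d r h k c μ = 0 → μ = m₁ ∨ μ = m₂ ∨ μ = m₃ ∨ μ = m₄) := by
  obtain ⟨hh0, hh1⟩ := hh
  obtain ⟨hk0, hk1⟩ := hk
  have hhk : 0 < 1 - h * k := by nlinarith
  have hu : 0 < uStar h k := div_pos (by linarith) hhk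
  have hv : 0 < vStar h k := div_pos (by linarith) hhk
  have hf : Continuous (P1 d r h k c) := by unfold P1; fun_prop
  have hP : ∀ x, P1 d r h k c x = (x ^ 2 - c * x - uStar h k) *
      (d * x ^ 2 - c * x - r * vStar h k) - k * h * r * uStar h k * vStar h k := fun _ => rfl
  generalize P1 d r h k c = f at *
  generalize uStar h k = u at *
  generalize vStar h k = v at *
  obtain ⟨ha₁, hb₁, q1⟩ := quad_facts 1 c u one_pos hu
  obtain ⟨ha₂, hb₂, q2⟩ := quad_facts d c (r * v) hd (mul_pos hr hv)
  simp only [mul_one, one_mul] at ha₁ hb₁ q1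
  rw [← mul_assoc] at ha₂ hb₂
  simp only [← mul_assoc] at q2
  have hK : 0 < k * h * r * u * v := by positivity
  have h0 : 0 < f 0 := by
    rw [hP]
    have := mul_pos hhk (mul_pos hr (mul_pos hu hv))
    nlinarith
  obtain ⟨m₁, m₂, m₃, m₄, h1, h2, h3, h4, l1, l2, l2', l3, l3', l4⟩ :=
    abstract_roots f hf d _ _ _ _ _ hd hK ha₁ ha₂ hb₁ hb₂
      (fun x => by rw [hP, q1, q2]; ring) h0
  have l12 : m₁ < m₂ := by
    have := l1.trans_le (min_le_max.trans l2.le)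
    exact this
  have l34 : m₃ < m₄ := l3'.trans_le (min_le_max.trans l4.le)
  refine ⟨m₁, m₂, m₃, m₄, h1, h2, h3, h4, l12, l2', l3, l34, l1, l2, l3', l4, ?_⟩
  intro x hx
  by_contra hcon
  simp only [not_or] at hcon
  obtain ⟨n1, n2, n3, n4⟩ := hcon
  have key : ∀ y, f y = 0 → d * y ^ 4 + (-(c + c * d)) * y ^ 3 + (c ^ 2 - r * v - u * d) * y ^ 2
      + (c * r * v + c * u) * y + (u * r * v - k * h * r * u * v) = 0 := by
    intro y hy
    rw [hP] at hy
    linear_combination hy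
  exact hd.ne' (quartic_lead_zero _ _ _ _ _ x m₁ m₂ m₃ m₄ (key _ hx) (key _ h1) (key _ h2)
    (key _ h3) (key _ h4) n1 n2 n3 n4 l12.ne (by linarith : m₁ < m₃).ne
    (by linarith : m₁ < m₄).ne (by linarith : m₂ < m₃).ne (by linarith : m₂ < m₄).ne l34.ne)
end
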